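/- arXiv:1506.04286 — 8 statements merged into one kernel-verified Lean document; each statement's English description precedes it below -/
import Mathlib

section
/- Let p be a prime, M a finitely generated abelian group, N an abelian group, j : M → N a group homomorphism, and Γ a subgroup of M. Let S be an abelian group together with an injective homomorphism δ : M/pM → S and a homomorphism σ : S → N/pN such that σ ∘ δ ∘ π_M = π_N ∘ j, where π_M : M → M/pM and π_N : N → N/pN are the quotient maps. Let X ⊆ N be a subset. Assume: (1) ker(σ) ⊆ δ(π_M(Γ)); and (2) q(X + j(Γ)) ∩ im(σ) ⊆ π_N(j(Γ)). Then every m ∈ M with j(m) ∈ X lies in the saturation Γ̄ = {m ∈ M : ∃ n ≥ 1, n·m ∈ Γ}. (This is the group-theoretic content of Proposition 2.1, with M playing the role of the Mordell–Weil group A(K), N of A(K_p), S of the p-Selmer group, and X of the chosen subset of p-adic points.) -/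
open Pointwise

/-- The subgroup `p·N` of an abelian group `N`. -/
def nSMulSub (p : ℕ) (N : Type*) [AddCommGroup N] : AddSubgroup N where
  carrier := {x | ∃ y : N, p • y = x}
  add_mem' := by rintro a b ⟨y, rfl⟩ ⟨z, rfl⟩; exact ⟨y + z, by rw [smul_add]⟩
  zero_mem' := ⟨0, smul_zero p⟩
  neg_mem' := by rintro a ⟨y, rfl⟩; exact ⟨-y, by rw [smul_neg]⟩

/-- `q(P) = {π(Q) : Q ∈ N, p^n • Q = P for some n ≥ 0}` where `π : N → N/pN`. -/
def qmap (p : ℕ) {N : Type*} [AddCommGroup N] (P : N) : Set (N ⧸ nSMulSub p N) :=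
  {ξ | ∃ Q : N, (∃ n : ℕ, p ^ n • Q = P) ∧ QuotientAddGroup.mk' (nSMulSub p N) Q = ξ}

/-- `q(S) = ⋃_{P ∈ S} q(P)`. -/
def qSet (p : ℕ) {N : Type*} [AddCommGroup N] (S : Set N) : Set (N ⧸ nSMulSub p N) :=
  ⋃ P ∈ S, qmap p P

/-- In a finitely generated abelian group, an element divisible by every power of a prime `p`
is torsion. -/
theorem exists_pos_nsmul_eq_zero_of_forall_pow_dvd {A : Type*} [AddCommGroup A]
    (hA : AddGroup.FG A) {p : ℕ} (hp : p.Prime) (x : A)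
    (hx : ∀ k : ℕ, ∃ y : A, p ^ k • y = x) : ∃ n : ℕ, 1 ≤ n ∧ n • x = 0 := by
  have : Module.Finite ℤ A := Module.Finite.iff_addGroup_fg.mpr hA
  have hmem : x ∈ (⨅ i : ℕ, Ideal.span {(p : ℤ)} ^ i • ⊤ : Submodule ℤ A) := by
    rw [Submodule.mem_iInf]
    intro k
    obtain ⟨y, rfl⟩ := hx k
    have := Submodule.smul_mem_smul
      (Ideal.pow_mem_pow (Ideal.mem_span_singleton_self (p : ℤ)) k)
      (Submodule.mem_top (x := y))
    rwa [← Nat.cast_pow, natCast_zsmul] at this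
  obtain ⟨⟨r, hr⟩, hrx⟩ := (Ideal.mem_iInf_smul_pow_eq_bot_iff _ x).mp hmem
  have hrx : r • x = x := hrx
  refine ⟨(r - 1).natAbs, Nat.one_le_iff_ne_zero.mpr fun h => ?_, ?_⟩
  · have hr1 : r = 1 := by omega
    rw [hr1, Ideal.mem_span_singleton] at hr
    exact hp.one_lt.ne' (Nat.dvd_one.mp (by exact_mod_cast hr))
  · rw [natAbs_nsmul_eq_zero, sub_smul, one_smul, hrx, sub_self]

/-- Proposition 2.1 (group-theoretic content): if `ker σ ⊆ δ(π_M(Γ))` and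
`q(X + j(Γ)) ∩ im σ ⊆ π_N(j(Γ))`, then every `m : M` with `j m ∈ X` lies in the
saturation of `Γ`. -/
theorem stmt0 (p : ℕ) (hp : p.Prime)
    (M N S : Type*) [AddCommGroup M] [AddCommGroup N] [AddCommGroup S]
    (hM : AddGroup.FG M)
    (j : M →+ N) (Γ : AddSubgroup M)
    (δ : M ⧸ nSMulSub p M →+ S) (hδ : Function.Injective δ)
    (σ : S →+ N ⧸ nSMulSub p N)
    (hcomm : ∀ m : M, σ (δ (QuotientAddGroup.mk' (nSMulSub p M) m)) =
      QuotientAddGroup.mk' (nSMulSub p N) (j m))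
    (X : Set N)
    (h1 : ∀ s : S, σ s = 0 →
      s ∈ δ '' (QuotientAddGroup.mk' (nSMulSub p M) '' (Γ : Set M)))
    (h2 : qSet p (X + ⇑j '' (Γ : Set M)) ∩ Set.range σ ⊆
      QuotientAddGroup.mk' (nSMulSub p N) '' (⇑j '' (Γ : Set M)))
    (m : M) (hm : j m ∈ X) :
    ∃ n : ℕ, 1 ≤ n ∧ n • m ∈ Γ := by
  have key : ∀ k : ℕ, ∃ Q : M, ∃ γ ∈ Γ, p ^ k • Q = m + γ := by
    intro k
    induction k with
    | zero => exact ⟨m, 0, Γ.zero_mem, by simp⟩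
    | succ k ih =>
      obtain ⟨Q, γ, hγ, hQ⟩ := ih
      obtain ⟨_, ⟨γ₁, hγ₁, rfl⟩, h₁⟩ := h2
        ⟨Set.mem_biUnion (Set.add_mem_add hm ⟨γ, hγ, rfl⟩)
          ⟨j Q, ⟨k, by rw [← map_nsmul, hQ, map_add]⟩, rfl⟩, ⟨_, hcomm Q⟩⟩
      obtain ⟨_, ⟨γ₂, hγ₂, rfl⟩, h₂⟩ := h1
        (δ (QuotientAddGroup.mk' (nSMulSub p M) (Q - γ₁)))
        (by rw [hcomm, map_sub, map_sub, h₁, sub_self])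
      obtain ⟨R, hR⟩ : -γ₂ + (Q - γ₁) ∈ nSMulSub p M := QuotientAddGroup.eq.mp (hδ h₂)
      refine ⟨R, γ - p ^ k • (γ₁ + γ₂),
        Γ.sub_mem hγ (Γ.nsmul_mem (Γ.add_mem hγ₁ hγ₂) _), ?_⟩
      rw [pow_succ, mul_smul, hR, ← add_sub_assoc m, ← hQ, ← smul_sub]
      congr 1
      abel
  have hFG : AddGroup.FG (M ⧸ Γ) := inferInstance
  obtain ⟨n, hn, hnm⟩ := exists_pos_nsmul_eq_zero_of_forall_pow_dvd hFG hp (m : M ⧸ Γ) (by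
    intro k
    obtain ⟨Q, γ, hγ, hQ⟩ := key k
    refine ⟨(Q : M ⧸ Γ), ?_⟩
    rw [← QuotientAddGroup.mk_nsmul, hQ, QuotientAddGroup.mk_add,
      (QuotientAddGroup.eq_zero_iff γ).mpr hγ, add_zero])
  exact ⟨n, hn, (QuotientAddGroup.eq_zero_iff _).mp (by rwa [QuotientAddGroup.mk_nsmul])⟩
end

section
/- Let p be a prime, N an abelian group with quotient map π : N → N/pN, and Γ ≤ N a subgroup. Fix a complete set of representatives R ⊆ Γ for Γ/pΓ (i.e., every γ ∈ Γ satisfies γ − T ∈ pΓ for exactly one T ∈ R). Let P ∈ N and set 𝒬 = {Q ∈ N : ∃ T ∈ R, p·Q = P + T}. Define an equivalence relation on 𝒬 by Q ∼ Q′ ⟺ Q − Q′ ∈ Γ, and let 𝒬′ be a complete set of representatives for 𝒬/∼. Then q(P + Γ) = (π(P) + π(Γ)) ∪ ⋃_{Q ∈ 𝒬′} q(Q + Γ). -/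
open Pointwise

theorem mem_qSet_singleton_add {p : ℕ} {N : Type*} [AddCommGroup N] {P : N}
    {Γ : AddSubgroup N} {ξ : N ⧸ nSMulSub p N} :
    ξ ∈ qSet p ({P} + (Γ : Set N)) ↔
      ∃ (X : N) (n : ℕ) (γ : N), γ ∈ Γ ∧ p ^ n • X = P + γ ∧
        QuotientAddGroup.mk' (nSMulSub p N) X = ξ := by
  simp only [qSet, qmap, Set.mem_iUnion, exists_prop, Set.mem_ofPred_eq, Set.singleton_add,
    Set.mem_image, SetLike.mem_coe]
  constructor
  · rintro ⟨_, ⟨γ, hγ, rfl⟩, X, ⟨n, hX⟩, hξ⟩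
    exact ⟨X, n, γ, hγ, hX, hξ⟩
  · rintro ⟨X, n, γ, hγ, hX, hξ⟩
    exact ⟨_, ⟨γ, hγ, rfl⟩, X, ⟨n, hX⟩, hξ⟩

theorem mem_singleton_mk_add_image {p : ℕ} {N : Type*} [AddCommGroup N] {P : N}
    {Γ : AddSubgroup N} {ξ : N ⧸ nSMulSub p N} :
    ξ ∈ ({QuotientAddGroup.mk' (nSMulSub p N) P} +
        QuotientAddGroup.mk' (nSMulSub p N) '' (Γ : Set N) : Set (N ⧸ nSMulSub p N)) ↔
      ∃ γ ∈ Γ, QuotientAddGroup.mk' (nSMulSub p N) (P + γ) = ξ := by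
  simp only [Set.singleton_add, Set.image_image, Set.mem_image, SetLike.mem_coe, map_add]

/-- Lemma 2.3: `q(P + Γ) = (π(P) + π(Γ)) ∪ ⋃_{Q ∈ 𝒬'} q(Q + Γ)` where `𝒬'` is a complete
set of representatives modulo `Γ` of `𝒬 = {Q : p·Q ∈ P + R}` and `R ⊆ Γ` is a complete
set of representatives for `Γ/pΓ`. -/
theorem stmt1 (p : ℕ) (hp : p.Prime) (N : Type*) [AddCommGroup N]
    (Γ : AddSubgroup N) (R : Set N) (hRΓ : R ⊆ (Γ : Set N))
    (hR : ∀ γ ∈ Γ, ∃! T, T ∈ R ∧ ∃ δ ∈ Γ, p • δ = γ - T)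
    (P : N)
    (Q' : Set N) (hQ'sub : Q' ⊆ {Q : N | ∃ T ∈ R, p • Q = P + T})
    (hQ'rep : ∀ Q ∈ {Q : N | ∃ T ∈ R, p • Q = P + T}, ∃! Q'', Q'' ∈ Q' ∧ Q - Q'' ∈ Γ) :
    qSet p ({P} + (Γ : Set N)) =
      ({QuotientAddGroup.mk' (nSMulSub p N) P} +
        QuotientAddGroup.mk' (nSMulSub p N) '' (Γ : Set N)) ∪
      ⋃ Q ∈ Q', qSet p ({Q} + (Γ : Set N)) := by
  ext ξ
  simp only [Set.mem_union, Set.mem_iUnion, mem_qSet_singleton_add, exists_prop,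
    mem_singleton_mk_add_image]
  constructor
  · rintro ⟨X, n, γ, hγ, hX, rfl⟩
    cases n with
    | zero => exact Or.inl ⟨γ, hγ, by rw [← hX, pow_zero, one_smul]⟩
    | succ m =>
      right
      obtain ⟨T, ⟨hT, δ, hδ, hδT⟩, -⟩ := hR γ hγ
      have hQ : p • (p ^ m • X - δ) = P + T := by
        rw [smul_sub, ← mul_smul, ← pow_succ', hX, hδT]
        abel
      obtain ⟨Q, ⟨hQ', hQΓ⟩, -⟩ := hQ'rep _ ⟨T, hT, hQ⟩
      exact ⟨Q, hQ', X, m, _, Γ.add_mem hQΓ hδ, by abel, rfl⟩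
  · rintro (⟨γ, hγ, rfl⟩ | ⟨Q, hQ, X, n, γ, hγ, hX, rfl⟩)
    · exact ⟨P + γ, 0, γ, hγ, by rw [pow_zero, one_smul], rfl⟩
    · obtain ⟨T, hT, hQT⟩ := hQ'sub hQ
      refine ⟨X, n + 1, T + p • γ, Γ.add_mem (hRΓ hT) (Γ.nsmul_mem hγ p), ?_, rfl⟩
      rw [pow_succ', mul_smul, hX, smul_add, hQT, add_assoc]
end

section
/- Let p be a prime, d ≥ 0 an integer, F a finite abelian group, and G = ℤ_p^d × F, regarded as a topological abelian group (ℤ_p with its p-adic topology, F discrete). Let Γ ≤ G be a subgroup, write cl(Γ) for its topological closure, and let P ∈ G. Then the following are equivalent: (i) for every n ≥ 0 there exists γ ∈ Γ with P + γ ∈ p^n·G (i.e., sup ν(P + Γ) = ∞); (ii) there exists an element T ∈ G of finite order coprime to p such that P ∈ T + cl(Γ). (This is Lemma 2.4, using that the group of K_p-points of an abelian variety has the form ℤ_p^d × F.) -/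
open Pointwise

/-- A point of `ℤ_p^d × F` lies in the closure of `S` iff for every `n` it agrees with some point
of `S` up to an element of `p^n ℤ_p^d × 0`. -/
theorem mem_closure_padicInt_pi_prod_iff {p : ℕ} [Fact p.Prime] {ι F : Type*} [Fintype ι]
    [TopologicalSpace F] [DiscreteTopology F] {S : Set ((ι → ℤ_[p]) × F)} {c : (ι → ℤ_[p]) × F} :
    c ∈ closure S ↔ ∀ n : ℕ, ∃ s ∈ S, s.2 = c.2 ∧ ∃ y : ι → ℤ_[p], p ^ n • y = c.1 - s.1 := by
  have hp0 : (0 : ℝ) < p := by exact_mod_cast (Fact.out : p.Prime).pos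
  have hbasis : (nhds c).HasBasis (fun i : ℝ × Unit => 0 < i.1 ∧ True)
      (fun i => Metric.closedBall c.1 i.1 ×ˢ {c.2}) := by
    rw [nhds_prod_eq, nhds_discrete F]
    exact Metric.nhds_basis_closedBall.prod (Filter.hasBasis_pure c.2)
  rw [mem_closure_iff_nhds_basis hbasis]
  constructor
  · intro h n
    obtain ⟨s, hs, hd, h2⟩ := h ((p : ℝ) ^ (-n : ℤ), ()) ⟨by positivity, trivial⟩
    have hdvd : ∀ i, ∃ z : ℤ_[p], c.1 i - s.1 i = (p : ℤ_[p]) ^ n * z := by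
      intro i
      rw [← dvd_def, ← Ideal.mem_span_singleton, ← PadicInt.norm_le_pow_iff_mem_span_pow,
        ← dist_eq_norm, dist_comm]
      exact (dist_le_pi_dist s.1 c.1 i).trans hd
    choose y hy using hdvd
    refine ⟨s, hs, h2, y, funext fun i => ?_⟩
    simp [hy i]
  · rintro h ⟨ε, u⟩ ⟨hε, -⟩
    obtain ⟨n, hn⟩ := PadicInt.exists_pow_neg_lt p hε
    obtain ⟨s, hs, h2, y, hy⟩ := h n
    refine ⟨s, hs, ?_, h2⟩
    rw [Metric.mem_closedBall, dist_comm, dist_pi_le_iff hε.le]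
    intro i
    have hi : c.1 i - s.1 i = (p : ℤ_[p]) ^ n * y i := by
      simpa using (congrFun hy i).symm
    rw [dist_eq_norm]
    refine le_trans ?_ hn.le
    rw [PadicInt.norm_le_pow_iff_mem_span_pow, Ideal.mem_span_singleton]
    exact ⟨y i, hi⟩

/-- An element killed by an integer coprime to `m` is divisible by `m`. -/
theorem exists_nsmul_eq_of_coprime {A : Type*} [AddCommGroup A] {k m : ℕ} (h : Nat.Coprime k m)
    {a : A} (ha : k • a = 0) : ∃ b : A, m • b = a := by
  have hb : (1 : ℤ) = k * k.gcdA m + m * k.gcdB m := by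
    simpa [h.gcd_eq_one] using Nat.gcd_eq_gcd_ab k m
  refine ⟨k.gcdB m • a, ?_⟩
  have hka : ((k : ℤ) * k.gcdA m) • a = 0 := by
    rw [mul_comm, mul_smul, natCast_zsmul, ha, smul_zero]
  calc m • k.gcdB m • a = ((k : ℤ) * k.gcdA m + m * k.gcdB m) • a := by
        rw [add_smul, hka, zero_add, mul_smul, natCast_zsmul]
    _ = a := by rw [← hb, one_smul]

/-- Lemma 2.4: in `G = ℤ_p^d × F` (`F` finite, discrete), for a subgroup `Γ` and `P ∈ G`,
`sup ν(P + Γ) = ∞` (i.e. for every `n` some element of the coset `P + Γ` lies in `p^n G`)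
iff `P ∈ T + cl(Γ)` for some point `T` of finite order prime to `p`. -/
theorem stmt2 (p : ℕ) [hp : Fact p.Prime] (d : ℕ) (F : Type*) [AddCommGroup F] [Fintype F]
    [TopologicalSpace F] [DiscreteTopology F]
    (Γ : AddSubgroup ((Fin d → ℤ_[p]) × F)) (P : (Fin d → ℤ_[p]) × F) :
    (∀ n : ℕ, ∃ γ ∈ Γ, ∃ Q : (Fin d → ℤ_[p]) × F, p ^ n • Q = P + γ) ↔
    (∃ T : (Fin d → ℤ_[p]) × F, (∃ k : ℕ, 0 < k ∧ Nat.Coprime k p ∧ k • T = 0) ∧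
      P ∈ {T} + closure (Γ : Set ((Fin d → ℤ_[p]) × F))) := by
  constructor
  · intro h
    obtain ⟨a, m, hpm, hcard⟩ := Nat.exists_eq_pow_mul_and_not_dvd
      (Fintype.card_ne_zero (α := F)) p hp.out.ne_one
    choose γ hγ Q hQ using fun n => h (n + a)
    obtain ⟨f, hf⟩ := Finite.exists_infinite_fiber fun n => p ^ (n + a) • (Q n).2
    have hinf := Set.infinite_coe_iff.mp hf
    have hm0 : 0 < m := Nat.pos_of_ne_zero fun h0 => hpm (h0 ▸ dvd_zero p)
    refine ⟨(0, f), ⟨m, hm0, ((Nat.Prime.coprime_iff_not_dvd hp.out).2 hpm).symm, ?_⟩, ?_⟩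
    · obtain ⟨n, hn⟩ := hinf.nonempty
      have hn : p ^ (n + a) • (Q n).2 = f := hn
      have : m • f = 0 := by
        rw [← hn, smul_smul, show m * p ^ (n + a) = p ^ n * (p ^ a * m) by ring, ← hcard,
          mul_smul, card_nsmul_eq_zero, smul_zero]
      simp [this]
    · refine Set.mem_add.2 ⟨(0, f), rfl, P - (0, f), ?_, add_sub_cancel _ _⟩
      rw [mem_closure_padicInt_pi_prod_iff]
      intro n
      obtain ⟨k, hk, hnk⟩ := hinf.exists_gt n
      have hk : p ^ (k + a) • (Q k).2 = f := hk
      have h1 : p ^ (k + a) • (Q k).1 = P.1 + (γ k).1 := congrArg Prod.fst (hQ k)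
      have h2 : p ^ (k + a) • (Q k).2 = P.2 + (γ k).2 := congrArg Prod.snd (hQ k)
      refine ⟨-γ k, Γ.neg_mem (hγ k), ?_, p ^ (k + a - n) • (Q k).1, ?_⟩
      · change -(γ k).2 = P.2 - f
        rw [← hk, h2]
        abel
      · rw [smul_smul, ← pow_add, Nat.add_sub_cancel' (by omega), h1, Prod.fst_neg, Prod.fst_sub]
        simp
  · rintro ⟨T, ⟨k, -, hkp, hkT⟩, hP⟩ n
    obtain ⟨T', hT', c, hc, rfl⟩ := Set.mem_add.1 hP
    obtain rfl : T' = T := hT'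
    obtain ⟨s, hs, h2, y, hy⟩ := mem_closure_padicInt_pi_prod_iff.1 hc n
    obtain ⟨b, hb⟩ := exists_nsmul_eq_of_coprime (hkp.pow_right n) hkT
    refine ⟨-s, Γ.neg_mem hs, b + (y, 0), ?_⟩
    have hcs : p ^ n • ((y, 0) : (Fin d → ℤ_[p]) × F) = c - s :=
      Prod.ext hy (by simp [h2])
    rw [smul_add, hb, hcs]
    abel
end

section
/- Fermat's Last Theorem holds for the exponents 5, 7, 11, 13 and 17: for each n ∈ {5, 7, 11, 13, 17} there are no positive integers x, y, z with x^n + y^n = z^n. -/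
/-- **Sophie Germain's criterion**, extraction step: in a solution of `x ^ p + y ^ p + z ^ p = 0`
in coprime integers with `p ∤ x`, both `y + z` and `(y ^ p + z ^ p) / (y + z)` are `p`-th powers. -/
theorem exists_pow_eq_add_of_pow_add_pow_add_pow_eq_zero {p : ℕ} (hp : p.Prime) (hodd : Odd p)
    {x y z : ℤ} (h : x ^ p + y ^ p + z ^ p = 0) (hyz : IsCoprime y z) (hx : ¬ (p : ℤ) ∣ x) :
    ∃ A α : ℤ, y + z = A ^ p ∧ (∑ i ∈ Finset.range p, y ^ i * (-z) ^ (p - 1 - i)) = α ^ p := by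
  set T : ℤ := ∑ i ∈ Finset.range p, y ^ i * (-z) ^ (p - 1 - i) with hT
  have hmul : (y + z) * T = (-x) ^ p := by
    have := geom_sum₂_mul y (-z) p
    rw [hodd.neg_pow] at this
    rw [hodd.neg_pow]
    linear_combination this + h
  have hTmod : (y + z) ∣ T - p * y ^ (p - 1) := by
    have h1 : (p : ℤ) * y ^ (p - 1) = ∑ i ∈ Finset.range p, y ^ i * y ^ (p - 1 - i) := by
      rw [Finset.sum_congr rfl (g := fun _ ↦ y ^ (p - 1))]
      · simp
      · intro i hi
        rw [← pow_add]
        congr 1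
        have := Finset.mem_range.1 hi
        lia
    rw [h1, hT, ← Finset.sum_sub_distrib]
    refine Finset.dvd_sum fun i _ ↦ ?_
    rw [← mul_sub]
    refine Dvd.dvd.mul_left (dvd_trans ?_ (sub_dvd_pow_sub_pow (-z) y (p - 1 - i))) _
    exact ⟨-1, by ring⟩
  have hcop : IsCoprime (y + z) T := by
    rw [Int.isCoprime_iff_gcd_eq_one]
    by_contra hg
    obtain ⟨r, hr, hrg⟩ := Nat.exists_prime_and_dvd hg
    have hr' : Prime (r : ℤ) := Nat.prime_iff_prime_int.1 hr
    have hg1 : (r : ℤ) ∣ y + z := (Int.natCast_dvd_natCast.2 hrg).trans (Int.gcd_dvd_left ..)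
    have hg2 : (r : ℤ) ∣ T := (Int.natCast_dvd_natCast.2 hrg).trans (Int.gcd_dvd_right ..)
    have h3 : (r : ℤ) ∣ p * y ^ (p - 1) := by
      have := dvd_sub hg2 (hg1.trans hTmod)
      simpa using this
    rcases hr'.dvd_or_dvd h3 with h4 | h4
    · have : r = p := (Nat.prime_dvd_prime_iff_eq hr hp).1 (by exact_mod_cast h4)
      subst this
      have : (r : ℤ) ∣ (-x) ^ r := hmul ▸ hg1.mul_right T
      exact hx (by simpa using hr'.dvd_of_dvd_pow this)
    · have hy := hr'.dvd_of_dvd_pow h4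
      exact hr'.not_isUnit (hyz.isUnit_of_dvd' hy ((dvd_add_right hy).1 hg1))
  obtain ⟨A, hA⟩ := Int.eq_pow_of_mul_eq_pow_odd_left hcop hodd hmul
  obtain ⟨α, hα⟩ := Int.eq_pow_of_mul_eq_pow_odd_right hcop hodd hmul
  exact ⟨A, α, hA, hα⟩

/-- If the nonzero `p`-th powers modulo `q` (the `N`-th roots of unity, where `q = N * p + 1`) are
never consecutive, then a sum of three of them does not vanish. -/
theorem ZMod.eq_zero_of_pow_add_pow_add_pow_eq_zero {p q N : ℕ} [Fact q.Prime] (hodd : Odd p)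
    (hN : q = N * p + 1) (hcons : ∀ v : ZMod q, v ^ N = 1 → (v + 1) ^ N ≠ 1) {x y z : ZMod q}
    (h : x ^ p + y ^ p + z ^ p = 0) : x = 0 ∨ y = 0 ∨ z = 0 := by
  by_contra! ⟨hx, hy, hz⟩
  have key : ∀ t : ZMod q, t ≠ 0 → (t ^ p) ^ N = 1 := fun t ht ↦ by
    rw [← pow_mul, mul_comm, show N * p = q - 1 by lia]
    exact ZMod.pow_card_sub_one_eq_one ht
  refine hcons _ (key (y / z) (div_ne_zero hy hz)) ?_
  rw [show (y / z) ^ p + 1 = (-x / z) ^ p by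
    rw [div_pow, div_pow, hodd.neg_pow]
    have := pow_ne_zero p hz
    field_simp
    linear_combination h]
  exact key _ (div_ne_zero (neg_ne_zero.2 hx) hz)

/-- **Sophie Germain's theorem** in the situation where the auxiliary prime divides `x`. -/
theorem not_dvd_of_pow_add_pow_add_pow_eq_zero {p q N : ℕ} (hp : p.Prime) (hodd : Odd p)
    [Fact q.Prime] (hN : q = N * p + 1)
    (hcons : ∀ v : ZMod q, v ^ N = 1 → (v + 1) ^ N ≠ 1) (hpow : (p : ZMod q) ^ N ≠ 1)
    {x y z : ℤ} (h : x ^ p + y ^ p + z ^ p = 0) (hxy : IsCoprime x y) (hyz : IsCoprime y z)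
    (hxz : IsCoprime x z) (hx : ¬ (p : ℤ) ∣ x) (hy : ¬ (p : ℤ) ∣ y) (hz : ¬ (p : ℤ) ∣ z) :
    ¬ (q : ℤ) ∣ x := by
  intro hqx
  have hq : Prime (q : ℤ) := Nat.prime_iff_prime_int.1 Fact.out
  obtain ⟨A, α, hA, hα⟩ := exists_pow_eq_add_of_pow_add_pow_add_pow_eq_zero hp hodd h hyz hx
  obtain ⟨B, -, hB, -⟩ := exists_pow_eq_add_of_pow_add_pow_add_pow_eq_zero hp hodd
    (by linear_combination h : y ^ p + x ^ p + z ^ p = 0) hxz hy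
  obtain ⟨C, γ, hC, hγ⟩ := exists_pow_eq_add_of_pow_add_pow_add_pow_eq_zero hp hodd
    (by linear_combination h : z ^ p + x ^ p + y ^ p = 0) hxy hz
  have hx0 : (x : ZMod q) = 0 := (ZMod.intCast_zmod_eq_zero_iff_dvd x q).2 hqx
  have hy0 : (y : ZMod q) ≠ 0 := fun h0 ↦ hq.not_isUnit
    (hxy.isUnit_of_dvd' hqx ((ZMod.intCast_zmod_eq_zero_iff_dvd y q).1 h0))
  have hz0 : (z : ZMod q) ≠ 0 := fun h0 ↦ hq.not_isUnit
    (hxz.isUnit_of_dvd' hqx ((ZMod.intCast_zmod_eq_zero_iff_dvd z q).1 h0))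
  have hA' := congrArg (Int.cast : ℤ → ZMod q) hA
  have hB' := congrArg (Int.cast : ℤ → ZMod q) hB
  have hC' := congrArg (Int.cast : ℤ → ZMod q) hC
  have hα' := congrArg (Int.cast : ℤ → ZMod q) hα
  have hγ' := congrArg (Int.cast : ℤ → ZMod q) hγ
  push_cast at hA' hB' hC' hα' hγ'
  rw [hx0] at hB' hC' hγ'
  have hp0 := hp.ne_zero
  have hsum : (B : ZMod q) ^ p + (C : ZMod q) ^ p + (-A : ZMod q) ^ p = 0 := by
    rw [hodd.neg_pow, ← hA', ← hB', ← hC']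
    ring
  rcases ZMod.eq_zero_of_pow_add_pow_add_pow_eq_zero hodd hN hcons hsum with h0 | h0 | h0
  · exact hz0 (by simpa [h0, hp0] using hB')
  · exact hy0 (by simpa [h0, hp0] using hC')
  have hA0 : (A : ZMod q) = 0 := by simpa using h0
  have hzy : -(z : ZMod q) = y := by
    rw [hA0, zero_pow hp0] at hA'
    linear_combination -hA'
  have hα2 : (p : ZMod q) * (y : ZMod q) ^ (p - 1) = (α : ZMod q) ^ p := by
    rw [← hα', hzy, Finset.sum_congr rfl (g := fun _ ↦ (y : ZMod q) ^ (p - 1))]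
    · simp
    · intro i hi
      rw [← pow_add]
      congr 1
      have := Finset.mem_range.1 hi
      lia
  have hγ2 : (y : ZMod q) ^ (p - 1) = (γ : ZMod q) ^ p := by
    rw [← hγ', Finset.sum_eq_single_of_mem 0 (Finset.mem_range.2 hp.pos)]
    · rw [pow_zero, one_mul, Nat.sub_zero, (Nat.Odd.sub_odd hodd odd_one).neg_pow]
    · intro i _ hi
      rw [zero_pow hi, zero_mul]
  have hγ0 : (γ : ZMod q) ≠ 0 := by
    rintro h0
    rw [h0, zero_pow hp0] at hγ2
    exact hy0 ((pow_eq_zero_iff (by have := hp.two_le; lia)).1 hγ2)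
  have hq1 : 1 < q := (Fact.out : q.Prime).one_lt
  have hpq : (p : ZMod q) ≠ 0 := by
    rw [Ne, ZMod.natCast_eq_zero_iff]
    refine Nat.not_dvd_of_pos_of_lt hp.pos ?_
    have hN0 : 0 < N := Nat.pos_of_ne_zero (by rintro rfl; lia)
    nlinarith
  have hα0 : (α : ZMod q) ≠ 0 := by
    rintro h0
    rw [h0, zero_pow hp0, hγ2] at hα2
    exact mul_ne_zero hpq (pow_ne_zero p hγ0) hα2
  refine hpow ?_
  have : (p : ZMod q) = (α / γ : ZMod q) ^ p := by
    rw [div_pow, ← hα2, hγ2, mul_div_cancel_right₀ _ (pow_ne_zero p hγ0)]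
  rw [this, ← pow_mul, mul_comm, show N * p = q - 1 by lia]
  exact ZMod.pow_card_sub_one_eq_one (div_ne_zero hα0 hγ0)

/-- **Sophie Germain's theorem**: the first case of Fermat's Last Theorem for the exponent `p`,
given a suitable auxiliary prime `q`. -/
theorem dvd_of_pow_add_pow_add_pow_eq_zero {p q N : ℕ} (hp : p.Prime) (hodd : Odd p)
    [Fact q.Prime] (hN : q = N * p + 1)
    (hcons : ∀ v : ZMod q, v ^ N = 1 → (v + 1) ^ N ≠ 1) (hpow : (p : ZMod q) ^ N ≠ 1)
    {x y z : ℤ} (h : x ^ p + y ^ p + z ^ p = 0) (hxy : IsCoprime x y) (hyz : IsCoprime y z)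
    (hxz : IsCoprime x z) : (p : ℤ) ∣ x ∨ (p : ℤ) ∣ y ∨ (p : ℤ) ∣ z := by
  by_contra! ⟨hx, hy, hz⟩
  have h0 : (x : ZMod q) ^ p + (y : ZMod q) ^ p + (z : ZMod q) ^ p = 0 := by
    exact_mod_cast congrArg (Int.cast : ℤ → ZMod q) h
  rcases ZMod.eq_zero_of_pow_add_pow_add_pow_eq_zero hodd hN hcons h0 with h1 | h1 | h1 <;>
    rw [ZMod.intCast_zmod_eq_zero_iff_dvd] at h1
  · exact not_dvd_of_pow_add_pow_add_pow_eq_zero hp hodd hN hcons hpow h hxy hyz hxz hx hy hz h1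
  · exact not_dvd_of_pow_add_pow_add_pow_eq_zero hp hodd hN hcons hpow
      (by linear_combination h : y ^ p + x ^ p + z ^ p = 0) hxy.symm hxz hyz hy hx hz h1
  · exact not_dvd_of_pow_add_pow_add_pow_eq_zero hp hodd hN hcons hpow
      (by linear_combination h : z ^ p + y ^ p + x ^ p = 0) hyz.symm hxy.symm hxz.symm hz hy hx h1

/-- The properties of the ring of integers `R` of the maximal real subfield of the `p`-th cyclotomic
field, `p = 2 * d + 1`, on which the descent in the second case of Fermat's Last Theorem rests.
Here `l a` stands for `2 - ζ ^ a - ζ ^ (-a)`. -/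
structure IsRealCyclotomic (R : Type*) [CommRing R] (p d : ℕ) (l : ℕ → R) : Prop where
  prime_nat : p.Prime
  eq_two_mul_add_one : p = 2 * d + 1
  two_le : 2 ≤ d
  prime : Prime (l 1)
  exists_dvd_sub_intCast : ∀ α : R, ∃ n : ℤ, l 1 ∣ α - n
  prod_eq : ∏ a ∈ Finset.Icc 1 d, l a = p
  associated : ∀ a ∈ Finset.Icc 1 d, Associated (l 1) (l a)
  associated_sub : ∀ a ∈ Finset.Icc 1 d, ∀ b ∈ Finset.Icc 1 d, a ≠ b →
    Associated (l 1) (l a - l b)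
  two_eq : l 2 = l 1 * (4 - l 1)
  pow_add_pow_eq : ∀ x y : R,
    x ^ p + y ^ p = (x + y) * ∏ a ∈ Finset.Icc 1 d, ((x + y) ^ 2 - l a * (x * y))
  exists_one_le_abs : ∀ γ : R, γ ≠ 0 → ∃ ψ : R →+* ℝ, 1 ≤ |ψ γ| ∧ 0 < ψ (l 1) ∧ ψ (l 1) ≤ 4

namespace IsRealCyclotomic

variable {R : Type*} [CommRing R] {p d : ℕ} {l : ℕ → R}

theorem associated_natCast (h : IsRealCyclotomic R p d l) : Associated (l 1 ^ d) (p : R) := by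
  have := Associated.prod (Finset.Icc 1 d) (fun _ ↦ l 1) l h.associated
  simpa [h.prod_eq] using this

theorem pow_dvd_natCast (h : IsRealCyclotomic R p d l) : l 1 ^ d ∣ (p : R) :=
  h.associated_natCast.dvd

theorem dvd_natCast (h : IsRealCyclotomic R p d l) : l 1 ∣ (p : R) :=
  (dvd_pow_self _ (by have := h.two_le; lia)).trans h.pow_dvd_natCast

theorem dvd_intCast_iff (h : IsRealCyclotomic R p d l) {n : ℤ} : l 1 ∣ (n : R) ↔ (p : ℤ) ∣ n := by
  constructor
  · intro hn
    by_contra hpn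
    have hcop : IsCoprime (p : ℤ) n :=
      (Nat.prime_iff_prime_int.1 h.prime_nat).coprime_iff_not_dvd.2 hpn
    have := hcop.map (Int.castRingHom R)
    simp only [eq_intCast, Int.cast_natCast] at this
    exact h.prime.not_isUnit (this.isUnit_of_dvd' h.dvd_natCast hn)
  · rintro ⟨m, rfl⟩
    push_cast
    exact h.dvd_natCast.mul_right _

theorem pow_dvd_intCast (h : IsRealCyclotomic R p d l) {n : ℤ} (hn : l 1 ∣ (n : R)) :
    l 1 ^ d ∣ (n : R) := by
  obtain ⟨m, rfl⟩ := h.dvd_intCast_iff.1 hn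
  push_cast
  exact h.pow_dvd_natCast.mul_right _

/-- If `α` is congruent to the integer `n` modulo `l 1`, then `α ^ p` is congruent to `n ^ p`
modulo `p`. -/
theorem pow_dvd_pow_sub_pow (h : IsRealCyclotomic R p d l) {α β : R} (hn : l 1 ∣ α - β) :
    l 1 ^ d ∣ α ^ p - β ^ p := by
  obtain ⟨t, ht⟩ := hn
  rw [show α = β + l 1 * t by linear_combination ht]
  obtain ⟨s, hs⟩ := exists_add_pow_prime_eq h.prime_nat β (l 1 * t)
  rw [hs, mul_pow]
  have h1 : l 1 ^ d ∣ l 1 ^ p := pow_dvd_pow _ (by have := h.eq_two_mul_add_one; lia)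
  have h2 := (h1.mul_right (t ^ p)).add (h.pow_dvd_natCast.mul_right (β * (l 1 * t) * s))
  convert h2 using 1
  ring

theorem exists_pow_dvd_pow_sub_intCast (h : IsRealCyclotomic R p d l) (α : R) :
    ∃ n : ℤ, l 1 ^ d ∣ α ^ p - n := by
  obtain ⟨n, hn⟩ := h.exists_dvd_sub_intCast α
  exact ⟨n ^ p, by simpa using h.pow_dvd_pow_sub_pow hn⟩

theorem dvd_pow_sub_self (h : IsRealCyclotomic R p d l) (α : R) : l 1 ∣ α ^ p - α := by
  obtain ⟨n, hn⟩ := h.exists_dvd_sub_intCast α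
  have h1 : l 1 ∣ α ^ p - (n : R) ^ p := hn.trans (sub_dvd_pow_sub_pow _ _ _)
  have h2 : l 1 ∣ ((n ^ p - n : ℤ) : R) := by
    rw [h.dvd_intCast_iff]
    have := Fact.mk h.prime_nat
    rw [← ZMod.intCast_zmod_eq_zero_iff_dvd]
    push_cast
    rw [ZMod.pow_card, sub_self]
  have := (h1.add h2).sub hn
  convert this using 1
  push_cast
  ring

theorem dvd_add_of_dvd_pow_add_pow (h : IsRealCyclotomic R p d l) {x y : R}
    (hxy : l 1 ∣ x ^ p + y ^ p) : l 1 ∣ x + y := by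
  have := (hxy.sub (h.dvd_pow_sub_self x)).sub (h.dvd_pow_sub_self y)
  convert this using 1
  ring

variable [IsDomain R]

theorem isUnit_four_sub (h : IsRealCyclotomic R p d l) : IsUnit (4 - l 1) := by
  obtain ⟨u, hu⟩ := h.associated 2 (Finset.mem_Icc.2 ⟨by simp, h.two_le⟩)
  rw [h.two_eq] at hu
  exact mul_left_cancel₀ h.prime.ne_zero hu ▸ u.isUnit

theorem isUnit_three_sub (h : IsRealCyclotomic R p d l) : IsUnit (3 - l 1) := by
  obtain ⟨u, hu⟩ := h.associated_sub 2 (Finset.mem_Icc.2 ⟨by simp, h.two_le⟩) 1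
    (Finset.mem_Icc.2 ⟨le_rfl, one_le_two.trans h.two_le⟩) (by simp)
  rw [h.two_eq, show l 1 * (4 - l 1) - l 1 = l 1 * (3 - l 1) by ring] at hu
  exact mul_left_cancel₀ h.prime.ne_zero hu ▸ u.isUnit

/-- Archimedean step: under every real embedding with `0 < l 1 ≤ 4`, the element
`(4 - l 1) * w ^ 2 / (l 1 * u)` lies between `0` and `4`, so it cannot be a nonzero multiple
of `p ^ 2`. -/
theorem not_sq_dvd (h : IsRealCyclotomic R p d l) {x y w' u' : R} (hx : x + y = l 1 * w')
    (hw : x + y ≠ 0) (hu : ((x + y) * w' - x * y) * u' = 1) :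
    ¬ (p : R) ^ 2 ∣ (4 - l 1) * ((x + y) * w') * u' := by
  rintro ⟨γ, hγ⟩
  have hw' : w' ≠ 0 := by
    rintro rfl
    exact hw (by simpa using hx)
  have hu' : u' ≠ 0 := by
    rintro rfl
    simp at hu
  have hγ0 : γ ≠ 0 := by
    rintro rfl
    rw [mul_zero] at hγ
    exact mul_ne_zero (mul_ne_zero h.isUnit_four_sub.ne_zero (mul_ne_zero hw hw')) hu' hγ
  obtain ⟨ψ, h1, hpos, hle⟩ := h.exists_one_le_abs γ hγ0
  have hγ' := congrArg ψ hγ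
  have hx' := congrArg ψ hx
  have hu1 := congrArg ψ hu
  simp only [map_mul, map_sub, map_add, map_pow, map_natCast, map_ofNat, map_one] at hγ' hx' hu1
  generalize ψ x = X at *
  generalize ψ y = Y at *
  generalize ψ w' = W at *
  generalize ψ u' = U at *
  generalize ψ γ = G at *
  generalize ψ (l 1) = L at *
  have hden : L * ((X + Y) * W - X * Y) * (L * U) = L * L := by linear_combination L * L * hu1
  set D := (X + Y) * W - X * Y with hD
  have hLD : L * D = (X + Y) ^ 2 - L * (X * Y) := by rw [hD]; linear_combination -(X + Y) * hx'
  have h4 : 4 * (L * D) - (4 - L) * (X + Y) ^ 2 = L * (X - Y) ^ 2 := by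
    rw [hLD]; ring
  have hLD0 : 0 ≤ L * D := by
    nlinarith [mul_nonneg (sub_nonneg.2 hle) (sq_nonneg (X + Y)), mul_nonneg hpos.le
      (sq_nonneg (X - Y))]
  have hD0 : 0 < D := lt_of_le_of_ne (nonneg_of_mul_nonneg_right hLD0 hpos) (by
    rintro h0
    rw [← h0] at hu1
    simp at hu1)
  have hU : U = 1 / D := by field_simp; linear_combination hu1
  have hval : (4 - L) * ((X + Y) * W) * U = (4 - L) * (X + Y) ^ 2 / (L * D) := by
    rw [hU]
    field_simp
    linear_combination -(4 - L) * hx' * (X + Y)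
  have hle4 : (4 - L) * ((X + Y) * W) * U ≤ 4 := by
    rw [hval, div_le_iff₀ (mul_pos hpos hD0)]
    nlinarith [mul_nonneg hpos.le (sq_nonneg (X - Y))]
  have hge0 : 0 ≤ (4 - L) * ((X + Y) * W) * U := by
    rw [hval]
    exact div_nonneg (mul_nonneg (sub_nonneg.2 hle) (sq_nonneg _)) hLD0
  have hp5 : (5 : ℝ) ≤ p := by
    exact_mod_cast (by have := h.two_le; have := h.eq_two_mul_add_one; lia : 5 ≤ p)
  have habs : |(p : ℝ) ^ 2 * G| ≤ 4 := by
    rw [← hγ', abs_of_nonneg hge0]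
    exact hle4
  rw [abs_mul, abs_of_nonneg (by positivity)] at habs
  nlinarith

end IsRealCyclotomic

namespace IsRealCyclotomic

variable {R : Type*} [CommRing R] {p d : ℕ} {l : ℕ → R} [IsDomain R] [IsPrincipalIdealRing R]

/-- One step of the descent in the second case of Fermat's Last Theorem. -/
theorem exists_descent (h : IsRealCyclotomic R p d l)
    (hK : ∀ (u : Rˣ) (n : ℤ), l 1 ^ d ∣ (u : R) - n → ∃ ε : Rˣ, u = ε ^ p)
    {x y z : R} {m : ℕ} {η : Rˣ} (hm : p ≤ m) (hxy : IsCoprime x y) (hz : ¬ l 1 ∣ z)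
    (heq : x ^ p + y ^ p = η * l 1 ^ m * z ^ p) :
    ∃ (x' y' z' : R) (m' : ℕ) (η' : Rˣ), p ≤ m' ∧ IsCoprime x' y' ∧ ¬ l 1 ∣ z' ∧
      x' ^ p + y' ^ p = η' * l 1 ^ m' * z' ^ p ∧
      (∃ π, Prime π ∧ π ∣ z ∧ ¬ π ∣ z') ∧ ∀ π, Prime π → π ∣ z' → π ∣ z := by
  have hpd := h.eq_two_mul_add_one
  have hd := h.two_le
  have hp0 : p ≠ 0 := h.prime_nat.ne_zero
  have hl0 : l 1 ≠ 0 := h.prime.ne_zero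
  have hodd : Odd p := ⟨d, hpd⟩
  have hlw : l 1 ∣ x + y := h.dvd_add_of_dvd_pow_add_pow
    (heq ▸ ((dvd_pow_self _ (by lia)).mul_left _).mul_right _)
  have hlx : ¬ l 1 ∣ x := fun h1 ↦
    h.prime.not_isUnit (hxy.isUnit_of_dvd' h1 ((dvd_add_right h1).1 hlw))
  have hly : ¬ l 1 ∣ y := fun h1 ↦
    h.prime.not_isUnit (hxy.isUnit_of_dvd' ((dvd_add_left h1).1 hlw) h1)
  have hlxy : ¬ l 1 ∣ x * y := fun h1 ↦ (h.prime.dvd_or_dvd h1).elim hlx hly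
  have hw' : ∀ a ∈ Finset.Icc 1 d, ∃ w' : R, x + y = l a * w' := fun a ha ↦
    (h.associated a ha).dvd_iff_dvd_left.1 hlw
  choose! W hW using hw'
  set q : ℕ → R := fun a ↦ (x + y) * W a - x * y with hq
  have hQ : ∀ a ∈ Finset.Icc 1 d, (x + y) ^ 2 - l a * (x * y) = l a * q a := fun a ha ↦ by
    simp only [hq]
    linear_combination (x + y) * hW a ha
  have hlq : ∀ a, ¬ l 1 ∣ q a := fun a h1 ↦
    hlxy ((dvd_sub_right (hlw.mul_right _)).1 h1)
  obtain ⟨v, hv⟩ := h.associated_natCast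
  have hprod : (x + y) * ∏ a ∈ Finset.Icc 1 d, q a =
      ((η * v⁻¹ : Rˣ) : R) * l 1 ^ (m - d) * z ^ p := by
    have h1 := h.pow_add_pow_eq x y
    rw [Finset.prod_congr rfl hQ, Finset.prod_mul_distrib, h.prod_eq, ← hv, heq,
      show m = d + (m - d) by lia, pow_add] at h1
    have h2 : (l 1 ^ d * (v : R)) * ((x + y) * ∏ a ∈ Finset.Icc 1 d, q a) =
        (l 1 ^ d * (v : R)) * (((η * v⁻¹ : Rˣ) : R) * l 1 ^ (m - d) * z ^ p) := by
      push_cast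
      linear_combination -h1 - (η : R) * l 1 ^ d * l 1 ^ (m - d) * z ^ p * v.mul_inv
    exact mul_left_cancel₀ (mul_ne_zero (pow_ne_zero _ hl0) v.ne_zero) h2
  have hlprod : ¬ l 1 ∣ ∏ a ∈ Finset.Icc 1 d, q a := fun h1 ↦ by
    obtain ⟨a, -, ha⟩ := (h.prime.dvd_finsetProd_iff _).1 h1
    exact hlq a ha
  obtain ⟨s, hs⟩ : l 1 ^ (m - d) ∣ x + y :=
    h.prime.pow_dvd_of_dvd_mul_right _ hlprod
      (hprod ▸ (dvd_mul_left _ _).mul_right _)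
  have hsprod : s * ∏ a ∈ Finset.Icc 1 d, q a = ((η * v⁻¹ : Rˣ) : R) * z ^ p := by
    rw [hs] at hprod
    refine mul_left_cancel₀ (pow_ne_zero (m - d) hl0) ?_
    linear_combination hprod
  have hassoc : Associated (z ^ p) (s * ∏ a ∈ Finset.Icc 1 d, q a) := by
    rw [hsprod]
    exact ⟨η * v⁻¹, mul_comm _ _⟩
  have hπ : ∀ π : R, Prime π → π ∣ x + y → ¬ π ∣ x * y := fun π hπ h1 h2 ↦ by
    rcases hπ.dvd_or_dvd h2 with h3 | h3
    · exact hπ.not_isUnit (hxy.isUnit_of_dvd' h3 ((dvd_add_right h3).1 h1))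
    · exact hπ.not_isUnit (hxy.isUnit_of_dvd' ((dvd_add_left h3).1 h1) h3)
  have hq0 : ∀ a, q a ≠ 0 := fun a h0 ↦ hlq a (h0 ▸ dvd_zero _)
  have hsq : ∀ a, IsCoprime s (q a) := fun a ↦
    isCoprime_of_prime_dvd (fun h0 ↦ hq0 a h0.2) fun π hπ' h1 h2 ↦ by
      have h3 : π ∣ x + y := hs ▸ h1.mul_left _
      exact hπ π hπ' h3 ((dvd_sub_right (h3.mul_right _)).1 h2)
  have hqq : ∀ a ∈ Finset.Icc 1 d, ∀ b ∈ Finset.Icc 1 d, a ≠ b → IsCoprime (q a) (q b) :=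
    fun a ha b hb hab ↦ isCoprime_of_prime_dvd (fun h0 ↦ hq0 a h0.1) fun π hπ' h1 h2 ↦ by
      have h3 : π ∣ (l a - l b) * (x * y) := by
        have := (h2.mul_left (l b)).sub (h1.mul_left (l a))
        rw [← hQ a ha, ← hQ b hb] at this
        convert this using 1
        ring
      rcases hπ'.dvd_or_dvd h3 with h4 | h4
      · rw [← (h.associated_sub a ha b hb hab).dvd_iff_dvd_right] at h4
        exact hlq a ((hπ'.associated_of_dvd h.prime h4).dvd_iff_dvd_left.1 h1)
      · refine hπ π hπ' (hπ'.dvd_of_dvd_pow (n := 2) ?_) h4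
        have := (h1.mul_left (l a)).add (h4.mul_left (l a))
        rw [← hQ a ha] at this
        simpa using this
  have hmem1 : 1 ∈ Finset.Icc 1 d := Finset.mem_Icc.2 ⟨le_rfl, by lia⟩
  have hmem2 : 2 ∈ Finset.Icc 1 d := Finset.mem_Icc.2 ⟨one_le_two, hd⟩
  have hqpow : ∀ a ∈ Finset.Icc 1 d, ∃ ρ : R, Associated (ρ ^ p) (q a) := fun a ha ↦ by
    refine exists_associated_pow_of_associated_pow_mul
      (b := s * ∏ b ∈ (Finset.Icc 1 d).erase a, q b) (c := z) ?_ ?_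
    · refine ((hsq a).symm).mul_right (IsCoprime.prod_right fun b hb ↦ ?_)
      exact hqq a ha b (Finset.mem_of_mem_erase hb) (Finset.ne_of_mem_erase hb).symm
    · rw [mul_left_comm, Finset.mul_prod_erase _ _ ha]
      exact hassoc
  obtain ⟨ρ₀, ε₀, h₀⟩ := exists_associated_pow_of_associated_pow_mul
    (IsCoprime.prod_right fun a _ ↦ hsq a) hassoc
  obtain ⟨ρ₁, ε₁, h₁⟩ := hqpow 1 hmem1
  obtain ⟨ρ₂, ε₂, h₂⟩ := hqpow 2 hmem2
  obtain ⟨μ, hμ⟩ := h.isUnit_four_sub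
  obtain ⟨ν, hν⟩ := h.isUnit_three_sub
  have hdiff : q 1 - q 2 = ((ν * μ⁻¹ * ε₀ ^ 2 : Rˣ) : R) * l 1 ^ (2 * m - p) * (ρ₀ ^ 2) ^ p := by
    have hW1 := hW 1 hmem1
    have hW2 := hW 2 hmem2
    rw [h.two_eq, ← hμ] at hW2
    have hW2' : W 2 = ((μ⁻¹ : Rˣ) : R) * l 1 ^ (m - d - 1) * s := by
      refine mul_left_cancel₀ (mul_ne_zero hl0 μ.ne_zero) ?_
      rw [← hW2, hs, show m - d = m - d - 1 + 1 by lia, pow_succ, Nat.add_sub_cancel]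
      linear_combination -(l 1 ^ (m - d - 1) * s * l 1) * μ.mul_inv
    have hW12 : W 1 - W 2 = (3 - l 1) * W 2 := by
      refine mul_left_cancel₀ hl0 ?_
      linear_combination hW2 - hW1 + l 1 * W 2 * hμ
    have : q 1 - q 2 = (x + y) * (W 1 - W 2) := by simp only [hq]; ring
    rw [this, hW12, hW2', hs, ← hν, ← h₀, show 2 * m - p = (m - d) + (m - d - 1) by lia, pow_add]
    push_cast
    ring
  have hlρ₁ : ¬ l 1 ∣ ρ₁ := fun h1 ↦ hlq 1 (h₁ ▸ (dvd_pow h1 hp0).mul_right _)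
  obtain ⟨ε, hε⟩ : ∃ ε : Rˣ, ε₁ * ε₂⁻¹ = ε ^ p := by
    obtain ⟨n₁, hn₁⟩ := h.exists_pow_dvd_pow_sub_intCast ρ₁
    obtain ⟨n₂, hn₂⟩ := h.exists_pow_dvd_pow_sub_intCast ρ₂
    have hpn : ¬ (p : ℤ) ∣ n₁ := fun h1 ↦ by
      refine hlρ₁ (h.prime.dvd_of_dvd_pow (n := p) ?_)
      have := ((dvd_pow_self _ (by lia)).trans hn₁).add (h.dvd_intCast_iff.2 h1)
      simpa using this
    obtain ⟨k, j, hkj⟩ : IsCoprime n₁ p :=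
      ((Nat.prime_iff_prime_int.1 h.prime_nat).coprime_iff_not_dvd.2 hpn).symm
    have hkj' := congrArg (Int.cast : ℤ → R) hkj
    push_cast at hkj'
    refine hK _ (n₂ * k) ?_
    have hdiff' : l 1 ^ d ∣ q 1 - q 2 := by
      rw [hdiff]
      exact ((pow_dvd_pow _ (by lia)).mul_left _).mul_right _
    rw [← h₁, ← h₂] at hdiff'
    push_cast
    have h3 := ((hdiff'.mul_left ((ε₂⁻¹ : Rˣ) * k : R)).sub
      (hn₁.mul_left (ε₁ * (ε₂⁻¹ : Rˣ) * k))).add (hn₂.mul_left (k : R))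
    have h4 := h3.add (h.pow_dvd_natCast.mul_left (j * (ε₁ * (ε₂⁻¹ : Rˣ)) : R))
    convert h4 using 1
    linear_combination -(ε₁ * (ε₂⁻¹ : Rˣ) : R) * hkj' + (k : R) * ρ₂ ^ p * ε₂.mul_inv
  have hε' : (ε₁ : R) = ε₂ * (ε : R) ^ p := by
    have := congrArg (Units.val) hε
    push_cast at this
    linear_combination (ε₂ : R) * this - (ε₁ : R) * ε₂.mul_inv
  have hρz : ∀ a ∈ Finset.Icc 1 d, ∀ ρ π : R, Associated (ρ ^ p) (q a) → Prime π → π ∣ ρ → π ∣ z :=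
    fun a ha ρ π h1 h2 h3 ↦ by
      refine h2.dvd_of_dvd_pow (n := p) (hassoc.dvd_iff_dvd_right.2 ?_)
      refine (dvd_trans ?_ (Finset.dvd_prod_of_mem q ha)).mul_left s
      exact h1.dvd_iff_dvd_right.1 (dvd_pow h3 hp0)
  have hsz : ∀ π : R, Prime π → π ∣ s → π ∣ z := fun π h1 h2 ↦
    h1.dvd_of_dvd_pow (n := p) (hassoc.dvd_iff_dvd_right.2 (h2.mul_right _))
  have hρ₀s : ∀ π : R, Prime π → π ∣ ρ₀ ^ 2 → π ∣ s := fun π h1 h2 ↦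
    h₀ ▸ (dvd_pow (h1.dvd_of_dvd_pow h2) hp0).mul_right _
  refine ⟨ε * ρ₁, -ρ₂, ρ₀ ^ 2, 2 * m - p, ε₂⁻¹ * (ν * μ⁻¹ * ε₀ ^ 2), by lia, ?_, ?_, ?_, ?_, ?_⟩
  · refine IsCoprime.neg_right ((isCoprime_mul_unit_left_left ε.isUnit _ _).2 ?_)
    have := hqq 1 hmem1 2 hmem2 (by simp)
    rw [← h₁, ← h₂] at this
    rw [← IsCoprime.pow_iff (Nat.pos_of_ne_zero hp0) (Nat.pos_of_ne_zero hp0)]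
    exact this.of_mul_left_left.of_mul_right_left
  · exact fun h1 ↦ hz (hsz _ h.prime (hρ₀s _ h.prime h1))
  · rw [← h₁, ← h₂, hε'] at hdiff
    rw [hodd.neg_pow, mul_pow, Units.val_mul]
    linear_combination ((ε₂⁻¹ : Rˣ) : R) * hdiff -
      ((ε : R) ^ p * ρ₁ ^ p - ρ₂ ^ p) * ε₂.mul_inv
  · have hnu : ¬ IsUnit ρ₁ := fun hunit ↦ by
      obtain ⟨u, hu⟩ : IsUnit (q 1) := h₁ ▸ (hunit.pow p).mul ε₁.isUnit
      have hw0 : x + y ≠ 0 := fun h0 ↦ by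
        rw [h0, zero_mul] at hprod
        refine mul_ne_zero (mul_ne_zero (Units.ne_zero _) (pow_ne_zero (m - d) hl0))
          (pow_ne_zero p ?_) hprod.symm
        rintro rfl
        exact hz (dvd_zero _)
      refine h.not_sq_dvd (u' := ((u⁻¹ : Rˣ) : R)) (hW 1 hmem1) hw0 ?_ ?_
      · rw [show (x + y) * W 1 - x * y = u from hu.symm, u.mul_inv]
      · have h3 : (p : R) ^ 2 ∣ (l 1 ^ d) ^ 2 := pow_dvd_pow_of_dvd h.associated_natCast.symm.dvd 2
        have h4 : l 1 ^ (m - d - 1) ∣ W 1 := by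
          rw [← mul_dvd_mul_iff_left hl0, ← hW 1 hmem1, hs, ← pow_succ',
            show m - d - 1 + 1 = m - d by lia]
          exact dvd_mul_right _ _
        have h5 : (l 1 ^ d) ^ 2 ∣ (x + y) * W 1 := by
          refine dvd_trans ?_ (mul_dvd_mul (hs ▸ dvd_mul_right (l 1 ^ (m - d)) s) h4)
          rw [← pow_mul, ← pow_add]
          exact pow_dvd_pow _ (by lia)
        exact ((h3.trans h5).mul_left _).mul_right _
    have hρ₁0 : ρ₁ ≠ 0 := fun h0 ↦ hlρ₁ (h0 ▸ dvd_zero _)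
    obtain ⟨π, hπ1, hπ2⟩ := WfDvdMonoid.exists_irreducible_factor hnu hρ₁0
    refine ⟨π, hπ1.prime, hρz 1 hmem1 ρ₁ π ⟨ε₁, h₁⟩ hπ1.prime hπ2, fun h1 ↦ ?_⟩
    refine hπ1.prime.not_isUnit ((hsq 1).isUnit_of_dvd' (hρ₀s π hπ1.prime h1) ?_)
    rw [← h₁]
    exact (dvd_pow hπ2 hp0).mul_right _
  · exact fun π h1 h2 ↦ hsz π h1 (hρ₀s π h1 h2)

theorem pow_add_pow_ne (h : IsRealCyclotomic R p d l)
    (hK : ∀ (u : Rˣ) (n : ℤ), l 1 ^ d ∣ (u : R) - n → ∃ ε : Rˣ, u = ε ^ p)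
    {x y z : R} {m : ℕ} {η : Rˣ} (hm : p ≤ m) (hxy : IsCoprime x y) (hz : ¬ l 1 ∣ z) :
    x ^ p + y ^ p ≠ η * l 1 ^ m * z ^ p := by
  classical
  let : StrongNormalizationMonoid R := UniqueFactorizationMonoid.strongNormalizationMonoid
  induction hn : (UniqueFactorizationMonoid.normalizedFactors z).toFinset.card
    using Nat.strong_induction_on generalizing x y z m η with
  | _ n ih =>
    intro heq
    obtain ⟨x', y', z', m', η', hm', hxy', hz', heq', ⟨π, hπ, hπz, hπz'⟩, hsub⟩ :=
      h.exists_descent hK hm hxy hz heq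
    refine ih _ ?_ hm' hxy' hz' rfl heq'
    have hz0 : z ≠ 0 := fun h0 ↦ hz (h0 ▸ dvd_zero _)
    have hz0' : z' ≠ 0 := fun h0 ↦ hz' (h0 ▸ dvd_zero _)
    rw [← hn]
    refine Finset.card_lt_card ((Finset.ssubset_iff_of_subset ?_).2 ?_)
    · intro t ht
      rw [Multiset.mem_toFinset, UniqueFactorizationMonoid.mem_normalizedFactors_iff' hz0'] at ht
      rw [Multiset.mem_toFinset, UniqueFactorizationMonoid.mem_normalizedFactors_iff' hz0]
      exact ⟨ht.1, ht.2.1, hsub t ht.1.prime ht.2.2⟩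
    · obtain ⟨t, ht, hat⟩ :=
        UniqueFactorizationMonoid.exists_mem_normalizedFactors_of_dvd hz0 hπ.irreducible hπz
      refine ⟨t, Multiset.mem_toFinset.2 ht, fun ht' ↦ hπz' (hat.dvd.trans ?_)⟩
      exact UniqueFactorizationMonoid.dvd_of_mem_normalizedFactors (Multiset.mem_toFinset.1 ht')

/-- The second case of Fermat's Last Theorem. -/
theorem int_pow_add_pow_ne [CharZero R] (h : IsRealCyclotomic R p d l)
    (hK : ∀ (u : Rˣ) (n : ℤ), l 1 ^ d ∣ (u : R) - n → ∃ ε : Rˣ, u = ε ^ p)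
    {x y z : ℤ} (hxy : IsCoprime x y) (hz0 : z ≠ 0) (hz : (p : ℤ) ∣ z) :
    x ^ p + y ^ p ≠ z ^ p := by
  intro heq
  have hpd := h.eq_two_mul_add_one
  have hd := h.two_le
  obtain ⟨k, c, hc, rfl⟩ := WfDvdMonoid.max_power_factor hz0
    (Nat.prime_iff_prime_int.1 h.prime_nat).irreducible
  have hk : 1 ≤ k := by
    rw [Nat.one_le_iff_ne_zero]
    rintro rfl
    exact hc (by simpa using hz)
  obtain ⟨v, hv⟩ := h.associated_natCast
  refine h.pow_add_pow_ne hK (x := (x : R)) (y := y) (z := c) (m := d * k * p) (η := v ^ (k * p))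
    ?_ (hxy.map (Int.castRingHom R)) (by rwa [h.dvd_intCast_iff]) ?_
  · exact Nat.le_mul_of_pos_left _ (by positivity)
  · have := congrArg (Int.cast : ℤ → R) heq
    push_cast at this
    rw [this, ← hv]
    push_cast
    ring

end IsRealCyclotomic

section

open Finset

theorem Finset.prod_range_two_mul_succ {M : Type*} [CommMonoid M] (f : ℕ → M) (d : ℕ) :
    ∏ k ∈ range (2 * d), f (k + 1) = ∏ a ∈ Icc 1 d, f a * f (2 * d + 1 - a) := by
  have : ∏ k ∈ range (2 * d), f (k + 1) = ∏ k ∈ Icc 1 (2 * d), f k :=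
    prod_nbij' (· + 1) (· - 1) (by simp) (by grind)
      (by simp) (by simp +contextual) (by simp)
  rw [this, prod_mul_distrib,
    show Icc 1 (2 * d) = Icc 1 d ∪ Icc (d + 1) (2 * d) by ext; simp; lia, prod_union]
  · congr 1
    refine prod_nbij' (fun a ↦ 2 * d + 1 - a) (fun a ↦ 2 * d + 1 - a) ?_ ?_ ?_ ?_ ?_ <;>
      intro a ha <;> rw [mem_Icc] at * <;> try lia
    congr 1
    lia
  · rw [disjoint_left]
    intro a ha hb
    rw [mem_Icc] at *
    lia

end

/-- `l a` plays the role of `2 - ζ ^ a - ζ ^ (-a)`, where `ζ` is a primitive `p`-th root of unity in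
an extension of `R`. -/
structure IsTwoSubTrace {R A : Type*} [CommRing R] [CommRing A] (φ : R →+* A) (p : ℕ) (ζ ζ' : A)
    (l : ℕ → R) : Prop where
  injective : Function.Injective φ
  isPrimitiveRoot : IsPrimitiveRoot ζ p
  mul_eq_one : ζ * ζ' = 1
  map_eq : ∀ a, φ (l a) = 2 - ζ ^ a - ζ' ^ a

/-- The polynomials with `2 - ζ ^ a - ζ ^ (-a) = x * chebyshevQuot x a`, where
`x = 2 - ζ - ζ⁻¹`. -/
def chebyshevQuot {R : Type*} [CommRing R] (x : R) : ℕ → R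
  | 0 => 0
  | 1 => 1
  | n + 2 => 2 + (2 - x) * chebyshevQuot x (n + 1) - chebyshevQuot x n

namespace IsTwoSubTrace

variable {R A : Type*} [CommRing R] [CommRing A] {φ : R →+* A} {p d : ℕ} {ζ ζ' : A} {l : ℕ → R}

theorem pow_mul_pow (h : IsTwoSubTrace φ p ζ ζ' l) (a : ℕ) : ζ ^ a * ζ' ^ a = 1 := by
  rw [← mul_pow, h.mul_eq_one, one_pow]

theorem pow_sub (h : IsTwoSubTrace φ p ζ ζ' l) {a : ℕ} (ha : a ≤ p) : ζ ^ (p - a) = ζ' ^ a := by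
  have h1 := h.pow_mul_pow a
  have h2 : ζ ^ (p - a) * ζ ^ a = 1 := by
    rw [← pow_add, Nat.sub_add_cancel ha, h.isPrimitiveRoot.pow_eq_one]
  linear_combination ζ' ^ a * h2 - ζ ^ (p - a) * h1

theorem mul_eq (h : IsTwoSubTrace φ p ζ ζ' l) (a b : ℕ) :
    l (a * b) = l a * chebyshevQuot (l a) b := by
  induction b using Nat.twoStepInduction with
  | zero =>
    apply h.injective
    rw [mul_zero, chebyshevQuot, mul_zero, h.map_eq, map_zero]
    ring
  | one => simp [chebyshevQuot]
  | more b h0 h1 =>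
    rw [chebyshevQuot, mul_sub, mul_add (l a), mul_left_comm (l a) (2 - l a), ← h0, ← h1]
    apply h.injective
    simp only [map_add, map_sub, map_mul, h.map_eq, map_ofNat]
    rw [show a * (b + 2) = a * b + 2 * a by ring, show a * (b + 1) = a * b + a by ring]
    simp only [pow_add, pow_mul]
    have := h.pow_mul_pow a
    rw [pow_right_comm ζ 2, pow_right_comm ζ' 2]
    linear_combination ((ζ ^ a) ^ b + (ζ' ^ a) ^ b) * this

theorem dvd (h : IsTwoSubTrace φ p ζ ζ' l) (a : ℕ) : l 1 ∣ l a :=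
  Dvd.intro _ (one_mul a ▸ h.mul_eq 1 a).symm

theorem eq_mul_chebyshevQuot (h : IsTwoSubTrace φ p ζ ζ' l) (a : ℕ) :
    l a = l 1 * chebyshevQuot (l 1) a := by
  simpa using h.mul_eq 1 a

theorem mod_eq (h : IsTwoSubTrace φ p ζ ζ' l) (a : ℕ) : l (a % p) = l a := by
  apply h.injective
  have h1 : ζ' ^ p = 1 := by
    have := h.pow_mul_pow p
    rwa [h.isPrimitiveRoot.pow_eq_one, one_mul] at this
  rw [h.map_eq, h.map_eq, ← pow_eq_pow_mod _ h.isPrimitiveRoot.pow_eq_one, ← pow_eq_pow_mod _ h1]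

theorem sq_sub_eq (h : IsTwoSubTrace φ p ζ ζ' l) {a b : ℕ} (hab : b ≤ a) :
    (l a - l b) ^ 2 = l (a + b) * l (a - b) := by
  obtain ⟨c, rfl⟩ := Nat.exists_eq_add_of_le hab
  rw [Nat.add_sub_cancel_left]
  apply h.injective
  simp only [map_sub, map_mul, h.map_eq, map_pow, pow_add]
  have h1 := h.pow_mul_pow b
  have h2 := h.pow_mul_pow c
  generalize ζ ^ b = s at *
  generalize ζ ^ c = t at *
  generalize ζ' ^ b = s' at *
  generalize ζ' ^ c = t' at *
  grind

theorem associated [IsDomain R] (h : IsTwoSubTrace φ p ζ ζ' l) (hp : p.Prime) {a : ℕ}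
    (ha : ¬ p ∣ a) :
    Associated (l 1) (l a) := by
  refine associated_of_dvd_dvd (h.dvd a) ?_
  have := Fact.mk hp
  have ha0 : (a : ZMod p) ≠ 0 := by rwa [Ne, ZMod.natCast_eq_zero_iff]
  have : a * (a : ZMod p)⁻¹.val % p = 1 := by
    rw [← ZMod.val_natCast]
    push_cast
    rw [ZMod.natCast_zmod_val, mul_inv_cancel₀ ha0, ZMod.val_one]
  rw [← this, h.mod_eq, h.mul_eq]
  exact dvd_mul_right _ _

theorem associated_sub [IsDomain R] (h : IsTwoSubTrace φ p ζ ζ' l) (hp : p.Prime)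
    (hl : Prime (l 1)) {a b : ℕ} (hba : b ≤ a) (hab : ¬ p ∣ a + b) (hab' : ¬ p ∣ a - b) :
    Associated (l 1) (l a - l b) := by
  have h1 := ((h.associated hp hab).mul_mul (h.associated hp hab')).dvd'
  rw [← h.sq_sub_eq hba] at h1
  obtain ⟨t, ht⟩ := (h.dvd a).sub (h.dvd b)
  rw [ht] at h1 ⊢
  obtain ⟨s, hs⟩ := h1
  refine (associated_mul_unit_right _ t (IsUnit.of_mul_eq_one (t * s) ?_))
  refine mul_left_cancel₀ (pow_ne_zero 2 hl.ne_zero) ?_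
  linear_combination -hs

variable [IsDomain A]

theorem prod_eq (h : IsTwoSubTrace φ (2 * d + 1) ζ ζ' l) :
    ∏ a ∈ Finset.Icc 1 d, l a = (2 * d + 1 : ℕ) := by
  apply h.injective
  have := h.isPrimitiveRoot.prod_one_sub_pow_eq_order
  rw [Finset.prod_range_two_mul_succ fun k ↦ 1 - ζ ^ k] at this
  rw [map_prod, map_natCast]
  push_cast at this ⊢
  rw [← this]
  refine Finset.prod_congr rfl fun a ha ↦ ?_
  rw [Finset.mem_Icc] at ha
  rw [h.map_eq, h.pow_sub (by lia)]
  linear_combination -h.pow_mul_pow a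

theorem pow_add_pow_eq (h : IsTwoSubTrace φ (2 * d + 1) ζ ζ' l) (x y : R) :
    x ^ (2 * d + 1) + y ^ (2 * d + 1) =
      (x + y) * ∏ a ∈ Finset.Icc 1 d, ((x + y) ^ 2 - l a * (x * y)) := by
  apply h.injective
  have := congrArg (Polynomial.eval (φ x)) (X_pow_sub_C_eq_prod h.isPrimitiveRoot (Nat.succ_pos _)
    (rfl : (- φ y) ^ (2 * d + 1) = _))
  rw [Polynomial.eval_prod, Finset.prod_range_succ', Finset.prod_range_two_mul_succ
    fun k ↦ Polynomial.eval (φ x) (Polynomial.X - Polynomial.C (ζ ^ k * -φ y)),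
    (odd_two_mul_add_one d).neg_pow] at this
  simp only [Polynomial.eval_sub, Polynomial.eval_pow, Polynomial.eval_X, Polynomial.eval_C,
    sub_neg_eq_add, pow_zero, one_mul, mul_neg] at this
  simp only [map_add, map_pow, map_mul, map_prod, map_sub]
  rw [this, mul_comm]
  congr 1
  refine Finset.prod_congr rfl fun a ha ↦ ?_
  rw [Finset.mem_Icc] at ha
  rw [h.map_eq, h.pow_sub (by lia)]
  linear_combination (φ y) ^ 2 * h.pow_mul_pow a

end IsTwoSubTrace

namespace IsTwoSubTrace

open NumberField

variable {F K : Type*} [Field F] [NumberField F] [Field K] [Algebra F K]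
  {p d : ℕ} {ζ ζ' : K} {l : ℕ → 𝓞 F}

theorem absNorm_span (h : IsTwoSubTrace (algebraMap (𝓞 F) K) p ζ ζ' l) (hp : p.Prime)
    (hpd : p = 2 * d + 1) (hd : d ≠ 0) (hF : Module.finrank ℚ F = d) :
    Ideal.absNorm (Ideal.span {l 1}) = p := by
  have h1 : Associated (l 1 ^ d) (p : 𝓞 F) := by
    have := Associated.prod (Finset.Icc 1 d) (fun _ ↦ l 1) l fun a ha ↦ by
      rw [Finset.mem_Icc] at ha
      exact h.associated hp (Nat.not_dvd_of_pos_of_lt (by lia) (by lia))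
    subst hpd
    simpa [h.prod_eq] using this
  have h2 := Ideal.span_singleton_eq_span_singleton.2 h1
  rw [← Ideal.span_singleton_pow] at h2
  replace h2 := congrArg Ideal.absNorm h2
  rw [map_pow, Ideal.absNorm_span_natCast, RingOfIntegers.rank, hF] at h2
  exact Nat.pow_left_injective hd h2

theorem exists_one_le_abs [CharZero K] [Algebra.IsAlgebraic F K] [IsTotallyReal F]
    (h : IsTwoSubTrace (algebraMap (𝓞 F) K) p ζ ζ' l) (hp : p ≠ 0) (hl : l 1 ≠ 0)
    {γ : 𝓞 F} (hγ : γ ≠ 0) :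
    ∃ ψ : 𝓞 F →+* ℝ, 1 ≤ |ψ γ| ∧ 0 < ψ (l 1) ∧ ψ (l 1) ≤ 4 := by
  obtain ⟨w, hw⟩ : ∃ w : InfinitePlace F, 1 ≤ w γ := by
    by_contra! hlt
    exact (InfinitePlace.one_le_of_lt_one (w := Classical.arbitrary _) hγ fun z _ ↦ hlt z).not_gt
      (hlt _)
  have hr := IsTotallyReal.isReal w
  refine ⟨(InfinitePlace.embedding_of_isReal hr).comp (algebraMap (𝓞 F) F), ?_, ?_⟩
  · rwa [← InfinitePlace.norm_embedding_of_isReal hr] at hw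
  set x := ((InfinitePlace.embedding_of_isReal hr).comp (algebraMap (𝓞 F) F)) (l 1) with hx
  have hx0 : x ≠ 0 := by
    rw [hx, RingHom.comp_apply]
    simpa using hl
  have hxc : (x : ℂ) = ComplexEmbedding.lift K w.embedding (algebraMap (𝓞 F) K (l 1)) := by
    rw [IsScalarTower.algebraMap_apply (𝓞 F) F K, ComplexEmbedding.lift_algebraMap_apply,
      ← InfinitePlace.embedding_of_isReal_apply hr, hx]
    rfl
  rw [h.map_eq, pow_one, pow_one, map_sub, map_sub, map_ofNat] at hxc
  have h1 := congrArg (ComplexEmbedding.lift K w.embedding) h.mul_eq_one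
  rw [map_mul, map_one] at h1
  have h2 : ‖ComplexEmbedding.lift K w.embedding ζ‖ = 1 :=
    Complex.norm_eq_one_of_pow_eq_one (n := p) (by
      rw [← map_pow, h.isPrimitiveRoot.pow_eq_one, map_one]) hp
  generalize ComplexEmbedding.lift K w.embedding ζ = z at *
  generalize ComplexEmbedding.lift K w.embedding ζ' = z' at *
  have hz' : z' = starRingEnd ℂ z := by
    rw [← Complex.inv_eq_conj h2]
    exact eq_inv_of_mul_eq_one_right h1
  have hx2 : x = 2 - 2 * z.re := by
    have := congrArg Complex.re hxc
    rw [hz'] at this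
    simp at this
    linarith
  have := abs_le.1 (h2 ▸ Complex.abs_re_le_norm z)
  constructor
  · exact lt_of_le_of_ne (by linarith) hx0.symm
  · linarith

theorem isRealCyclotomic [CharZero K] [Algebra.IsAlgebraic F K] [IsTotallyReal F]
    (h : IsTwoSubTrace (algebraMap (𝓞 F) K) p ζ ζ' l) (hp : p.Prime)
    (hpd : p = 2 * d + 1) (hd : 2 ≤ d) (hF : Module.finrank ℚ F = d) :
    IsRealCyclotomic (𝓞 F) p d l := by
  have hN := h.absNorm_span hp hpd (by lia) hF
  have hl0 : l 1 ≠ 0 := by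
    intro h0
    rw [h0] at hN
    simp at hN
    exact hp.ne_zero hN.symm
  have hl : Prime (l 1) := (Ideal.span_singleton_prime hl0).1
    (Ideal.isPrime_of_irreducible_absNorm (hN ▸ hp))
  have hnd {a : ℕ} (ha : a ≠ 0) (hap : a < p) : ¬ p ∣ a :=
    Nat.not_dvd_of_pos_of_lt (Nat.pos_of_ne_zero ha) hap
  have hsub {a b : ℕ} (hb : 1 ≤ b) (ha : a ≤ d) (hab : b < a) : Associated (l 1) (l a - l b) :=
    h.associated_sub hp hl hab.le (hnd (by lia) (by lia)) (hnd (by lia) (by lia))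
  refine ⟨hp, hpd, hd, hl, fun α ↦ ?_, ?_, fun a ha ↦ ?_, fun a ha b hb hab ↦ ?_, ?_, ?_,
    fun γ hγ ↦ h.exists_one_le_abs hp.ne_zero hl0 hγ⟩
  · have hcard : Nat.card (𝓞 F ⧸ Ideal.span {l 1}) = p := by
      rw [← hN, Ideal.absNorm_apply, Submodule.cardQuot_apply]
    have : Finite (𝓞 F ⧸ Ideal.span {l 1}) := Nat.finite_of_card_ne_zero (hcard ▸ hp.ne_zero)
    have := Fintype.ofFinite (𝓞 F ⧸ Ideal.span {l 1})
    rw [Nat.card_eq_fintype_card] at hcard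
    obtain ⟨m, hm⟩ := (ZMod.ringEquivOfPrime _ hp hcard).surjective (Ideal.Quotient.mk _ α)
    obtain ⟨n, rfl⟩ := ZMod.intCast_surjective m
    refine ⟨n, ?_⟩
    rw [← Ideal.mem_span_singleton, ← Ideal.Quotient.mk_eq_mk_iff_sub_mem, ← hm, map_intCast,
      map_intCast]
  · subst hpd
    exact h.prod_eq
  · rw [Finset.mem_Icc] at ha
    exact h.associated hp (hnd (by lia) (by lia))
  · rw [Finset.mem_Icc] at ha hb
    rcases hab.lt_or_gt with hab | hab
    · rw [← neg_sub]
      exact (hsub ha.1 hb.2 hab).neg_right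
    · exact hsub hb.1 ha.2 hab
  · rw [h.eq_mul_chebyshevQuot 2]
    simp only [chebyshevQuot]
    ring
  · subst hpd
    exact h.pow_add_pow_eq

end IsTwoSubTrace

namespace IsTwoSubTrace

open NumberField Polynomial

section

variable {R A : Type*} [CommRing R] [CommRing A] {φ : R →+* A} {p : ℕ} {ζ ζ' : A} {l : ℕ → R}

theorem eval_dickson (h : IsTwoSubTrace φ p ζ ζ' l) (a n : ℕ) :
    (dickson 1 (1 : R) n).eval (2 - l a) = 2 - l (a * n) := by
  apply h.injective
  rw [← eval_map_apply, map_dickson, map_one, map_sub, map_sub, h.map_eq, h.map_eq, map_ofNat,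
    show (2 : A) - (2 - ζ ^ a - ζ' ^ a) = ζ ^ a + ζ' ^ a by ring,
    dickson_one_one_eval_add_inv _ _ (h.pow_mul_pow a)]
  ring

theorem map_two_sub_pow (h : IsTwoSubTrace φ p ζ ζ' l) {k : Type*} [CommRing k] (f : R →+* k)
    (q : ℕ) [Fact q.Prime] [CharP k q] (n : ℕ) : f (2 - l (q ^ n)) = f (2 - l 1) ^ q ^ n := by
  induction n with
  | zero => simp
  | succ n ih =>
    rw [pow_succ, ← h.eval_dickson, ← eval_map_apply, map_dickson, map_one,
      dickson_one_one_charP k q, eval_pow, eval_X, ih, ← pow_mul]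

end

variable {F K : Type*} [Field F] [NumberField F] [Field K] [Algebra F K]
  {p : ℕ} {ζ ζ' : K} {l : ℕ → 𝓞 F}

/-- A prime of the real cyclotomic field which does not divide `p` has norm congruent to `1` or
`-1` modulo `p`. -/
theorem absNorm_mod (h : IsTwoSubTrace (algebraMap (𝓞 F) K) p ζ ζ' l) (hp : p.Prime)
    (hl : Prime (l 1)) {P : Ideal (𝓞 F)} (hP : P.IsPrime) (hP0 : P ≠ ⊥) :
    P = Ideal.span {l 1} ∨ p ∣ P.absNorm + 1 ∨ p ∣ P.absNorm - 1 := by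
  have hmax := hP.isMaximal hP0
  let := Ideal.Quotient.field P
  have : Fintype (𝓞 F ⧸ P) := Fintype.ofFinite _
  obtain ⟨q, hchar⟩ := CharP.exists (𝓞 F ⧸ P)
  obtain ⟨n, hq, hcard⟩ := FiniteField.card (𝓞 F ⧸ P) q
  have := Fact.mk hq
  have hN : P.absNorm = q ^ (n : ℕ) := by
    rw [Ideal.absNorm_apply, Submodule.cardQuot_apply, Nat.card_eq_fintype_card, hcard]
  by_cases hlP : l 1 ∈ P
  · refine .inl (Eq.symm ?_)
    have := ((Ideal.span_singleton_prime hl.ne_zero).2 hl).isMaximal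
      (by simpa using hl.ne_zero)
    exact this.eq_of_le hP.ne_top (by simpa [Ideal.span_le] using hlP)
  right
  by_contra! hcon
  have hmem : l P.absNorm - l 1 ∈ P := by
    have := h.map_two_sub_pow (Ideal.Quotient.mk P) q n
    rw [← hcard, FiniteField.pow_card, hcard, ← hN, Ideal.Quotient.mk_eq_mk_iff_sub_mem] at this
    rw [← neg_mem_iff]
    convert this using 1
    ring
  refine hlP (Ideal.mem_of_dvd _ (h.associated_sub hp hl ?_ hcon.1 hcon.2).dvd' hmem)
  rw [hN]
  exact Nat.one_le_pow _ _ hq.pos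

end IsTwoSubTrace

namespace NumberField

open Module

theorem isPrincipalIdealRing_of_abs_discr_le {F : Type*} [Field F] [NumberField F] [IsTotallyReal F]
    {D B : ℕ} (hD : |discr F| ≤ D)
    (hB : (finrank ℚ F).factorial ^ 2 * D < (finrank ℚ F ^ finrank ℚ F * (B + 1)) ^ 2)
    (h : ∀ P : Ideal (𝓞 F), P.IsPrime → P ≠ ⊥ → P.absNorm ≤ B → P.IsPrincipal) :
    IsPrincipalIdealRing (𝓞 F) := by
  refine RingOfIntegers.isPrincipalIdealRing_of_isPrincipal_of_norm_le_of_isPrime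
    fun ⟨P, hP0⟩ hP hle ↦ h P hP (nonZeroDivisors.ne_zero hP0) ?_
  rw [IsTotallyReal.nrComplexPlaces_eq_zero, pow_zero, one_mul] at hle
  have hd : (0 : ℝ) < finrank ℚ F ^ finrank ℚ F := by
    have : 0 < finrank ℚ F := finrank_pos
    positivity
  have hD' : |(discr F : ℝ)| ≤ D := by exact_mod_cast hD
  have hB' : ((finrank ℚ F).factorial : ℝ) ^ 2 * D <
      ((finrank ℚ F : ℝ) ^ finrank ℚ F * (B + 1)) ^ 2 := by exact_mod_cast hB
  rw [← Nat.lt_succ_iff, ← Nat.cast_lt (α := ℝ)]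
  refine hle.trans_lt ?_
  push_cast
  rw [div_mul_eq_mul_div, div_lt_iff₀ hd]
  refine lt_of_pow_lt_pow_left₀ 2 (by positivity) ?_
  rw [mul_pow, Real.sq_sqrt (by positivity)]
  refine (mul_le_mul_of_nonneg_left hD' (by positivity)).trans_lt (hB'.trans_eq ?_)
  ring

end NumberField

namespace NumberField.IsCMField

open Module

variable {p d : ℕ} [Fact p.Prime] (K : Type*) [Field K] [NumberField K] [IsCMField K]
  [IsCyclotomicExtension {p} ℚ K]

include p in
theorem finrank_maximalRealSubfield (hpd : p = 2 * d + 1) :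
    finrank ℚ (maximalRealSubfield K) = d := by
  have h1 := finrank_mul_finrank ℚ (maximalRealSubfield K) K
  rw [Algebra.IsQuadraticExtension.finrank_eq_two (maximalRealSubfield K) K,
    IsCyclotomicExtension.Rat.finrank p K,
    Nat.totient_prime Fact.out] at h1
  lia

include p in
theorem abs_discr_maximalRealSubfield_le (hpd : p = 2 * d + 1) (hd : d ≠ 0) :
    |discr (maximalRealSubfield K)| ≤ (p ^ (d - 1) : ℕ) := by
  have hp : p.Prime := Fact.out
  have h1 := natAbs_discr_eq_absNorm_differentIdeal_mul_natAbs_discr_pow (maximalRealSubfield K)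
    (𝓞 (maximalRealSubfield K)) K (𝓞 K)
  rw [Algebra.IsQuadraticExtension.finrank_eq_two, IsCyclotomicExtension.Rat.discr_prime p K,
    Int.natAbs_mul, Int.natAbs_pow, Int.natAbs_neg, Int.natAbs_one, one_pow, one_mul,
    Int.natAbs_pow, Int.natAbs_natCast] at h1
  obtain ⟨j, hj, hj'⟩ := (Nat.dvd_prime_pow hp).1
    ((dvd_pow_self _ two_ne_zero).trans (Dvd.intro_left _ h1.symm))
  rw [hj', ← pow_mul] at h1
  have h2 := (Nat.pow_dvd_pow_iff_le_right hp.one_lt).1 (Dvd.intro_left _ h1.symm)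
  rw [Int.abs_eq_natAbs, hj']
  exact_mod_cast Nat.pow_le_pow_right hp.pos (by lia)

theorem exists_isTwoSubTrace : ∃ (ζ ζ' : K) (l : ℕ → 𝓞 (maximalRealSubfield K)),
    IsTwoSubTrace (algebraMap (𝓞 (maximalRealSubfield K)) K) p ζ ζ' l := by
  have hp : p.Prime := Fact.out
  obtain ⟨ζ, hζ⟩ : ∃ ζ : 𝓞 K, IsPrimitiveRoot ζ p :=
    ⟨_, (IsCyclotomicExtension.zeta_spec p ℚ K).toInteger_isPrimitiveRoot⟩
  have hζ1 : ζ * ζ ^ (p - 1) = 1 := by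
    rw [← pow_succ', Nat.sub_add_cancel hp.pos, hζ.pow_eq_one]
  have hconj : complexConj K (ζ : K) = (ζ ^ (p - 1) : 𝓞 K) := by
    let φ : K →+* ℂ := Classical.choice (inferInstance : Nonempty _)
    apply φ.injective
    have h1 : ‖φ (ζ : K)‖ = 1 := Complex.norm_eq_one_of_pow_eq_one (n := p) (by
      rw [← map_pow, ← map_pow, hζ.pow_eq_one, map_one, map_one]) hp.ne_zero
    rw [complexEmbedding_complexConj, ← Complex.inv_eq_conj h1]
    refine (eq_inv_of_mul_eq_one_right ?_).symm
    rw [← map_mul, ← map_mul, hζ1, map_one, map_one]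
  have hconj' : complexConj K (ζ ^ (p - 1) : 𝓞 K) = (ζ : K) := by
    rw [← hconj, complexConj_apply_apply]
  have hex (a : ℕ) : ∃ y : 𝓞 (maximalRealSubfield K), algebraMap (𝓞 (maximalRealSubfield K)) K y =
      ((2 - ζ ^ a - (ζ ^ (p - 1)) ^ a : 𝓞 K) : K) := by
    rw [← RingOfIntegers.complexConj_eq_self_iff]
    simp only [map_sub, map_pow _ _ a, map_ofNat] at hconj hconj' ⊢
    rw [hconj, hconj']
    ring
  choose l hl using hex
  refine ⟨ζ, (ζ ^ (p - 1) : 𝓞 K), l, ?_, hζ.map_of_injective RingOfIntegers.coe_injective, ?_, ?_⟩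
  · exact FaithfulSMul.algebraMap_injective _ _
  · rw [← map_mul, hζ1, map_one]
  · intro a
    simp only [hl, map_sub, map_pow _ _ a, map_ofNat]

end NumberField.IsCMField

namespace NumberField

open Polynomial Module IntermediateField

theorem isPrimePow_absNorm {F : Type*} [Field F] [NumberField F] {P : Ideal (𝓞 F)}
    (hP : P.IsPrime) (hP0 : P ≠ ⊥) : IsPrimePow P.absNorm := by
  have hmax := hP.isMaximal hP0
  let := Ideal.Quotient.field P
  have : Fintype (𝓞 F ⧸ P) := Fintype.ofFinite _
  rw [Ideal.absNorm_apply, Submodule.cardQuot_apply, Nat.card_eq_fintype_card]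
  exact FiniteField.isPrimePow_card _

theorem absNorm_span_of_sq {F : Type*} [Field F] [NumberField F] {g : 𝓞 F}
    (hg : g ^ 2 - 5 * g + 2 = 0) : (Ideal.span {g}).absNorm ^ 2 = 2 ^ finrank ℚ F := by
  have hdeg : (X ^ 2 - 5 * X + 2 : ℚ[X]).natDegree = 2 := by compute_degree!
  have hmonic : (X ^ 2 - 5 * X + 2 : ℚ[X]).Monic := by monicity!
  have hirr : Irreducible (X ^ 2 - 5 * X + 2 : ℚ[X]) := by
    refine irreducible_of_degree_le_three_of_not_isRoot (by rw [hdeg]; simp) fun x hx ↦ ?_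
    have h1 : x ^ 2 - 5 * x + 2 = 0 := by simpa using hx
    have h2 : IsSquare (17 : ℚ) := ⟨2 * x - 5, by linear_combination -4 * h1⟩
    rw [show (17 : ℚ) = (17 : ℕ) by norm_num, Rat.isSquare_natCast_iff] at h2
    exact absurd h2 (by decide +kernel)
  have hmin : minpoly ℚ (g : F) = X ^ 2 - 5 * X + 2 := by
    refine (minpoly.eq_of_irreducible_of_monic hirr ?_ hmonic).symm
    have := congrArg (algebraMap (𝓞 F) F) hg
    simpa [map_ofNat] using this
  have hint : IsIntegral ℚ (g : F) := Algebra.IsIntegral.isIntegral _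
  have h1 := Algebra.norm_eq_norm_adjoin ℚ (g : F)
  have h2 := Algebra.PowerBasis.norm_gen_eq_coeff_zero_minpoly (adjoin.powerBasis hint)
  rw [adjoin.powerBasis_gen, IntermediateField.minpoly_gen, hmin, adjoin.powerBasis_dim, hmin,
    hdeg] at h2
  have h3 := finrank_mul_finrank ℚ ℚ⟮(g : F)⟯ F
  rw [adjoin.finrank hint, hmin, hdeg] at h3
  have h4 : (X ^ 2 - 5 * X + 2 : ℚ[X]).coeff 0 = 2 := by simp [coeff_zero_eq_eval_zero]
  rw [h2, h4] at h1
  have h5 : Algebra.norm ℤ g = 2 ^ finrank ℚ⟮(g : F)⟯ F := by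
    have := Algebra.coe_norm_int g
    rw [h1] at this
    simp at this
    exact_mod_cast this
  rw [Ideal.absNorm_span_singleton, h5, ← h3, Int.natAbs_pow, ← pow_mul, mul_comm]
  rfl

end NumberField

namespace IsTwoSubTrace

open NumberField Module

variable {F K : Type*} [Field F] [NumberField F] [IsTotallyReal F] [Field K] [Algebra F K]
  {p d : ℕ} {ζ ζ' : K} {l : ℕ → 𝓞 F}

theorem isPrincipalIdealRing (h : IsTwoSubTrace (algebraMap (𝓞 F) K) p ζ ζ' l)
    (hp : p.Prime) (hl : Prime (l 1)) {B : ℕ} (hD : |discr F| ≤ (p ^ (d - 1) : ℕ))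
    (hF : finrank ℚ F = d)
    (hB : d.factorial ^ 2 * p ^ (d - 1) < (d ^ d * (B + 1)) ^ 2)
    (H : ∀ P : Ideal (𝓞 F), P.IsPrime → P ≠ ⊥ → P.absNorm ≤ B → 2 ≤ P.absNorm →
      p ∣ P.absNorm + 1 ∨ p ∣ P.absNorm - 1 → P.IsPrincipal) :
    IsPrincipalIdealRing (𝓞 F) := by
  subst hF
  refine isPrincipalIdealRing_of_abs_discr_le hD hB fun P hP hP0 hPB ↦ ?_
  rcases h.absNorm_mod hp hl hP hP0 with h1 | h1
  · exact h1 ▸ ⟨_, rfl⟩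
  · exact H P hP hP0 hPB (isPrimePow_absNorm hP hP0).two_le h1

theorem isPrincipalIdealRing_of_lt (h : IsTwoSubTrace (algebraMap (𝓞 F) K) p ζ ζ' l)
    (hp : p.Prime) (hl : Prime (l 1)) (hD : |discr F| ≤ (p ^ (d - 1) : ℕ))
    (hF : finrank ℚ F = d)
    (hB : d.factorial ^ 2 * p ^ (d - 1) < (d ^ d * (p - 1)) ^ 2) :
    IsPrincipalIdealRing (𝓞 F) := by
  have := hp.two_le
  refine h.isPrincipalIdealRing hp hl (B := p - 2) hD hF
    (by rwa [show p - 2 + 1 = p - 1 by lia]) fun P _ _ hle hge hdvd ↦ ?_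
  rcases hdvd with hdvd | hdvd <;> exact absurd (Nat.le_of_dvd (by lia) hdvd) (by lia)

theorem isPrincipalIdealRing_seventeen (h : IsTwoSubTrace (algebraMap (𝓞 F) K) 17 ζ ζ' l)
    (hl : Prime (l 1)) (hD : |discr F| ≤ (17 ^ (8 - 1) : ℕ)) (hF : finrank ℚ F = 8) :
    IsPrincipalIdealRing (𝓞 F) := by
  refine h.isPrincipalIdealRing (by norm_num) hl (B := 48) hD hF
    (by decide +kernel) fun P hP hP0 hle hge hdvd ↦ ?_
  have hN : P.absNorm = 16 := by
    have hpp := isPrimePow_absNorm hP hP0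
    generalize P.absNorm = N at *
    rw [isPrimePow_iff_card_primeFactors_eq_one] at hpp
    revert N
    decide +kernel
  have h2 : (2 : 𝓞 F) ∈ P := by
    have := P.absNorm_mem
    rw [hN] at this
    exact hP.mem_of_pow_mem 4 (by convert this using 1; norm_num)
  obtain ⟨g, g', hg, hg', hgg'⟩ : ∃ g g' : 𝓞 F, g ^ 2 - 5 * g + 2 = 0 ∧ g' ^ 2 - 5 * g' + 2 = 0 ∧
      g * g' = 2 := by
    suffices hsuff : ∃ η : 𝓞 F, η ^ 2 + η - 4 = 0 by
      obtain ⟨η, hη⟩ := hsuff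
      exact ⟨η + 3, 2 - η, by linear_combination hη, by linear_combination hη,
        by linear_combination -hη⟩
    refine ⟨8 - l 1 - l 2 - l 4 - l 8, h.injective ?_⟩
    have h1 := h.isPrimitiveRoot.geom_sum_eq_zero (by norm_num)
    have h2 := h.isPrimitiveRoot.pow_eq_one
    simp only [Finset.sum_range_succ, Finset.sum_range_zero] at h1
    simp only [map_add, map_sub, map_pow, map_zero, map_ofNat, h.map_eq]
    rw [← h.pow_sub (show 1 ≤ 17 by simp), ← h.pow_sub (show 2 ≤ 17 by simp),
      ← h.pow_sub (show 4 ≤ 17 by simp), ← h.pow_sub (show 8 ≤ 17 by simp)]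
    linear_combination 4 * h1 +
      (8 + 3 * ζ + 2 * ζ ^ 2 + 2 * ζ ^ 3 + 2 * ζ ^ 4 + 2 * ζ ^ 5 + 2 * ζ ^ 6
      + 4 * ζ ^ 7 + 2 * ζ ^ 8 + ζ ^ 9 + 2 * ζ ^ 11 + 2 * ζ ^ 12 + ζ ^ 13 + 2 * ζ ^ 14 + ζ ^ 15) * h2
  have key {x : 𝓞 F} (hx : x ^ 2 - 5 * x + 2 = 0) (hxP : x ∈ P) : P.IsPrincipal := by
    have hx16 := absNorm_span_of_sq hx
    rw [hF, show 2 ^ 8 = 16 ^ 2 by norm_num] at hx16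
    have hx16 := Nat.pow_left_injective two_ne_zero hx16
    obtain ⟨J, hJ⟩ := Ideal.dvd_iff_le.2 ((Ideal.span_singleton_le_iff_mem P).2 hxP)
    have hJ1 := congrArg Ideal.absNorm hJ
    rw [hx16, map_mul, hN, eq_comm, Nat.mul_eq_left (by norm_num), Ideal.absNorm_eq_one_iff] at hJ1
    rw [hJ1, Ideal.mul_top] at hJ
    exact hJ ▸ ⟨_, rfl⟩
  rw [← hgg'] at h2
  rcases hP.mem_or_mem h2 with h2 | h2
  · exact key hg h2
  · exact key hg' h2

end IsTwoSubTrace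

theorem Subgroup.le_of_index_le_pow {G : Type*} [CommGroup G] {p n : ℕ} (hp : p.Prime)
    {H : Subgroup G} (hH0 : H.index ≠ 0) (hH : H.index ≤ p ^ n) (hpow : ∀ g, g ^ p ∈ H)
    {U : ℕ → Subgroup G} (hHU : ∀ k, H ≤ U k) (hU : ∀ k < n, U (k + 1) ≤ U k)
    (hU' : ∀ k < n, ∃ g ∈ U k, g ∉ U (k + 1)) : U n ≤ H := by
  have := Fact.mk hp
  have hdvd : ∀ k ≤ n, p ^ k ∣ (U k).index := by
    intro k hk
    induction k with
    | zero => simp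
    | succ k ih =>
      rw [← relIndex_mul_index (hU k hk), pow_succ']
      refine mul_dvd_mul ?_ (ih (by lia))
      obtain ⟨g, hg, hg'⟩ := hU' k hk
      let N := (U (k + 1)).subgroupOf (U k)
      have : orderOf ((⟨g, hg⟩ : U k) : U k ⧸ N) = p := by
        refine orderOf_eq_prime ?_ ?_
        · rw [← QuotientGroup.mk_pow, QuotientGroup.eq_one_iff, mem_subgroupOf]
          exact hHU (k + 1) (hpow g)
        · rwa [Ne, QuotientGroup.eq_one_iff, mem_subgroupOf]
      exact this ▸ _root_.orderOf_dvd_natCard ((⟨g, hg⟩ : U k) : U k ⧸ N)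
  have h1 := relIndex_mul_index (hHU n)
  have h2 : (U n).index ≠ 0 := right_ne_zero_of_mul (h1 ▸ hH0)
  have h3 := Nat.le_of_dvd (Nat.pos_of_ne_zero h2) (hdvd n le_rfl)
  have h4 : H.relIndex (U n) ≠ 0 := left_ne_zero_of_mul (h1 ▸ hH0)
  rw [← relIndex_eq_one]
  have h5 : 0 < p ^ n := pow_pos hp.pos n
  by_contra h6
  have : 2 * p ^ n ≤ H.relIndex (U n) * (U n).index := Nat.mul_le_mul (by lia) h3
  lia

namespace NumberField

open NumberField.Units

theorem sq_eq_one_of_mem_torsion {F : Type*} [Field F] [NumberField F] [IsTotallyReal F]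
    {x : (𝓞 F)ˣ} (hx : x ∈ torsion F) : x ^ 2 = 1 := by
  obtain ⟨n, hn, hxn⟩ := isOfFinOrder_iff_pow_eq_one.1 ((CommGroup.mem_torsion _).1 hx)
  obtain ⟨w⟩ : Nonempty (InfinitePlace F) := inferInstance
  let ψ := InfinitePlace.embedding_of_isReal (IsTotallyReal.isReal w)
  have h1 : |ψ (algebraMap (𝓞 F) F x)| = 1 := by
    rw [← pow_eq_one_iff_of_nonneg (abs_nonneg _) hn.ne', ← abs_pow, ← map_pow, ← map_pow,
      ← Units.val_pow_eq_pow_val, hxn]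
    simp
  rw [← sq_eq_sq₀ (abs_nonneg _) zero_le_one, sq_abs, one_pow] at h1
  ext
  apply ψ.injective
  simpa using h1

theorem index_range_powMonoidHom_le {F : Type*} [Field F] [NumberField F] [IsTotallyReal F]
    {p : ℕ} (hp : Odd p) :
    (powMonoidHom (α := (𝓞 F)ˣ) p).range.index ≠ 0 ∧
      (powMonoidHom (α := (𝓞 F)ˣ) p).range.index ≤ p ^ (Module.finrank ℚ F - 1) := by
  have hr : rank F = Module.finrank ℚ F - 1 := by
    rw [rank, IsTotallyReal.finrank, InfinitePlace.card_eq_nrRealPlaces_add_nrComplexPlaces,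
      IsTotallyReal.nrComplexPlaces_eq_zero, add_zero]
  let f : (Fin (rank F) → Fin p) → (𝓞 F)ˣ ⧸ (powMonoidHom (α := (𝓞 F)ˣ) p).range :=
    fun e ↦ QuotientGroup.mk (∏ i, fundSystem F i ^ (e i : ℕ))
  have hf : Function.Surjective f := by
    intro x
    obtain ⟨x, rfl⟩ := QuotientGroup.mk_surjective x
    obtain ⟨⟨ζ, e⟩, he, -⟩ := exist_unique_eq_mul_prod F x
    have hp0 : (0 : ℤ) < p := by exact_mod_cast hp.pos
    refine ⟨fun i ↦ ⟨(e i % p).toNat, by have := Int.emod_lt_of_pos (e i) hp0; lia⟩,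
      QuotientGroup.eq.2 ⟨ζ * ∏ i, fundSystem F i ^ (e i / p), ?_⟩⟩
    have hζ : (ζ : (𝓞 F)ˣ) ^ p = ζ := by
      obtain ⟨k, rfl⟩ := hp
      rw [pow_succ, pow_mul, sq_eq_one_of_mem_torsion ζ.2, one_pow, one_mul]
    rw [powMonoidHom_apply, mul_pow, hζ, eq_inv_mul_iff_mul_eq, he, mul_left_comm,
      ← Finset.prod_pow, ← Finset.prod_mul_distrib]
    congr 1
    refine Finset.prod_congr rfl fun i _ ↦ ?_
    have h0 := Int.emod_nonneg (e i) hp0.ne'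
    rw [← zpow_natCast, ← zpow_natCast, ← zpow_mul, ← zpow_add]
    congr 1
    have := Int.emod_add_mul_ediv (e i) p
    simp only [Int.toNat_of_nonneg h0]
    linarith
  have hfin := Finite.of_surjective f hf
  refine ⟨Subgroup.index_ne_zero_of_finite, ?_⟩
  rw [Subgroup.index]
  refine (Nat.card_le_card_of_surjective f hf).trans ?_
  simp [hr]

end NumberField

namespace IsRealCyclotomic

section

variable {R : Type*} [CommRing R] {p d : ℕ} {l : ℕ → R}

/-- The group of units congruent to an integer modulo `l 1 ^ min j d`. -/
def unitsModInt (h : IsRealCyclotomic R p d l) (j : ℕ) : Subgroup Rˣ :=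
  have hmul {u v : Rˣ} (hu : ∃ n : ℤ, l 1 ^ min j d ∣ (u : R) - n)
      (hv : ∃ n : ℤ, l 1 ^ min j d ∣ (v : R) - n) :
      ∃ n : ℤ, l 1 ^ min j d ∣ ((u * v : Rˣ) : R) - n := by
    obtain ⟨m, hm⟩ := hu
    obtain ⟨n, hn⟩ := hv
    refine ⟨m * n, ?_⟩
    convert (hm.mul_right (v : R)).add (hn.mul_left (m : R)) using 1
    push_cast
    ring
  have hone : ∃ n : ℤ, l 1 ^ min j d ∣ ((1 : Rˣ) : R) - n := ⟨1, by simp⟩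
  { carrier := {u | ∃ n : ℤ, l 1 ^ min j d ∣ (u : R) - n}
    mul_mem' := hmul
    one_mem' := hone
    inv_mem' := fun {u} hu ↦ by
      have hpow (n : ℕ) : ∃ m : ℤ, l 1 ^ min j d ∣ ((u ^ n : Rˣ) : R) - m := by
        induction n with
        | zero => simpa using hone
        | succ n ih => simpa only [pow_succ] using hmul ih hu
      obtain ⟨n, hn⟩ := h.exists_pow_dvd_pow_sub_intCast ((u⁻¹ : Rˣ) : R)
      have := hmul (hpow (p - 1)) (v := u⁻¹ ^ p)
        ⟨n, by simpa using (pow_dvd_pow _ (min_le_right _ _)).trans hn⟩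
      rwa [inv_pow, ← div_eq_mul_inv, ← inv_div, ← pow_sub_one_mul h.prime_nat.ne_zero,
        mul_div_cancel_left] at this }

theorem pow_mem_unitsModInt (h : IsRealCyclotomic R p d l) (j : ℕ) (u : Rˣ) :
    u ^ p ∈ h.unitsModInt j := by
  obtain ⟨n, hn⟩ := h.exists_pow_dvd_pow_sub_intCast (u : R)
  exact ⟨n, by simpa using (pow_dvd_pow _ (min_le_right _ _)).trans hn⟩

theorem notMem_unitsModInt [IsDomain R] (h : IsRealCyclotomic R p d l) {k : ℕ} (hk : 1 ≤ k)
    (hkd : k < d) {v : Rˣ} {c b : ℤ} (hb : ¬ (p : ℤ) ∣ b)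
    (hv : l 1 ^ (k + 1) ∣ (v : R) - (c + b * l 1 ^ k)) : v ∉ h.unitsModInt (k + 1) := by
  rintro ⟨n, hn⟩
  rw [min_eq_left (by lia)] at hn
  have h1 : l 1 ^ (k + 1) ∣ ((n - c : ℤ) : R) - b * l 1 ^ k := by
    convert hv.sub hn using 1
    push_cast
    ring
  have h2 : l 1 ∣ ((n - c : ℤ) : R) := by
    have h3 := ((dvd_pow_self (l 1) (by lia)).trans h1).add
      ((dvd_pow_self (l 1) (by lia : k ≠ 0)).mul_left (b : R))
    rwa [sub_add_cancel] at h3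
  have h4 := (dvd_sub_comm.1 h1).add ((pow_dvd_pow _ hkd).trans (h.pow_dvd_intCast h2))
  rw [sub_add_cancel, pow_succ', mul_dvd_mul_iff_right (pow_ne_zero k h.prime.ne_zero)] at h4
  exact hb (h.dvd_intCast_iff.1 h4)

end

open NumberField Module

variable {F : Type*} [Field F] [NumberField F] [IsTotallyReal F] {p d : ℕ} {l : ℕ → 𝓞 F}

/-- **Kummer's lemma**: in the presence of enough units, a unit that is congruent to an integer
modulo `p` is a `p`-th power. -/
theorem exists_eq_pow (h : IsRealCyclotomic (𝓞 F) p d l) (hF : finrank ℚ F = d)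
    (hv : ∀ k, 1 ≤ k → k < d → ∃ (v : (𝓞 F)ˣ) (c b : ℤ), ¬ (p : ℤ) ∣ b ∧
      l 1 ^ (k + 1) ∣ (v : 𝓞 F) - (c + b * l 1 ^ k)) (u : (𝓞 F)ˣ) (n : ℤ)
    (hu : l 1 ^ d ∣ (u : 𝓞 F) - n) : ∃ ε : (𝓞 F)ˣ, u = ε ^ p := by
  have hd := h.two_le
  obtain ⟨h0, hle⟩ := index_range_powMonoidHom_le (F := F) (p := p)
    ⟨d, h.eq_two_mul_add_one⟩
  rw [hF] at hle
  obtain ⟨ε, hε⟩ : u ∈ (powMonoidHom (α := (𝓞 F)ˣ) p).range := by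
    refine Subgroup.le_of_index_le_pow h.prime_nat h0 hle (fun g ↦ ⟨g, rfl⟩)
      (U := fun k ↦ h.unitsModInt (k + 1)) ?_ ?_ ?_ ⟨n, ?_⟩
    · rintro k _ ⟨g, rfl⟩
      exact h.pow_mem_unitsModInt _ _
    · rintro k - v ⟨m, hm⟩
      exact ⟨m, (pow_dvd_pow _ (min_le_min_right _ (Nat.le_succ _))).trans hm⟩
    · intro k hk
      obtain ⟨v, c, b, hb, hv⟩ := hv (k + 1) (by lia) (by lia)
      refine ⟨v, ⟨c, ?_⟩, h.notMem_unitsModInt (by lia) (by lia) hb hv⟩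
      rw [min_eq_left (by lia)]
      convert ((pow_dvd_pow _ (Nat.le_succ _)).trans hv).add
        (dvd_mul_left (l 1 ^ (k + 1)) (b : 𝓞 F)) using 1
      ring
    · rwa [Nat.sub_add_cancel (by lia), min_self]
  exact ⟨ε, hε.symm⟩

end IsRealCyclotomic

/-! Computation with polynomials modulo `p` and `X ^ m`, given by their lists of coefficients. -/

namespace TruncPoly

/-- The value at `x` of the polynomial with the given list of coefficients. -/
def eval {A : Type*} [CommRing A] (x : A) : List ℕ → A
  | [] => 0
  | a :: f => a + x * eval x f

/-- Sum of polynomials modulo `p`. -/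
def addMod (p : ℕ) : List ℕ → List ℕ → List ℕ
  | [], g => g
  | f, [] => f
  | a :: f, b :: g => (a + b) % p :: addMod p f g

/-- Product of a constant and a polynomial modulo `p`. -/
def smul (p c : ℕ) (f : List ℕ) : List ℕ := f.map fun a ↦ c * a % p

/-- Product of polynomials modulo `p` and `X ^ m`. -/
def mul (p m : ℕ) : List ℕ → List ℕ → List ℕ
  | [], _ => []
  | a :: f, g => (addMod p (smul p a g) (0 :: mul p m f g)).take m

/-- Powers of a polynomial modulo `p` and `X ^ m`. -/
def pow (p m : ℕ) (f : List ℕ) : ℕ → List ℕ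
  | 0 => [1]
  | n + 1 => mul p m f (pow p m f n)

/-- The polynomial `chebyshevQuot X n` modulo `p` and `X ^ m`. -/
def cheb (p m : ℕ) : ℕ → List ℕ
  | 0 => []
  | 1 => [1]
  | n + 2 =>
    addMod p [2]
      (addMod p (mul p m [2, p - 1] (cheb p m (n + 1))) (smul p (p - 1) (cheb p m n)))

/-- The product of the powers of `chebyshevQuot X a`, `chebyshevQuot X (a + 1)`, … with the given
exponents, modulo `p` and `X ^ m`. -/
def chebProd (p m : ℕ) : ℕ → List ℕ → List ℕ
  | _, [] => [1]
  | a, e :: E => mul p m (pow p m (cheb p m a) e) (chebProd p m (a + 1) E)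

variable {A : Type*} [CommRing A] {p m : ℕ} {x : A}

theorem cast_mod (hp : (p : A) = 0) (a : ℕ) : ((a % p : ℕ) : A) = a := by
  conv_rhs => rw [← Nat.mod_add_div a p]
  simp [hp]

theorem eval_addMod (hp : (p : A) = 0) (f g : List ℕ) :
    eval x (addMod p f g) = eval x f + eval x g := by
  induction f, g using addMod.induct with
  | case1 g => simp [addMod, eval]
  | case2 f hf => cases f <;> simp [addMod, eval]
  | case3 a f b g ih =>
    simp only [addMod, eval, ih, cast_mod hp]
    push_cast
    ring

theorem eval_smul (hp : (p : A) = 0) (c : ℕ) (f : List ℕ) :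
    eval x (smul p c f) = c * eval x f := by
  induction f with
  | nil => simp [smul, eval]
  | cons a f ih =>
    rw [smul] at ih
    simp only [smul, List.map_cons, eval, ih, cast_mod hp]
    push_cast
    ring

theorem eval_append (f g : List ℕ) :
    eval x (f ++ g) = eval x f + x ^ f.length * eval x g := by
  induction f with
  | nil => simp [eval]
  | cons a f ih =>
    simp only [List.cons_append, eval, ih, List.length_cons]
    ring

theorem eval_take (hx : x ^ m = 0) (f : List ℕ) : eval x (f.take m) = eval x f := by
  conv_rhs => rw [← List.take_append_drop m f]
  rw [eval_append]
  rcases le_total m f.length with h | h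
  · simp [h, hx]
  · simp [h, List.drop_of_length_le, eval]

theorem eval_mul (hp : (p : A) = 0) (hx : x ^ m = 0) (f g : List ℕ) :
    eval x (mul p m f g) = eval x f * eval x g := by
  induction f with
  | nil => simp [mul, eval]
  | cons a f ih =>
    simp only [mul, eval_take hx, eval_addMod hp, eval_smul hp, eval, ih]
    push_cast
    ring

theorem eval_pow (hp : (p : A) = 0) (hx : x ^ m = 0) (f : List ℕ) (n : ℕ) :
    eval x (pow p m f n) = eval x f ^ n := by
  induction n with
  | zero => simp [pow, eval]
  | succ n ih => rw [pow, eval_mul hp hx, ih, pow_succ']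

theorem eval_cheb (hp : (p : A) = 0) (hp0 : p ≠ 0) (hx : x ^ m = 0) (n : ℕ) :
    eval x (cheb p m n) = chebyshevQuot x n := by
  have h1 : ((p - 1 : ℕ) : A) = -1 := by
    rw [Nat.cast_sub (by lia), hp, Nat.cast_one, zero_sub]
  induction n using Nat.twoStepInduction with
  | zero => rfl
  | one => simp [cheb, eval, chebyshevQuot]
  | more n h0 h2 =>
    simp only [cheb, eval_addMod hp, eval_mul hp hx, eval_smul hp, eval, h0, h2, chebyshevQuot, h1]
    push_cast
    ring

theorem eval_chebProd (hp : (p : A) = 0) (hp0 : p ≠ 0) (hx : x ^ m = 0) (a : ℕ) (E : List ℕ) :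
    eval x (chebProd p m a E) = ((E.zipIdx a).map fun e ↦ chebyshevQuot x e.2 ^ e.1).prod := by
  induction E generalizing a with
  | nil => simp [chebProd, eval]
  | cons e E ih => simp [chebProd, eval_mul hp hx, eval_pow hp hx, eval_cheb hp hp0 hx, ih]

theorem eval_replicate_zero (n : ℕ) : eval x (List.replicate n 0) = 0 := by
  induction n with
  | zero => rfl
  | succ n ih => simp [List.replicate_succ, eval, ih]

end TruncPoly

theorem map_chebyshevQuot {R S : Type*} [CommRing R] [CommRing S] (f : R →+* S) (x : R) (n : ℕ) :
    f (chebyshevQuot x n) = chebyshevQuot (f x) n := by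
  induction n using Nat.twoStepInduction with
  | zero => simp [chebyshevQuot]
  | one => simp [chebyshevQuot]
  | more n h0 h2 => simp [chebyshevQuot, h0, h2, map_ofNat]

theorem IsTwoSubTrace.exists_unit_of_chebProd {R A : Type*} [CommRing R] [CommRing A] [IsDomain R]
    {φ : R →+* A} {p d : ℕ} {ζ ζ' : A} {l : ℕ → R} (h : IsTwoSubTrace φ p ζ ζ' l)
    (h' : IsRealCyclotomic R p d l) {k c : ℕ} (hk : 1 ≤ k) (hkd : k < d) {E : List ℕ}
    (hE : E.length < d)
    (hc : TruncPoly.chebProd p (k + 1) 2 E = c :: (List.replicate (k - 1) 0 ++ [c])) :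
    ∃ v : Rˣ, l 1 ^ (k + 1) ∣ (v : R) - (c + c * l 1 ^ k) := by
  have hunit : IsUnit ((E.zipIdx 2).map fun e ↦ chebyshevQuot (l 1) e.2 ^ e.1).prod := by
    refine List.prod_isUnit fun u hu ↦ ?_
    obtain ⟨⟨e, a⟩, hea, rfl⟩ := List.mem_map.1 hu
    refine IsUnit.pow _ ?_
    have ha1 := List.le_snd_of_mem_zipIdx hea
    have ha2 := List.snd_lt_add_of_mem_zipIdx hea
    obtain ⟨v, hv⟩ := h'.associated a (Finset.mem_Icc.2 (by simp at *; lia))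
    rw [h.eq_mul_chebyshevQuot a] at hv
    exact mul_left_cancel₀ h'.prime.ne_zero hv ▸ v.isUnit
  refine ⟨hunit.unit, ?_⟩
  rw [IsUnit.unit_spec, ← Ideal.mem_span_singleton, ← Ideal.Quotient.eq_zero_iff_mem]
  have hp : ((p : ℕ) : R ⧸ Ideal.span {l 1 ^ (k + 1)}) = 0 := by
    rw [← map_natCast (Ideal.Quotient.mk _), Ideal.Quotient.eq_zero_iff_mem,
      Ideal.mem_span_singleton]
    exact (pow_dvd_pow _ hkd).trans h'.pow_dvd_natCast
  have hx : (Ideal.Quotient.mk (Ideal.span {l 1 ^ (k + 1)}) (l 1)) ^ (k + 1) = 0 := by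
    rw [← map_pow, Ideal.Quotient.eq_zero_iff_mem]
    exact Ideal.mem_span_singleton_self _
  have := TruncPoly.eval_chebProd hp h'.prime_nat.ne_zero hx 2 E
  obtain ⟨k, rfl⟩ := Nat.exists_eq_add_of_le' hk
  rw [hc, TruncPoly.eval, TruncPoly.eval_append, TruncPoly.eval_replicate_zero] at this
  rw [map_sub, map_list_prod, List.map_map, sub_eq_zero]
  simp only [Function.comp_def, map_pow, map_chebyshevQuot]
  rw [← this]
  simp [TruncPoly.eval]
  ring

open NumberField Module

/-- Fermat's Last Theorem for a prime exponent `p = 2 * d + 1`, given an auxiliary prime `q`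
satisfying the conditions of Sophie Germain, the triviality of the class group of the maximal real
subfield of the `p`-th cyclotomic field, and exponents of products of cyclotomic units congruent to
`c * (1 + l 1 ^ k)` modulo `l 1 ^ (k + 1)` for `1 ≤ k < d`. -/
theorem fermatLastTheoremFor_of_chebProd {p d q N : ℕ} (hp : p.Prime) (hq : q.Prime)
    (hpd : p = 2 * d + 1) (hd : 2 ≤ d) (hN : q = N * p + 1)
    (hcons : ∀ v : ZMod q, v ^ N = 1 → (v + 1) ^ N ≠ 1) (hpow : (p : ZMod q) ^ N ≠ 1)
    (hPID : ∀ (F K : Type) [Field F] [NumberField F] [IsTotallyReal F] [Field K] [Algebra F K]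
      (ζ ζ' : K) (l : ℕ → 𝓞 F), IsTwoSubTrace (algebraMap (𝓞 F) K) p ζ ζ' l → Prime (l 1) →
      |discr F| ≤ (p ^ (d - 1) : ℕ) → finrank ℚ F = d → IsPrincipalIdealRing (𝓞 F))
    (E : ℕ → List ℕ)
    (hE : ∀ k ∈ Finset.Ico 1 d, (E k).length < d ∧ ∃ c ∈ Finset.Ico 1 p,
      TruncPoly.chebProd p (k + 1) 2 (E k) = c :: (List.replicate (k - 1) 0 ++ [c])) :
    FermatLastTheoremFor p := by
  have := Fact.mk hp
  have := Fact.mk hq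
  have := NeZero.mk hp.ne_zero
  let K := CyclotomicField p ℚ
  have : IsCyclotomicExtension {p} ℚ K := CyclotomicField.isCyclotomicExtension p ℚ
  have : IsCMField K := IsCyclotomicExtension.Rat.isCMField K (S := {p}) ⟨p, rfl, by lia⟩
  let F := maximalRealSubfield K
  obtain ⟨ζ, ζ', l, hl⟩ := IsCMField.exists_isTwoSubTrace (p := p) K
  have hF : finrank ℚ F = d := IsCMField.finrank_maximalRealSubfield (p := p) K hpd
  have hD := IsCMField.abs_discr_maximalRealSubfield_le (p := p) K hpd (by lia)
  have h := hl.isRealCyclotomic hp hpd hd hF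
  have := hPID F K ζ ζ' l hl h.prime hD hF
  have hII {x y z : ℤ} (hxy : IsCoprime x y) (hz0 : z ≠ 0) (hz : (p : ℤ) ∣ z) :
      x ^ p + y ^ p ≠ z ^ p := by
    refine h.int_pow_add_pow_ne (h.exists_eq_pow hF fun k hk hkd ↦ ?_) hxy hz0 hz
    obtain ⟨hlen, c, hc, hc'⟩ := hE k (Finset.mem_Ico.2 ⟨hk, hkd⟩)
    obtain ⟨v, hv⟩ := hl.exists_unit_of_chebProd h hk hkd hlen hc'
    rw [Finset.mem_Ico] at hc
    exact ⟨v, c, c, fun hpc ↦ Nat.not_dvd_of_pos_of_lt hc.1 hc.2 (Int.natCast_dvd_natCast.1 hpc),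
      by simpa using hv⟩
  have hodd : Odd p := ⟨d, hpd⟩
  rw [fermatLastTheoremFor_iff_int]
  refine fermatLastTheoremWith_of_fermatLastTheoremWith_coprime fun x y z hx hy hz hgcd heq ↦ ?_
  have heq' : x ^ p + y ^ p + (-z) ^ p = 0 := by rw [hodd.neg_pow, heq]; ring
  have hgcd' : Finset.gcd {x, y, -z} id = 1 := by
    simpa [Finset.gcd_insert, ← Int.abs_eq_normalize] using hgcd
  have hxy := isCoprime_of_gcd_eq_one_of_FLT hgcd' heq'
  have hyz : IsCoprime y (-z) := by
    refine isCoprime_of_gcd_eq_one_of_FLT (n := p) (c := x) ?_ (by linear_combination heq')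
    rw [← hgcd']
    congr 1
    ext
    simp
    tauto
  have hxz : IsCoprime x (-z) := by
    refine isCoprime_of_gcd_eq_one_of_FLT (n := p) (c := y) ?_ (by linear_combination heq')
    rw [← hgcd']
    congr 1
    ext
    simp
    tauto
  rcases dvd_of_pow_add_pow_add_pow_eq_zero hp hodd hN hcons hpow heq' hxy hyz hxz
    with h1 | h1 | h1
  · refine hII (x := z) (y := -y) ?_ hx h1 (by rw [hodd.neg_pow]; linear_combination -heq)
    exact ((IsCoprime.neg_right_iff _ _).1 hyz).symm.neg_right
  · refine hII (x := z) (y := -x) ?_ hy h1 (by rw [hodd.neg_pow]; linear_combination -heq)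
    exact ((IsCoprime.neg_right_iff _ _).1 hxz).symm.neg_right
  · exact hII hxy hz (by simpa using h1) heq

theorem fermatLastTheoremFor_of_chebProd_of_lt {p d q N : ℕ} (hp : p.Prime) (hq : q.Prime)
    (hpd : p = 2 * d + 1) (hd : 2 ≤ d) (hB : d.factorial ^ 2 * p ^ (d - 1) < (d ^ d * (p - 1)) ^ 2)
    (hN : q = N * p + 1) (hcons : ∀ v : ZMod q, v ^ N = 1 → (v + 1) ^ N ≠ 1)
    (hpow : (p : ZMod q) ^ N ≠ 1) (E : ℕ → List ℕ)
    (hE : ∀ k ∈ Finset.Ico 1 d, (E k).length < d ∧ ∃ c ∈ Finset.Ico 1 p,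
      TruncPoly.chebProd p (k + 1) 2 (E k) = c :: (List.replicate (k - 1) 0 ++ [c])) :
    FermatLastTheoremFor p :=
  fermatLastTheoremFor_of_chebProd hp hq hpd hd hN hcons hpow
    (fun _ _ _ _ _ _ _ _ _ _ h hl hD hF ↦ h.isPrincipalIdealRing_of_lt hp hl hD hF hB) E hE

theorem fermatLastTheoremFive : FermatLastTheoremFor 5 :=
  fermatLastTheoremFor_of_chebProd_of_lt (d := 2) (q := 11) (N := 2) (by norm_num)
    (by norm_num) rfl le_rfl (by decide +kernel) rfl (by decide +kernel) (by decide +kernel)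
    (fun _ ↦ [1]) (by decide +kernel)

theorem fermatLastTheoremSeven : FermatLastTheoremFor 7 :=
  fermatLastTheoremFor_of_chebProd_of_lt (d := 3) (q := 29) (N := 4) (by norm_num)
    (by norm_num) rfl (by norm_num) (by decide +kernel) rfl (by decide +kernel) (by decide +kernel)
    (fun k ↦ [[], [5, 1], [5, 6]].getD k []) (by decide +kernel)

theorem fermatLastTheoremEleven : FermatLastTheoremFor 11 :=
  fermatLastTheoremFor_of_chebProd_of_lt (d := 5) (q := 23) (N := 2) (by norm_num)
    (by norm_num) rfl (by norm_num) (by decide +kernel) rfl (by decide +kernel) (by decide +kernel)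
    (fun k ↦ [[], [8, 0, 7, 1], [4, 4, 9, 4], [7, 8, 3, 1], [4, 9, 5, 3]].getD k [])
    (by decide +kernel)

theorem fermatLastTheoremThirteen : FermatLastTheoremFor 13 :=
  fermatLastTheoremFor_of_chebProd_of_lt (d := 6) (q := 53) (N := 4) (by norm_num)
    (by norm_num) rfl (by norm_num) (by decide +kernel) rfl (by decide +kernel) (by decide +kernel)
    (fun k ↦ [[], [0, 2, 8, 9, 0], [6, 12, 6, 2, 11], [6, 9, 5, 9, 1], [6, 12, 2, 7, 0],
      [9, 4, 10, 1, 3]].getD k []) (by decide +kernel)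

theorem fermatLastTheoremSeventeen : FermatLastTheoremFor 17 :=
  fermatLastTheoremFor_of_chebProd (d := 8) (q := 137) (N := 8) (by norm_num)
    (by norm_num) rfl (by norm_num) rfl
    (by decide +kernel) (by decide +kernel)
    (fun _ _ _ _ _ _ _ _ _ _ h hl hD hF ↦ h.isPrincipalIdealRing_seventeen hl hD hF)
    (fun k ↦ [[], [0, 0, 0, 12, 10, 11, 1], [0, 6, 0, 4, 6, 15, 4], [12, 2, 11, 1, 14, 9, 15],
      [10, 3, 3, 1, 5, 6, 5], [3, 5, 12, 11, 2, 16, 1], [14, 1, 12, 15, 15, 3, 7],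
      [10, 14, 6, 3, 5, 12, 7]].getD k []) (by decide +kernel)

/-- Fermat's Last Theorem holds for the exponents 5, 7, 11, 13 and 17. -/
theorem stmt6 : ∀ n ∈ ({5, 7, 11, 13, 17} : Finset ℕ), ∀ x y z : ℕ,
    0 < x → 0 < y → 0 < z → x ^ n + y ^ n ≠ z ^ n := by
  intro n hn x y z hx hy hz
  have key : FermatLastTheoremFor n := by
    simp only [Finset.mem_insert, Finset.mem_singleton] at hn
    rcases hn with rfl | rfl | rfl | rfl | rfl
    exacts [fermatLastTheoremFive, fermatLastTheoremSeven, fermatLastTheoremEleven,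
      fermatLastTheoremThirteen, fermatLastTheoremSeventeen]
  exact key x y z hx.ne' hy.ne' hz.ne'
end

section
/- Let p be an odd prime. Suppose that every pair of rational numbers (x, y) satisfying y² = 4·x^p + 1 has x = 0. Then there are no rational numbers u, v, w with uvw ≠ 0 and u^p + v^p + w^p = 0. (This is the reduction of Fermat's Last Theorem for exponent p to the determination of the rational points of the curve y² = 4x^p + 1, via the map (u : v : w) ↦ (−uv/w², 2u^p/w^p + 1).) -/
/-- Reduction of Fermat's Last Theorem for an odd prime exponent `p` to the determination
of the rational points of the curve `y² = 4xᵖ + 1`: if every rational point of that curve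
has `x = 0`, then there is no nontrivial rational solution of `uᵖ + vᵖ + wᵖ = 0`. -/
theorem stmt7 (p : ℕ) (hp : p.Prime) (hodd : Odd p)
    (h : ∀ x y : ℚ, y ^ 2 = 4 * x ^ p + 1 → x = 0) :
    ∀ u v w : ℚ, u * v * w ≠ 0 → u ^ p + v ^ p + w ^ p ≠ 0 := by
  intro u v w huvw hsum
  have hw : w ≠ 0 := right_ne_zero_of_mul huvw
  have huv : u * v ≠ 0 := left_ne_zero_of_mul huvw
  have hx : -(u * v) / w ^ 2 = 0 := by
    refine h _ (2 * (u ^ p / w ^ p) + 1) ?_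
    have hv : v ^ p = -u ^ p - w ^ p := by linear_combination hsum
    have hwp : w ^ p ≠ 0 := pow_ne_zero p hw
    rw [div_pow, hodd.neg_pow, mul_pow, hv, pow_right_comm]
    field_simp
    ring
  exact div_ne_zero (neg_ne_zero.mpr huv) (pow_ne_zero 2 hw) hx
end

section
/- Let p ≥ 5 be a prime, let L = ℚ[x]/(x^p − 2) with α the image of x, let L₂ = ℚ₂[x]/(x^p − 2) with λ the image of x, and let ι : L → L₂ be the ring homomorphism over ℚ with ι(α) = λ. Assume that the class number of L is odd. If u is a unit of the ring of integers O_L such that ι(u) is a square in L₂, then u is a square in L. (Equivalently, the natural map O_L^×/(O_L^×)² → L₂^×/(L₂^×)² is injective.) -/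
open NumberField

theorem finite_ker_nsmul (M : Type*) [AddCommGroup M] [Module.Finite ℤ M] {n : ℕ} (hn : n ≠ 0) :
    Finite (nsmulAddMonoidHom (α := M) n).ker := by
  have : Finite (Submodule.torsion ℤ M) := Module.finite_of_fg_torsion _ Submodule.torsion_isTorsion
  refine Finite.of_injective (β := Submodule.torsion ℤ M)
    (fun x ↦ ⟨x, (Submodule.mem_torsion_iff _).2 ⟨⟨n, by simpa using hn⟩, ?_⟩⟩) ?_
  · have hx : n • (x : M) = 0 := x.2
    simpa [Submonoid.smul_def] using hx
  · exact fun x y h ↦ Subtype.ext (congrArg (fun z : Submodule.torsion ℤ M ↦ (z : M)) h)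

open Module in
theorem index_range_nsmul_of_finite (M : Type*) [AddCommGroup M] [Module.Finite ℤ M] {n : ℕ}
    (hn : n ≠ 0) :
    (nsmulAddMonoidHom (α := M) n).range.index =
      n ^ finrank ℤ M * Nat.card (nsmulAddMonoidHom (α := M) n).ker := by
  let T := Submodule.torsion ℤ M
  have : Finite T := Module.finite_of_fg_torsion T (Submodule.torsion_isTorsion)
  obtain ⟨f, hf⟩ := Module.projective_lifting_property _ (LinearMap.id : M ⧸ T →ₗ[ℤ] M ⧸ T)
    T.mkQ_surjective
  let e : M ≃ₗ[ℤ] T × (M ⧸ T) :=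
    (lequivProdOfRightSplitExact T.injective_subtype (by simp) hf).symm
  have hrk : finrank ℤ (M ⧸ T) = finrank ℤ M := by
    rw [← T.finrank_quotient_add_finrank, (Module.finrank_eq_zero_iff_isTorsion (R := ℤ) (M := T)).2
      Submodule.torsion_isTorsion, add_zero]
  have hrange : ((nsmulAddMonoidHom (α := M) n).range.map e.toAddEquiv.toAddMonoidHom) =
      (nsmulAddMonoidHom (α := T) n).range.prod (nsmulAddMonoidHom (α := M ⧸ T) n).range := by
    ext ⟨x, y⟩
    simp only [AddSubgroup.mem_map, AddMonoidHom.mem_range, AddSubgroup.mem_prod]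
    constructor
    · rintro ⟨_, ⟨z, rfl⟩, hz⟩
      refine ⟨⟨(e z).1, ?_⟩, ⟨(e z).2, ?_⟩⟩
      · simpa using congrArg Prod.fst hz
      · simpa using congrArg Prod.snd hz
    · rintro ⟨⟨x, rfl⟩, ⟨y, rfl⟩⟩
      exact ⟨_, ⟨e.symm (x, y), rfl⟩, by simp⟩
  have hker : Nat.card (nsmulAddMonoidHom (α := M) n).ker =
      Nat.card (nsmulAddMonoidHom (α := T) n).ker := by
    refine Nat.card_congr ⟨fun x ↦ ⟨⟨x, ?_⟩, ?_⟩, fun x ↦ ⟨x, ?_⟩, fun _ ↦ rfl, fun _ ↦ rfl⟩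
    · exact (Submodule.mem_torsion_iff _).2 ⟨⟨n, by simpa using hn⟩, by
        have hx : n • (x : M) = 0 := x.2
        simpa [Submonoid.smul_def] using hx⟩
    · exact Subtype.ext x.2
    · exact congrArg Subtype.val x.2
  have h1 := AddSubgroup.index_map_equiv (nsmulAddMonoidHom (α := M) n).range e.toAddEquiv
  rw [← h1]
  erw [hrange]
  rw [AddSubgroup.index_prod, AddSubgroup.index_range, AddSubgroup.index_range_nsmul, hker, hrk,
    mul_comm]

open Module in
theorem finrank_le_of_hilbert90 {M M' : Type*} [AddCommGroup M] [AddCommGroup M']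
    [Module.Finite ℤ M] [Module.Finite ℤ M'] (N : M →ₗ[ℤ] M') (i : M' →ₗ[ℤ] M) (σ : M →ₗ[ℤ] M)
    (hi : Function.Injective i) (hNi : ∀ f, N (i f) = 2 • f)
    (hiN : ∀ e, i (N e) = e + σ e) (hσi : ∀ f, σ (i f) = i f)
    (h90 : ∀ a, N a = 0 → ∃ e, a = e - σ e)
    (hM : Nat.card (nsmulAddMonoidHom (α := M') 2).ker ≤ 2)
    (t : M') (ht : 2 • t = 0) (ht0 : t ≠ 0) :
    finrank ℤ M ≤ 2 * finrank ℤ M' ∧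
      (finrank ℤ M = 2 * finrank ℤ M' → ∀ f, ∃ e g, f = N e + 2 • g) := by
  let A := LinearMap.ker N
  let φ : M →ₗ[ℤ] A := LinearMap.codRestrict A (LinearMap.id - σ) (fun e ↦ by
    have h1 := hσi (N e)
    rw [hiN, map_add, add_comm] at h1
    refine hi ?_
    have h2 := hiN (e - σ e)
    rw [map_sub σ, add_right_cancel h1] at h2
    simpa using h2)
  have hφ : Function.Surjective φ := by
    rintro ⟨a, ha⟩
    obtain ⟨e, he⟩ := h90 a ha
    exact ⟨e, Subtype.ext he.symm⟩
  let D := (nsmulAddMonoidHom (α := A) 2).range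
  let D' := (nsmulAddMonoidHom (α := M') 2).range
  have hle : D'.comap N.toAddMonoidHom ≤ D.comap φ.toAddMonoidHom := by
    rintro e ⟨f, hf⟩
    have hf : 2 • f = N e := hf
    have hb : N (e - i f) = 0 := by rw [map_sub, hNi, hf, sub_self]
    refine ⟨⟨e - i f, hb⟩, Subtype.ext ?_⟩
    have h1 := hiN (e - i f)
    rw [hb, map_zero, map_sub, hσi] at h1
    change 2 • (e - i f) = e - σ e
    rw [two_nsmul, ← sub_eq_zero]
    calc _ = (e - i f + (σ e - i f)) := by abel
      _ = 0 := h1.symm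
  have hDindex : (D.comap φ.toAddMonoidHom).index = D.index :=
    AddSubgroup.index_comap_of_surjective _ hφ
  have hD : D.index = _ := index_range_nsmul_of_finite A two_ne_zero
  have hD' : D'.index = _ := index_range_nsmul_of_finite M' two_ne_zero
  have hA2 : 2 ≤ Nat.card (nsmulAddMonoidHom (α := A) 2).ker := by
    have := finite_ker_nsmul A two_ne_zero
    have htA : N (i t) = 0 := (hNi t).trans ht
    have : Nontrivial (nsmulAddMonoidHom (α := A) 2).ker :=
      ⟨⟨⟨i t, htA⟩, Subtype.ext (by
        change 2 • i t = 0
        rw [← map_nsmul, ht, map_zero])⟩, 0, fun h ↦ ht0 (hi ?_)⟩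
    · exact Finite.one_lt_card
    · simpa using congrArg (fun z : (nsmulAddMonoidHom (α := A) 2).ker ↦ ((z : A) : M)) h
  have hD'0 : D'.index ≠ 0 := by
    have := finite_ker_nsmul M' two_ne_zero
    rw [hD']
    exact mul_ne_zero (by positivity) Nat.card_pos.ne'
  have h1 : D.index ≤ D'.relIndex N.toAddMonoidHom.range := by
    rw [← hDindex, ← AddSubgroup.index_comap]
    refine Nat.le_of_dvd (Nat.pos_of_ne_zero ?_) (AddSubgroup.index_dvd_of_le hle)
    rw [AddSubgroup.index_comap]
    exact fun h ↦ hD'0 (AddSubgroup.index_eq_zero_of_relIndex_eq_zero h)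
  have h2 : D'.relIndex N.toAddMonoidHom.range * (D' ⊔ N.toAddMonoidHom.range).index = D'.index := by
    rw [← AddSubgroup.relIndex_sup_left, sup_comm, AddSubgroup.relIndex_mul_index le_sup_right]
  have hrk : finrank ℤ M ≤ finrank ℤ A + finrank ℤ M' := by
    have := A.finrank_quotient_add_finrank
    have : finrank ℤ (M ⧸ A) = finrank ℤ N.range := N.quotKerEquivRange.finrank_eq
    have := N.range.finrank_le
    omega
  have h3 : 2 ^ (finrank ℤ A + 1) * (D' ⊔ N.toAddMonoidHom.range).index ≤ 2 ^ (finrank ℤ M' + 1) :=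
    calc _ ≤ D.index * (D' ⊔ N.toAddMonoidHom.range).index := by
          rw [hD, pow_succ]; gcongr
      _ ≤ D'.index := by rw [← h2]; gcongr
      _ ≤ _ := by rw [hD', pow_succ]; gcongr
  have hs0 : (D' ⊔ N.toAddMonoidHom.range).index ≠ 0 := fun h ↦ hD'0 (by rw [← h2, h, mul_zero])
  have h4 : 2 ^ (finrank ℤ A + 1) ≤ 2 ^ (finrank ℤ M' + 1) :=
    (Nat.le_mul_of_pos_right _ (Nat.pos_of_ne_zero hs0)).trans h3
  have h5 := (Nat.pow_le_pow_iff_right one_lt_two).1 h4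
  refine ⟨by omega, fun h f ↦ ?_⟩
  have h6 : finrank ℤ A = finrank ℤ M' := by omega
  rw [h6] at h3
  have h7 : (D' ⊔ N.toAddMonoidHom.range).index = 1 := by
    have := Nat.le_of_mul_le_mul_left (h3.trans_eq (mul_one _).symm) (by positivity)
    omega
  have hf : f ∈ D' ⊔ N.toAddMonoidHom.range := by
    rw [AddSubgroup.index_eq_one.1 h7]; trivial
  obtain ⟨_, ⟨g, rfl⟩, _, ⟨e, rfl⟩, h⟩ := AddSubgroup.mem_sup.1 hf
  exact ⟨e, g, by rw [← h, add_comm]; rfl⟩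

theorem val_units_mul {K : Type*} [Field K] (a b : (𝓞 K)ˣ) :
    (((a * b : (𝓞 K)ˣ) : 𝓞 K) : K) = (a : 𝓞 K) * (b : 𝓞 K) :=
  map_mul (algebraMap (𝓞 K) K) _ _

theorem val_units_pow {K : Type*} [Field K] (a : (𝓞 K)ˣ) (n : ℕ) :
    (((a ^ n : (𝓞 K)ˣ) : 𝓞 K) : K) = ((a : 𝓞 K) : K) ^ n := by
  rw [Units.val_pow_eq_pow_val]
  exact map_pow (algebraMap (𝓞 K) K) _ _

theorem exists_unit_of_sq {K : Type*} [Field K] {x : K} {e : (𝓞 K)ˣ}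
    (h : x ^ 2 = ((e : 𝓞 K) : K)) : ∃ y : (𝓞 K)ˣ, ((y : 𝓞 K) : K) = x := by
  have he : ((e : 𝓞 K) : K) * (((e⁻¹ : (𝓞 K)ˣ) : 𝓞 K) : K) = 1 := by
    rw [← map_mul, ← Units.val_mul, mul_inv_cancel, Units.val_one, map_one]
  have hx : IsIntegral ℤ x := .of_pow two_pos (h ▸ RingOfIntegers.isIntegral_coe _)
  have hy : IsIntegral ℤ (x * (((e⁻¹ : (𝓞 K)ˣ) : 𝓞 K) : K)) :=
    hx.mul (RingOfIntegers.isIntegral_coe _)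
  have hxy : x * (x * (((e⁻¹ : (𝓞 K)ˣ) : 𝓞 K) : K)) = 1 := by rw [← mul_assoc, ← sq, h, he]
  exact ⟨Units.mkOfMulEqOne ⟨x, hx⟩ ⟨_, hy⟩ (RingOfIntegers.ext hxy), rfl⟩

theorem exists_sq_span_eq {L : Type*} [Field L] [NumberField L] {α : 𝓞 L} (hα : Prime α) {m : ℕ}
    (hm : 4 ∣ α ^ m) {n B : 𝓞 L} {u : (𝓞 L)ˣ} (hn : n ≠ 0)
    (h : n * (n - 4) = u * B ^ 2) : ∃ (c : 𝓞 L) (k : ℕ), c ≠ 0 ∧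
      Associated (c ^ 2) (n ^ classNumber L * α ^ (k * classNumber L)) := by
  let I : Ideal (𝓞 L) := Ideal.span {n, B}
  have hnI : n ∈ I := Ideal.subset_span (by simp)
  have hBI : B ∈ I := Ideal.subset_span (by simp)
  have hB2 : B ^ 2 = n * ((u⁻¹ : (𝓞 L)ˣ) * (n - 4)) := by
    rw [mul_left_comm, h, ← mul_assoc, Units.inv_mul, one_mul]
  have h1 : Ideal.span {n} ∣ I ^ 2 := by
    rw [Ideal.dvd_iff_le, sq, Ideal.span_pair_mul_span_pair, Ideal.span_le]
    rintro x (rfl | rfl | rfl | rfl) <;> rw [SetLike.mem_coe, Ideal.mem_span_singleton]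
    · simp
    · simp
    · simp
    · exact ⟨_, (sq B).symm.trans hB2⟩
  obtain ⟨q, hq⟩ := h1
  have hn0 : Ideal.span {n} ≠ 0 := by simpa using hn
  have hn4 : n * 4 ∈ I ^ 2 := by
    have : n * 4 = n * n - u * (B * B) := by linear_combination -h
    rw [this, sq]
    exact sub_mem (Ideal.mul_mem_mul hnI hnI) (Ideal.mul_mem_left _ _ (Ideal.mul_mem_mul hBI hBI))
  have hq4 : q ∣ Ideal.span {α} ^ m := by
    rw [← mul_dvd_mul_iff_left hn0, ← hq, Ideal.dvd_iff_le, Ideal.span_singleton_pow,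
      Ideal.span_singleton_mul_span_singleton, Ideal.span_singleton_le_iff_mem]
    obtain ⟨d, hd⟩ := hm
    rw [hd, ← mul_assoc]
    exact Ideal.mul_mem_right _ _ hn4
  have hαI : Prime (Ideal.span {α}) :=
    Ideal.prime_of_isPrime (by simpa using hα.ne_zero) ((Ideal.span_singleton_prime hα.ne_zero).2 hα)
  obtain ⟨k, -, hk⟩ := (dvd_prime_pow hαI m).1 hq4
  rw [associated_iff_eq] at hk
  have hI0 : I ≠ 0 := fun h ↦ hn (by simpa [h] using hnI)
  have hI : I ^ classNumber L ∈ nonZeroDivisors (Ideal (𝓞 L)) :=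
    mem_nonZeroDivisors_of_ne_zero (pow_ne_zero _ hI0)
  have hpr : (I ^ classNumber L).IsPrincipal := by
    rw [← ClassGroup.mk0_eq_one_iff hI]
    have : ClassGroup.mk0 ⟨I, mem_nonZeroDivisors_of_ne_zero hI0⟩ ^ classNumber L = 1 :=
      pow_card_eq_one
    rw [← map_pow] at this
    exact this
  obtain ⟨c, hc⟩ := hpr
  have hc : I ^ classNumber L = Ideal.span {c} := hc
  refine ⟨c, k, fun h0 ↦ pow_ne_zero _ hI0 (by rw [hc, h0]; simp), ?_⟩
  rw [← Ideal.span_singleton_eq_span_singleton, ← Ideal.span_singleton_pow, ← hc, ← pow_mul,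
    mul_comm, pow_mul, hq, hk, mul_pow, ← pow_mul, Ideal.span_singleton_pow,
    Ideal.span_singleton_pow, Ideal.span_singleton_mul_span_singleton]

/-- Hilbert 90 for units of a quadratic extension `K = L(√u)`, `u` a unit, when `L` has odd class
number and the only prime above `2` is principal and unramified in `K`. -/
theorem exists_unit_eq_div {L K : Type*} [Field L] [NumberField L] [Field K] [NumberField K]
    [Algebra L K] (hcl : Odd (classNumber L)) {α : 𝓞 L} (hα : Prime α) {m : ℕ} (hm : 4 ∣ α ^ m)
    (u : (𝓞 L)ˣ) (σ : K →ₐ[L] K) {r : K} (hr : r ^ 2 = algebraMap L K (u : 𝓞 L)) (hσr : σ r = -r)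
    (hdec : ∀ x : K, ∃ a b : L, x = algebraMap L K a + algebraMap L K b * r)
    (v : K → ℤ) (hv : ∀ x y, x ≠ 0 → y ≠ 0 → v (x * y) = v x + v y)
    (hvu : ∀ e : (𝓞 K)ˣ, v (e : 𝓞 K) = 0) (hvα : v (algebraMap L K α) = 1)
    (e : (𝓞 K)ˣ) (he : ((e : 𝓞 K) : K) * σ (e : 𝓞 K) = 1) :
    ∃ y : (𝓞 K)ˣ, ((e : 𝓞 K) : K) * σ (y : 𝓞 K) = (y : 𝓞 K) := by
  have hv1 : v 1 = 0 := by simpa using hv 1 1 one_ne_zero one_ne_zero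
  have hvpow : ∀ (x : K) (n : ℕ), x ≠ 0 → v (x ^ n) = n * v x := fun x n hx ↦ by
    induction n with
    | zero => simpa using hv1
    | succ n ih => rw [pow_succ, hv _ _ (pow_ne_zero _ hx) hx, ih]; push_cast; ring
  have hinj : Function.Injective (algebraMap L K) := (algebraMap L K).injective
  have hint : ∀ {x : L}, IsIntegral ℤ (algebraMap L K x) → IsIntegral ℤ x := fun h ↦
    (isIntegral_algebraMap_iff hinj).1 h
  let i : (𝓞 L)ˣ →* (𝓞 K)ˣ := Units.map (algebraMap (𝓞 L) (𝓞 K)).toMonoidHom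
  have hi : ∀ f : (𝓞 L)ˣ, ((i f : 𝓞 K) : K) = algebraMap L K (f : 𝓞 L) := fun f ↦ rfl
  obtain ⟨R, hR⟩ := exists_unit_of_sq (hr.trans (hi u).symm)
  by_cases he1 : ((e : 𝓞 K) : K) = -1
  · exact ⟨R, by rw [he1, hR, hσr]; ring⟩
  obtain ⟨a, b, hab⟩ := hdec (e : 𝓞 K)
  set E : K := ((e : 𝓞 K) : K) with hE
  have hσE : σ E = algebraMap L K a - algebraMap L K b * r := by
    rw [hab]; simp [hσr, sub_eq_add_neg]
  have hEint : IsIntegral ℤ E := RingOfIntegers.isIntegral_coe _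
  have hσEint : IsIntegral ℤ (σ E) := map_isIntegral_int σ hEint
  have hr0 : r ≠ 0 := by rw [← hR]; simp
  have hu0 : algebraMap L K (u : 𝓞 L) ≠ 0 := by rw [← hr]; exact pow_ne_zero _ hr0
  have hn : IsIntegral ℤ (2 + 2 * a) := by
    refine hint ?_
    have : algebraMap L K (2 + 2 * a) = 1 + 1 + E + σ E := by
      rw [hσE, hab]; simp only [map_add, map_mul, map_ofNat]; ring
    rw [this]
    exact ((isIntegral_one.add isIntegral_one).add hEint).add hσEint
  have hB : IsIntegral ℤ (2 * b) := by
    refine hint ?_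
    have : algebraMap L K (2 * b) = (E - σ E) * (((R⁻¹ : (𝓞 K)ˣ) : 𝓞 K) : K) := by
      have hRR : r * (((R⁻¹ : (𝓞 K)ˣ) : 𝓞 K) : K) = 1 := by
        rw [← hR, ← map_mul, ← Units.val_mul, mul_inv_cancel, Units.val_one, map_one]
      rw [hσE, hab, map_mul, map_ofNat]
      linear_combination (-2 * algebraMap L K b) * hRR
    rw [this]
    exact (hEint.sub hσEint).mul (RingOfIntegers.isIntegral_coe _)
  let n : 𝓞 L := ⟨_, hn⟩
  let B : 𝓞 L := ⟨_, hB⟩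
  have hnK : algebraMap L K n = 2 + E + σ E := by
    change algebraMap L K (2 + 2 * a) = _
    rw [hσE, hab]; simp only [map_add, map_mul, map_ofNat]; ring
  have hBK : algebraMap L K B * r = E - σ E := by
    change algebraMap L K (2 * b) * r = _
    rw [hσE, hab]; simp only [map_mul, map_ofNat]; ring
  have hnx : (1 + E) ^ 2 = E * algebraMap L K n := by
    rw [hnK]; linear_combination -he
  have hx0 : 1 + E ≠ 0 := fun h ↦ he1 (by linear_combination h)
  have hE0 : E ≠ 0 := left_ne_zero_of_mul_eq_one he
  have hnK0 : algebraMap L K n ≠ 0 := fun h ↦ by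
    rw [h, mul_zero] at hnx; exact hx0 (pow_eq_zero_iff two_ne_zero |>.1 hnx)
  have hn0 : n ≠ 0 := fun h ↦ hnK0 (by rw [h]; simp)
  have hrel : n * (n - 4) = u * B ^ 2 := by
    refine RingOfIntegers.ext (hinj ?_)
    simp only [map_mul, map_sub, map_pow, map_ofNat]
    rw [← hr, hnK]
    linear_combination (-(algebraMap L K B * r) - (E - σ E)) * hBK + 4 * he
  obtain ⟨c, k, hc0, η, hη⟩ := exists_sq_span_eq hα hm hn0 hrel
  set h := classNumber L
  have hcK0 : algebraMap L K c ≠ 0 := by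
    simpa using hc0
  have hαK0 : algebraMap L K α ≠ 0 := by simpa using hα.ne_zero
  have hηK : (algebraMap L K c) ^ 2 * ((i η : 𝓞 K) : K) =
      algebraMap L K n ^ h * algebraMap L K α ^ (k * h) := by
    rw [hi]
    have := congrArg (fun z : 𝓞 L ↦ algebraMap L K z) hη
    simpa only [map_mul, map_pow] using this
  have hvn : 2 * v (1 + E) = v (algebraMap L K n) := by
    have := congrArg v hnx
    rw [hvpow _ _ hx0, hv _ _ hE0 hnK0, hvu] at this
    simpa using this
  have hvη := congrArg v hηK
  rw [hv _ _ (pow_ne_zero _ hcK0) (by simp), hvu, hv _ _ (pow_ne_zero _ hnK0)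
    (pow_ne_zero _ hαK0), hvpow _ _ hcK0, hvpow _ _ hnK0, hvpow _ _ hαK0, hvα, ← hvn] at hvη
  have hkh : Even (k * h) := by
    have : Even ((k * h : ℕ) : ℤ) := ⟨v (algebraMap L K c) - h * v (1 + E), by
      push_cast at hvη ⊢; linear_combination -hvη⟩
    exact_mod_cast this
  obtain ⟨t, ht⟩ := hkh
  obtain ⟨l, hl⟩ := hcl
  let y : K := (1 + E) ^ h * algebraMap L K α ^ t / algebraMap L K c
  have hy : y ^ 2 = (((e ^ h * i η : (𝓞 K)ˣ) : 𝓞 K) : K) := by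
    rw [val_units_mul, val_units_pow, ← hE]
    change ((1 + E) ^ h * algebraMap L K α ^ t / algebraMap L K c) ^ 2 = _
    rw [div_pow, div_eq_iff (pow_ne_zero _ hcK0)]
    rw [mul_assoc, mul_comm ((i η : 𝓞 K) : K), hηK, ht, mul_pow, ← pow_mul, mul_comm h, pow_mul,
      hnx, mul_pow]
    ring
  obtain ⟨Y, hY⟩ := exists_unit_of_sq hy
  have hσx : E * σ (1 + E) = 1 + E := by
    rw [map_add, map_one]; linear_combination he
  have hσy : E ^ h * σ y = y := by
    change E ^ h * σ ((1 + E) ^ h * algebraMap L K α ^ t / algebraMap L K c) = _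
    rw [map_div₀, map_mul, map_pow, map_pow, AlgHom.commutes, AlgHom.commutes, ← mul_div_assoc,
      ← mul_assoc, ← mul_pow, hσx]
  have hEinv : ((((e ^ l)⁻¹ : (𝓞 K)ˣ) : 𝓞 K) : K) = (σ E) ^ l := by
    refine mul_left_cancel₀ (pow_ne_zero l hE0) ?_
    rw [← mul_pow, he, one_pow, hE, ← map_pow, ← map_mul, ← Units.val_pow_eq_pow_val,
      ← Units.val_mul, mul_inv_cancel, Units.val_one, map_one]
  have hσσ : σ (σ E) = E := by
    rw [hσE, hab]; simp [hσr]
  refine ⟨Y * (e ^ l)⁻¹, ?_⟩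
  rw [hl] at hσy
  rw [val_units_mul, map_mul, hY, hEinv, map_pow, hσσ]
  have hEl : E ^ l * σ E ^ l = 1 := by rw [← mul_pow, he, one_pow]
  linear_combination σ E ^ l * hσy - E ^ (l + 1) * σ y * hEl

/-- If Hilbert 90 holds for the units of `K = L(√d)`, then `rank K ≤ 2 rank L`, and in the case of
equality every unit of `L` is a norm from `K` up to squares. -/
theorem rank_le_two_mul_rank {L K : Type*} [Field L] [NumberField L] [Field K] [NumberField K]
    [Algebra L K] {d : L} (σ : K →ₐ[L] K) {r : K} (hr : r ^ 2 = algebraMap L K d) (hσr : σ r = -r)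
    (hdec : ∀ x : K, ∃ a b : L, x = algebraMap L K a + algebraMap L K b * r)
    (h90 : ∀ e : (𝓞 K)ˣ, ((e : 𝓞 K) : K) * σ (e : 𝓞 K) = 1 →
      ∃ y : (𝓞 K)ˣ, ((e : 𝓞 K) : K) * σ (y : 𝓞 K) = (y : 𝓞 K)) :
    Units.rank K ≤ 2 * Units.rank L ∧ (Units.rank K = 2 * Units.rank L →
      ∀ f : (𝓞 L)ˣ, ∃ a b g : L, ((f : 𝓞 L) : L) = (a ^ 2 - d * b ^ 2) * g ^ 2) := by
  have hinj : Function.Injective (algebraMap L K) := (algebraMap L K).injective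
  let i : (𝓞 L)ˣ →* (𝓞 K)ˣ := Units.map (algebraMap (𝓞 L) (𝓞 K)).toMonoidHom
  let s : (𝓞 K)ˣ →* (𝓞 K)ˣ := Units.map (RingOfIntegers.mapRingHom σ).toMonoidHom
  have hi : ∀ f : (𝓞 L)ˣ, ((i f : 𝓞 K) : K) = algebraMap L K (f : 𝓞 L) := fun f ↦ rfl
  have hs : ∀ e : (𝓞 K)ˣ, ((s e : 𝓞 K) : K) = σ (e : 𝓞 K) := fun f ↦ rfl
  have hext : ∀ {e e' : (𝓞 K)ˣ}, ((e : 𝓞 K) : K) = (e' : 𝓞 K) → e = e' :=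
    fun h ↦ Units.ext (RingOfIntegers.ext h)
  have hi_inj : Function.Injective i := fun f g h ↦ Units.ext (RingOfIntegers.ext (hinj
    ((hi f).symm.trans ((congrArg (fun z : (𝓞 K)ˣ ↦ ((z : 𝓞 K) : K)) h).trans (hi g)))))
  have hnorm : ∀ e : (𝓞 K)ˣ, ∃ a b : L,
      ((e * s e : (𝓞 K)ˣ) : 𝓞 K) = algebraMap L K (a ^ 2 - d * b ^ 2) := fun e ↦ by
    obtain ⟨a, b, hab⟩ := hdec (e : 𝓞 K)
    refine ⟨a, b, ?_⟩
    rw [val_units_mul, hs, hab]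
    simp only [map_add, map_mul, AlgHom.commutes, hσr, map_sub, map_pow, ← hr]
    ring
  have hN : ∀ e : (𝓞 K)ˣ, ∃ f : (𝓞 L)ˣ, i f = e * s e := fun e ↦ by
    obtain ⟨a, b, h⟩ := hnorm e
    obtain ⟨a', b', h'⟩ := hnorm e⁻¹
    have hint : ∀ {x : L} {z : 𝓞 K}, (z : K) = algebraMap L K x → IsIntegral ℤ x := fun h ↦
      (isIntegral_algebraMap_iff hinj).1 (h ▸ RingOfIntegers.isIntegral_coe _)
    refine ⟨Units.mkOfMulEqOne ⟨_, hint h⟩ ⟨_, hint h'⟩ (RingOfIntegers.ext (hinj ?_)), hext h.symm⟩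
    change algebraMap L K ((a ^ 2 - d * b ^ 2) * (a' ^ 2 - d * b' ^ 2)) = _
    rw [map_mul, ← h, ← h', ← val_units_mul, map_inv, mul_mul_mul_comm, mul_inv_cancel,
      mul_inv_cancel, one_mul]
    simp
  choose N hN using hN
  let N' : (𝓞 K)ˣ →* (𝓞 L)ˣ := MonoidHom.mk' N fun x y ↦ hi_inj (by
    rw [map_mul, hN, hN, hN, map_mul]; exact mul_mul_mul_comm ..)
  have hsi : ∀ f, s (i f) = i f := fun f ↦ hext (by rw [hs, hi, AlgHom.commutes])
  have hNi : ∀ f, N' (i f) = f ^ 2 := fun f ↦ hi_inj ((hN _).trans (by rw [hsi, map_pow, sq]))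
  have h90' : ∀ a, N' a = 1 → ∃ e, a = e / s e := fun a ha ↦ by
    have h1 : i (N' a) = a * s a := hN a
    rw [ha, map_one] at h1
    obtain ⟨y, hy⟩ := h90 a (by rw [← hs, ← val_units_mul, ← h1]; simp)
    refine ⟨y, ?_⟩
    have : a * s y = y := hext (by rw [val_units_mul, hs]; exact hy)
    exact eq_div_of_mul_eq' this
  have htors : Nat.card (nsmulAddMonoidHom (α := Additive (𝓞 L)ˣ) 2).ker ≤ 2 := by
    have hsq : ∀ t : Bool, ((if t then 1 else -1 : (𝓞 L)ˣ)) ^ 2 = 1 := by simp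
    refine (Nat.card_le_card_of_surjective (α := Bool)
      (fun t ↦ ⟨Additive.ofMul (if t then 1 else -1), hsq t⟩) ?_).trans (by simp)
    rintro ⟨x, hx⟩
    have hx : x.toMul ^ 2 = 1 := hx
    have hx' : ((x.toMul : (𝓞 L)ˣ) : 𝓞 L) ^ 2 = 1 := by
      rw [← Units.val_pow_eq_pow_val, hx, Units.val_one]
    rcases mul_self_eq_one_iff.1 ((sq _).symm.trans hx') with h | h
    · exact ⟨true, Subtype.ext (congrArg Additive.ofMul (Units.ext h.symm))⟩
    · exact ⟨false, Subtype.ext (congrArg Additive.ofMul (Units.ext h.symm))⟩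
  have hneg : ((-1 : (𝓞 L)ˣ)) ^ 2 = 1 := by simp
  have hneg1 : (-1 : (𝓞 L)ˣ) ≠ 1 := fun h ↦ by
    have := congrArg (fun z : (𝓞 L)ˣ ↦ (z : 𝓞 L)) h
    norm_num at this
  have key := finrank_le_of_hilbert90 (M := Additive (𝓞 K)ˣ) (M' := Additive (𝓞 L)ˣ)
    (MonoidHom.toAdditive N').toIntLinearMap (MonoidHom.toAdditive i).toIntLinearMap
    (MonoidHom.toAdditive s).toIntLinearMap hi_inj hNi hN hsi h90' htors
    (Additive.ofMul (-1)) hneg hneg1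
  rw [Units.finrank_eq, Units.finrank_eq] at key
  refine ⟨key.1, fun h f ↦ ?_⟩
  obtain ⟨e, g, hfg⟩ := key.2 h (Additive.ofMul f)
  have hfg : f = N e.toMul * g.toMul ^ 2 := hfg
  obtain ⟨a, b, hab⟩ := hnorm e.toMul
  refine ⟨a, b, ((g.toMul : (𝓞 L)ˣ) : 𝓞 L), ?_⟩
  rw [← hN, hi] at hab
  rw [hfg, val_units_mul, val_units_pow, hinj hab]

open Polynomial in
theorem AdjoinRoot.exists_eq_add_mul_root {F : Type*} [Field F] (d : F)
    (x : AdjoinRoot (X ^ 2 - C d)) :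
    ∃ a b : F, x = algebraMap F _ a + algebraMap F _ b * AdjoinRoot.root (X ^ 2 - C d) := by
  have hmonic : (X ^ 2 - C d).Monic := monic_X_pow_sub_C d two_ne_zero
  obtain ⟨f, rfl⟩ := AdjoinRoot.mk_surjective x
  have hdeg : (f %ₘ (X ^ 2 - C d)).natDegree ≤ 1 := by
    have := natDegree_modByMonic_lt f hmonic (fun h ↦ by
      simpa [natDegree_X_pow_sub_C] using congrArg natDegree h)
    rw [natDegree_X_pow_sub_C] at this
    omega
  obtain ⟨b, a, h⟩ := exists_eq_X_add_C_of_natDegree_le_one hdeg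
  refine ⟨a, b, ?_⟩
  rw [← AdjoinRoot.mk_leftInverse hmonic (AdjoinRoot.mk _ f), AdjoinRoot.modByMonicHom_mk, h]
  simp [add_comm, AdjoinRoot.algebraMap_eq]

theorem exists_valuation_of_pow_eq {p : ℕ} [Fact p.Prime] {n : ℕ} (hn : n ≠ 0)
    {F : Type*} [Field F] [Algebra ℚ_[p] F] (hF : Module.finrank ℚ_[p] F = n)
    {a : F} (ha : a ^ n = p) :
    ∃ v : F → ℤ, (∀ x y, x ≠ 0 → y ≠ 0 → v (x * y) = v x + v y) ∧
      (∀ x, IsIntegral ℤ x → 0 ≤ v x) ∧ v a = 1 := by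
  have : FiniteDimensional ℚ_[p] F := .of_finrank_pos (hF ▸ Nat.pos_of_ne_zero hn)
  refine ⟨fun x ↦ (Algebra.norm ℚ_[p] x).valuation, fun x y hx hy ↦ ?_, fun x hx ↦ ?_, ?_⟩
  · beta_reduce
    rw [map_mul, Padic.valuation_mul (Algebra.norm_ne_zero_iff.2 hx)
      (Algebra.norm_ne_zero_iff.2 hy)]
  · rw [← Padic.norm_le_one_iff_val_nonneg]
    have h1 : IsIntegral ℤ_[p] (Algebra.norm ℚ_[p] x) := (Algebra.isIntegral_norm ℚ_[p] hx).tower_top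
    obtain ⟨z, hz⟩ := IsIntegrallyClosed.isIntegral_iff.1 h1
    rw [← hz]
    exact z.2
  · have h := congrArg Padic.valuation (congrArg (Algebra.norm ℚ_[p]) ha)
    rw [map_pow, Padic.valuation_pow, ← map_natCast (algebraMap ℚ_[p] F), Algebra.norm_algebraMap,
      hF, Padic.valuation_pow, Padic.valuation_p] at h
    exact mul_left_cancel₀ (by exact_mod_cast hn) h

theorem prime_of_pow_eq_prime {L : Type*} [Field L] [NumberField L] {q : ℕ} (hq : q.Prime) {α : 𝓞 L}
    (h : α ^ Module.finrank ℚ L = q) : Prime α := by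
  have h0 : Module.finrank ℚ L ≠ 0 := Module.finrank_pos.ne'
  refine Ideal.prime_of_irreducible_absNorm_span (fun h' ↦ ?_) ?_
  · rw [h', zero_pow h0] at h
    exact hq.ne_zero (by exact_mod_cast h.symm)
  · have h2 := congrArg (fun z ↦ Ideal.absNorm (Ideal.span {z})) h
    simp only [← Ideal.span_singleton_pow, map_pow] at h2
    rw [Ideal.absNorm_span_natCast, RingOfIntegers.rank] at h2
    rw [Nat.pow_left_injective h0 h2]
    exact hq

theorem two_mul_rank_add_one {L : Type*} [Field L] [NumberField L] {p : ℕ} (hp : Odd p) {α : L}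
    {c : ℚ} (hα : α ^ p = algebraMap ℚ L c) (hgen : Algebra.adjoin ℚ {α} = ⊤)
    (hdeg : Module.finrank ℚ L = p) :
    2 * Units.rank L + 1 = p := by
  have h1 : InfinitePlace.nrRealPlaces L ≤ 1 := by
    classical
    rw [← InfinitePlace.card_real_embeddings, Fintype.card_le_one_iff]
    rintro ⟨f, hf⟩ ⟨g, hg⟩
    have hfα := congrArg f hα
    have hgα := congrArg g hα
    rw [map_pow, eq_ratCast, map_ratCast, ← ComplexEmbedding.IsReal.coe_embedding_apply hf] at hfα
    rw [map_pow, eq_ratCast, map_ratCast, ← ComplexEmbedding.IsReal.coe_embedding_apply hg] at hgα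
    have hfg : (hf.embedding α) ^ p = (hg.embedding α) ^ p := by exact_mod_cast hfα.trans hgα.symm
    have hfg' : f α = g α := by
      rw [← ComplexEmbedding.IsReal.coe_embedding_apply hf,
        ← ComplexEmbedding.IsReal.coe_embedding_apply hg, hp.strictMono_pow.injective hfg]
    have : f.toRatAlgHom = g.toRatAlgHom := AlgHom.ext_of_adjoin_eq_top hgen (by simpa using hfg')
    refine Subtype.ext (RingHom.ext fun x ↦ DFunLike.congr_fun this x)
  have h2 := InfinitePlace.nrRealPlaces_pos_of_odd_finrank (K := L) (hdeg ▸ hp)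
  have h3 := InfinitePlace.card_add_two_mul_card_eq_rank L
  have h4 := InfinitePlace.card_eq_nrRealPlaces_add_nrComplexPlaces L
  rw [Units.rank]
  omega

theorem finrank_le_two_mul_rank_add_two {K : Type*} [Field K] [NumberField K] :
    Module.finrank ℚ K ≤ 2 * Units.rank K + 2 := by
  have h3 := InfinitePlace.card_add_two_mul_card_eq_rank K
  have h4 := InfinitePlace.card_eq_nrRealPlaces_add_nrComplexPlaces K
  rw [Units.rank]
  omega

theorem finrank_lt_two_mul_rank_add_two {K : Type*} [Field K] [NumberField K] (f : K →+* ℝ) :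
    Module.finrank ℚ K < 2 * Units.rank K + 2 := by
  classical
  have h1 : 0 < InfinitePlace.nrRealPlaces K := by
    rw [← InfinitePlace.card_real_embeddings, Fintype.card_pos_iff]
    exact ⟨(algebraMap ℝ ℂ).comp f, RingHom.ext fun x ↦ Complex.conj_ofReal _⟩
  have h3 := InfinitePlace.card_add_two_mul_card_eq_rank K
  have h4 := InfinitePlace.card_eq_nrRealPlaces_add_nrComplexPlaces K
  rw [Units.rank]
  omega

theorem exists_real_embedding {L : Type*} [Field L] [NumberField L]
    (h : Odd (Module.finrank ℚ L)) : Nonempty (L →+* ℝ) := by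
  classical
  have h1 := InfinitePlace.nrRealPlaces_pos_of_odd_finrank h
  rw [← InfinitePlace.card_real_embeddings, Fintype.card_pos_iff] at h1
  obtain ⟨f, hf⟩ := h1
  exact ⟨hf.embedding⟩

theorem false_of_quadratic_extension_embeds {L K F : Type*} [Field L] [NumberField L] [Field K]
    [NumberField K] [Algebra L K] [Field F] {p : ℕ} (hp : Odd p) {α : L} (hα : α ^ p = 2)
    (hgen : Algebra.adjoin ℚ {α} = ⊤) (hdeg : Module.finrank ℚ L = p)
    (hK : Module.finrank ℚ K = 2 * p) (hcl : Odd (classNumber L)) {u : (𝓞 L)ˣ}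
    (σ : K →ₐ[L] K) {r : K} (hr : r ^ 2 = algebraMap L K (u : 𝓞 L)) (hσr : σ r = -r)
    (hdec : ∀ x : K, ∃ a b : L, x = algebraMap L K a + algebraMap L K b * r)
    (hlift : ∀ (φ : L →+* ℝ) (s : ℝ), s ^ 2 = φ (u : 𝓞 L) → Nonempty (K →+* ℝ))
    (j : K →+* F) {w : F → ℤ} (hw : ∀ x y, x ≠ 0 → y ≠ 0 → w (x * y) = w x + w y)
    (hw0 : ∀ x, IsIntegral ℤ x → 0 ≤ w x) (hwα : w (j (algebraMap L K α)) = 1) : False := by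
  have hp0 : p ≠ 0 := by rintro rfl; simp at hp
  have hαint : IsIntegral ℤ α :=
    .of_pow (Nat.pos_of_ne_zero hp0) (by
      simpa [hα] using isIntegral_algebraMap (R := ℤ) (A := L) (x := 2))
  let α' : 𝓞 L := ⟨α, hαint⟩
  have hα' : α' ^ p = 2 :=
    FaithfulSMul.algebraMap_injective (𝓞 L) L (by rw [map_pow, map_ofNat]; exact hα)
  have hprime : Prime α' := prime_of_pow_eq_prime Nat.prime_two (by rw [hdeg, hα']; rfl)
  have hm : 4 ∣ α' ^ (p * 2) := by rw [pow_mul, hα']; norm_num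
  have hv : ∀ x y : K, x ≠ 0 → y ≠ 0 → w (j (x * y)) = w (j x) + w (j y) := fun x y hx hy ↦ by
    rw [map_mul, hw _ _ (by simpa using hx) (by simpa using hy)]
  have hv1 : w (j 1) = 0 := by
    have := hv 1 1 one_ne_zero one_ne_zero
    rw [mul_one] at this
    omega
  have hv0 : ∀ x : 𝓞 K, 0 ≤ w (j x) := fun x ↦ hw0 _ (map_isIntegral_int j x.2)
  have hvu : ∀ e : (𝓞 K)ˣ, w (j (e : 𝓞 K)) = 0 := fun e ↦ by
    have h1 := hv (e : 𝓞 K) ((e⁻¹ : (𝓞 K)ˣ) : 𝓞 K) (by simp) (by simp)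
    rw [← map_mul (algebraMap (𝓞 K) K), Units.mul_inv, map_one, hv1] at h1
    have h2 := hv0 e
    have h3 := hv0 (e⁻¹ : (𝓞 K)ˣ)
    omega
  obtain ⟨hle, heq⟩ := rank_le_two_mul_rank σ hr hσr hdec fun e he ↦
    exists_unit_eq_div hcl hprime hm u σ hr hσr hdec (fun x ↦ w (j x)) hv hvu hwα e he
  have hL := two_mul_rank_add_one hp (c := 2) (by simpa using hα) hgen hdeg
  obtain ⟨φ⟩ := exists_real_embedding (L := L) (hdeg ▸ hp)
  rcases le_or_gt (φ (u : 𝓞 L)) 0 with hφ | hφ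
  · have h1 := finrank_le_two_mul_rank_add_two (K := K)
    obtain ⟨a, b, g, h⟩ := heq (by omega) (-1)
    have h2 := congrArg φ h
    simp only [Units.val_neg, Units.val_one, map_neg, map_one, map_mul, map_sub, map_pow] at h2
    nlinarith [mul_nonneg (sq_nonneg (φ a)) (sq_nonneg (φ g)),
      mul_nonneg (neg_nonneg.2 hφ) (mul_nonneg (sq_nonneg (φ b)) (sq_nonneg (φ g)))]
  · obtain ⟨f⟩ := hlift φ _ (Real.sq_sqrt hφ.le)
    have h1 := finrank_lt_two_mul_rank_add_two f
    omega

/-- If the class number of `L = ℚ(2^{1/p})` is odd, then a unit of `O_L` that becomes a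
square in `L₂ = ℚ₂(2^{1/p})` is already a square in `L`; i.e. the natural map
`O_L^×/(O_L^×)² → L₂^×/(L₂^×)²` is injective. -/
theorem stmt8 (p : ℕ) (hp : p.Prime) (hp5 : 5 ≤ p)
    (L : Type*) [Field L] [Algebra ℚ L] [NumberField L]
    (α : L) (hα : α ^ p = 2) (hgen : Algebra.adjoin ℚ {α} = ⊤)
    (hdeg : Module.finrank ℚ L = p)
    (L₂ : Type*) [Field L₂] [Algebra ℚ_[2] L₂]
    (lam : L₂) (hlam : lam ^ p = 2)
    (hdeg2 : Module.finrank ℚ_[2] L₂ = p)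
    (ι : L →+* L₂) (hι : ι α = lam)
    (hcl : Odd (NumberField.classNumber L)) :
    ∀ u : (𝓞 L)ˣ, (∃ s : L₂, s ^ 2 = ι (algebraMap (𝓞 L) L (u : 𝓞 L))) →
      ∃ t : L, t ^ 2 = algebraMap (𝓞 L) L (u : 𝓞 L) := by
  rintro u ⟨s, hs⟩
  obtain rfl : ‹Algebra ℚ L› = DivisionRing.toRatAlgebra := Subsingleton.elim _ _
  by_contra! hu
  set U : L := algebraMap (𝓞 L) L u with hU
  set q : Polynomial L := Polynomial.X ^ 2 - Polynomial.C U
  have hirr : Irreducible q := X_pow_sub_C_irreducible_of_prime Nat.prime_two hu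
  have : Fact (Irreducible q) := ⟨hirr⟩
  let K := AdjoinRoot q
  have hroot : AdjoinRoot.root q ^ 2 = algebraMap L K U := by
    have h := AdjoinRoot.eval₂_root q
    rw [Polynomial.eval₂_sub, Polynomial.eval₂_X_pow, Polynomial.eval₂_C, sub_eq_zero] at h
    exact h
  have hfin : Module.finrank L K = 2 := by
    rw [(AdjoinRoot.powerBasis hirr.ne_zero).finrank, AdjoinRoot.powerBasis_dim,
      Polynomial.natDegree_X_pow_sub_C]
  have : FiniteDimensional L K := .of_finrank_pos (by omega)
  have : CharZero K := charZero_of_injective_algebraMap (algebraMap L K).injective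
  have : IsScalarTower ℚ L K := inferInstance
  have : FiniteDimensional ℚ K := .trans ℚ L K
  have : NumberField K := ⟨⟩
  have hK : Module.finrank ℚ K = 2 * p := by
    rw [← Module.finrank_mul_finrank ℚ L K, hfin, hdeg, mul_comm]
  obtain ⟨w, hw, hw0, hwα⟩ := exists_valuation_of_pow_eq hp.ne_zero hdeg2 (a := lam)
    (by simpa using hlam)
  let σ : K →ₐ[L] K := AdjoinRoot.liftAlgHom _ (Algebra.ofId L K) (-AdjoinRoot.root q) (by
    simpa [q, sub_eq_zero] using hroot)
  let j : K →+* L₂ := AdjoinRoot.lift ι s (by simpa [q, sub_eq_zero] using hs)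
  refine false_of_quadratic_extension_embeds (hp.odd_of_ne_two (by omega)) hα hgen hdeg hK hcl σ hroot
    (AdjoinRoot.liftAlgHom_root ..) (AdjoinRoot.exists_eq_add_mul_root U)
    (fun φ s hs ↦ ⟨AdjoinRoot.lift φ s (by simpa [q, sub_eq_zero] using hs)⟩) j hw hw0 ?_
  rw [AdjoinRoot.algebraMap_eq, AdjoinRoot.lift_of, hι, hwα]
end

section
/- Let l ≥ 3 be odd, let L₂ = ℚ₂[x]/(x^l − 2) with λ the image of x (a totally ramified field extension of ℚ₂ of degree l, since x^l − 2 is Eisenstein at 2). Then the classes of the l + 2 elements λ, 1+λ, 1+λ³, 1+λ⁵, …, 1+λ^{2l−1}, 1+λ^{2l} (i.e., λ together with 1+λ^j for each odd j with 1 ≤ j ≤ 2l−1, together with 1+λ^{2l}) form an 𝔽₂-basis of the group L₂^×/(L₂^×)². -/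
section Ultrametric

variable {L : Type*} [NormedField L] [IsUltrametricDist L]

theorem norm_eq_of_norm_sub_lt_norm_right {x y : L} (h : ‖x - y‖ < ‖y‖) : ‖x‖ = ‖y‖ := by
  have := IsUltrametricDist.norm_eq_of_add_norm_lt_max (x := x) (y := -y)
    (by rw [← sub_eq_add_neg, norm_neg]; exact lt_max_of_lt_right h)
  rwa [norm_neg] at this

theorem norm_sub_le_max_norm (x y : L) : ‖x - y‖ ≤ max ‖x‖ ‖y‖ := by
  rw [sub_eq_add_neg, ← norm_neg y]
  exact IsUltrametricDist.norm_add_le_max x (-y)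

theorem norm_add_eq_of_norm_lt {x y : L} (h : ‖y‖ < ‖x‖) : ‖x + y‖ = ‖x‖ :=
  norm_eq_of_norm_sub_lt_norm_right (by simpa using h)

/-- Principal units of a given level are closed under finite products. -/
theorem norm_prod_sub_one_le {ι : Type*} (s : Finset ι) (f : ι → L) {ε : ℝ} (h0 : 0 ≤ ε)
    (h1 : ε ≤ 1) (hf : ∀ i ∈ s, ‖f i - 1‖ ≤ ε) : ‖∏ i ∈ s, f i - 1‖ ≤ ε := by
  classical
  induction s using Finset.induction_on with
  | empty => simpa using h0
  | insert a s ha ih =>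
    rw [Finset.prod_insert ha]
    have hQ := ih fun i hi => hf i (Finset.mem_insert_of_mem hi)
    have hA := hf a (Finset.mem_insert_self a s)
    have hid : f a * ∏ i ∈ s, f i - 1
        = (f a - 1) * (∏ i ∈ s, f i - 1) + ((f a - 1) + (∏ i ∈ s, f i - 1)) := by ring
    rw [hid]
    refine (IsUltrametricDist.norm_add_le_max _ _).trans (max_le ?_ ?_)
    · rw [norm_mul]
      calc _ ≤ ε * 1 := mul_le_mul hA (hQ.trans h1) (norm_nonneg _) h0
        _ = ε := mul_one ε
    · exact (IsUltrametricDist.norm_add_le_max _ _).trans (max_le hA hQ)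

/-- If the nonzero terms of a finite sum have pairwise distinct norms, one term dominates. -/
theorem exists_norm_sum_sub_lt {ι : Type*} [Fintype ι] (g : ι → L)
    (hg : ∀ i j, g i ≠ 0 → ‖g i‖ = ‖g j‖ → i = j) (hne : ∃ i, g i ≠ 0) :
    ∃ i, g i ≠ 0 ∧ ‖∑ j, g j - g i‖ < ‖g i‖ := by
  classical
  obtain ⟨i₀, hi₀⟩ := hne
  obtain ⟨i, -, hi⟩ := Finset.exists_max_image Finset.univ (fun i => ‖g i‖) ⟨i₀, Finset.mem_univ _⟩
  have hpos : 0 < ‖g i‖ := (norm_pos_iff.2 hi₀).trans_le (hi i₀ (Finset.mem_univ _))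
  have hi0 : g i ≠ 0 := norm_pos_iff.1 hpos
  refine ⟨i, hi0, ?_⟩
  rw [← Finset.add_sum_erase _ _ (Finset.mem_univ i), add_sub_cancel_left]
  have : Nonempty ι := ⟨i⟩
  rcases (Finset.univ.erase i).eq_empty_or_nonempty with he | he
  · simpa [he] using hpos
  · obtain ⟨j, hj, hle⟩ := IsUltrametricDist.exists_norm_finsetSum_le_of_nonempty he g
    refine hle.trans_lt (lt_of_le_of_ne (hi j (Finset.mem_univ _)) fun h => ?_)
    exact Finset.ne_of_mem_erase hj (hg i j hi0 h.symm).symm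

/-- Hensel lemma for squares: units congruent to `1` modulo more than `4` are squares. -/
theorem exists_sq_eq_of_norm_sub_one_lt [CompleteSpace L] {u : L} (hu : ‖u - 1‖ < ‖(4 : L)‖) :
    ∃ y : L, y ^ 2 = u := by
  have h4 : (4 : L) ≠ 0 := norm_pos_iff.1 ((norm_nonneg _).trans_lt hu)
  set w : L := (u - 1) / 4 with hw
  have hw1 : ‖w‖ < 1 := by
    rw [hw, norm_div, div_lt_one (norm_pos_iff.2 h4)]
    exact hu
  set f : L → L := fun z => w - z ^ 2 with hf
  set s : Set L := Metric.closedBall 0 ‖w‖ with hs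
  have hsf : Set.MapsTo f s s := by
    intro z hz
    rw [hs, mem_closedBall_zero_iff] at hz ⊢
    refine (norm_sub_le_max_norm _ _).trans (max_le le_rfl ?_)
    rw [norm_pow, sq]
    calc _ ≤ ‖w‖ * 1 := mul_le_mul hz (hz.trans hw1.le) (norm_nonneg _) (norm_nonneg _)
      _ = ‖w‖ := mul_one _
  have hc : ContractingWith ‖w‖₊ (hsf.restrict f s s) := by
    refine ⟨by exact_mod_cast hw1, LipschitzWith.of_dist_le_mul ?_⟩
    rintro ⟨a, ha⟩ ⟨b, hb⟩
    rw [hs, mem_closedBall_zero_iff] at ha hb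
    simp only [Subtype.dist_eq, Set.MapsTo.val_restrict_apply, dist_eq_norm, hf, coe_nnnorm]
    have hid : w - a ^ 2 - (w - b ^ 2) = -((a + b) * (a - b)) := by ring
    rw [hid, norm_neg, norm_mul]
    exact mul_le_mul_of_nonneg_right
      ((IsUltrametricDist.norm_add_le_max _ _).trans (max_le ha hb)) (norm_nonneg _)
  obtain ⟨z, -, hz, -⟩ := hc.exists_fixedPoint' Metric.isClosed_closedBall.isComplete hsf
    (x := 0) (by simp [hs]) (edist_ne_top _ _)
  refine ⟨1 + 2 * z, ?_⟩
  have hz' : w - z ^ 2 = z := hz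
  have hu' : u = 1 + 4 * w := by rw [hw]; field_simp; ring
  rw [hu', ← sub_eq_zero]
  linear_combination (-4) * hz'

theorem norm_le_pow_succ_of_lt {π : L} (h0 : 0 < ‖π‖) (h1 : ‖π‖ < 1)
    (hres : ∀ x : L, x ≠ 0 → ∃ n : ℤ, ‖x - π ^ n‖ < ‖π ^ n‖)
    {x : L} {k : ℕ} (hx : ‖x‖ < ‖π‖ ^ k) : ‖x‖ ≤ ‖π‖ ^ (k + 1) := by
  by_cases hx0 : x = 0
  · simp [hx0, pow_nonneg h0.le]
  obtain ⟨n, hn⟩ := hres x hx0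
  have hxn := norm_eq_of_norm_sub_lt_norm_right hn
  rw [norm_zpow] at hxn
  rw [hxn] at hx ⊢
  rw [← zpow_natCast, zpow_lt_zpow_iff_right_of_lt_one₀ h0 h1] at hx
  rw [← zpow_natCast, zpow_le_zpow_iff_right_of_lt_one₀ h0 h1]
  push_cast
  omega

theorem norm_sub_pow_le {π : L} (h0 : 0 < ‖π‖) (h1 : ‖π‖ < 1)
    (hres : ∀ x : L, x ≠ 0 → ∃ n : ℤ, ‖x - π ^ n‖ < ‖π ^ n‖)
    {x : L} {k : ℕ} (hx : ‖x‖ = ‖π‖ ^ k) :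
    ‖x - π ^ k‖ ≤ ‖π‖ ^ (k + 1) := by
  apply norm_le_pow_succ_of_lt h0 h1 hres
  have hx0 : x ≠ 0 := norm_pos_iff.1 (hx ▸ pow_pos h0 k)
  obtain ⟨n, hn⟩ := hres x hx0
  have hxn := norm_eq_of_norm_sub_lt_norm_right hn
  rw [hx, norm_zpow, ← zpow_natCast] at hxn
  obtain rfl := zpow_right_injective₀ h0 h1.ne hxn
  simpa using hn

theorem exists_norm_eq_pow_of_le {π : L} (h0 : 0 < ‖π‖) (h1 : ‖π‖ < 1)
    (hres : ∀ x : L, x ≠ 0 → ∃ n : ℤ, ‖x - π ^ n‖ < ‖π ^ n‖)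
    {x : L} {k : ℕ} (hx0 : x ≠ 0) (hx : ‖x‖ ≤ ‖π‖ ^ k) :
    ∃ m : ℕ, k ≤ m ∧ ‖x‖ = ‖π‖ ^ m := by
  obtain ⟨n, hn⟩ := hres x hx0
  have hxn := norm_eq_of_norm_sub_lt_norm_right hn
  rw [norm_zpow] at hxn
  rw [hxn, ← zpow_natCast, zpow_le_zpow_iff_right_of_lt_one₀ h0 h1] at hx
  lift n to ℕ using by omega
  exact ⟨n, by exact_mod_cast hx, by simpa using hxn⟩

/-- The possible levels of squares of units, `l` being the ramification index over `ℚ₂`. -/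
theorem even_and_lt_or_lt_of_norm_sq_sub_one {π : L} (h0 : 0 < ‖π‖) (h1 : ‖π‖ < 1)
    (hres : ∀ x : L, x ≠ 0 → ∃ n : ℤ, ‖x - π ^ n‖ < ‖π ^ n‖)
    {l j : ℕ} (hl : 1 ≤ l) (h2 : π ^ l = 2) (hj : 1 ≤ j)
    {y : L} (hy : ‖y ^ 2 - 1‖ = ‖π‖ ^ j) : (Even j ∧ j < 2 * l) ∨ 2 * l < j := by
  have hn2 : ‖(2 : L)‖ = ‖π‖ ^ l := by rw [← h2, norm_pow]
  have hanti := pow_right_strictAnti₀ h0 h1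
  have hy1 : ‖y‖ = ‖π‖ ^ 0 := by
    have : ‖y ^ 2‖ = ‖(1 : L)‖ := norm_eq_of_norm_sub_lt_norm_right
      (by rw [hy, norm_one]; exact pow_lt_one₀ h0.le h1 (by omega))
    rw [norm_one, norm_pow] at this
    rw [pow_zero]
    exact (pow_eq_one_iff_of_nonneg (norm_nonneg _) two_ne_zero).1 this
  have hd := norm_sub_pow_le h0 h1 hres hy1
  rw [pow_zero] at hd
  set d := y - 1 with hdd
  have hid : y ^ 2 - 1 = d * (d + 2) := by rw [hdd]; ring
  rw [hid, norm_mul] at hy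
  have hd0 : d ≠ 0 := by
    intro h
    rw [h, norm_zero, zero_mul] at hy
    exact (pow_pos h0 j).ne hy
  obtain ⟨m, hm1, hm⟩ := exists_norm_eq_pow_of_le h0 h1 hres hd0 hd
  rcases lt_trichotomy m l with hml | rfl | hml
  · rw [norm_add_eq_of_norm_lt (by rw [hm, hn2]; exact hanti hml), hm, ← pow_add] at hy
    have := hanti.injective hy
    left
    exact ⟨⟨m, this.symm⟩, by omega⟩
  · right
    have hle : ‖d + 2‖ ≤ ‖π‖ ^ (m + 1) := by
      have hid' : d + 2 = (d - π ^ m) + 2 * π ^ m := by rw [h2]; ring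
      rw [hid']
      refine (IsUltrametricDist.norm_add_le_max _ _).trans
        (max_le (norm_sub_pow_le h0 h1 hres hm) ?_)
      rw [norm_mul, hn2, norm_pow, ← pow_add]
      exact hanti.antitone (by omega)
    have : ‖π‖ ^ j ≤ ‖π‖ ^ (m + (m + 1)) := by
      rw [← hy, hm, pow_add]
      exact mul_le_mul_of_nonneg_left hle (pow_nonneg h0.le _)
    have := hanti.le_iff_ge.1 this
    omega
  · right
    rw [add_comm d, norm_add_eq_of_norm_lt (by rw [hm, hn2]; exact hanti hml), hm, hn2,
      ← pow_add] at hy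
    have := hanti.injective hy
    omega

/-- A multiplicative class containing the squares and one representative of each level of
principal units contains all principal units. -/
theorem principal_units_induction {π : L} (h0 : 0 < ‖π‖) (h1 : ‖π‖ < 1)
    (hres : ∀ x : L, x ≠ 0 → ∃ n : ℤ, ‖x - π ^ n‖ < ‖π ^ n‖)
    {l : ℕ} [CompleteSpace L] (h2 : π ^ l = 2)
    (P : L → Prop) (hmul : ∀ x y, P x → P y → P (x * y)) (hsq : ∀ x, x ≠ 0 → P (x ^ 2))
    (hodd : ∀ j, Odd j → j < 2 * l → P (1 + π ^ j)) (htop : P (1 + π ^ (2 * l)))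
    {u : L} (hu : ‖u - 1‖ ≤ ‖π‖) : P u := by
  have hn2 : ‖(2 : L)‖ = ‖π‖ ^ l := by rw [← h2, norm_pow]
  have hanti := pow_right_strictAnti₀ h0 h1
  have hunit : ∀ {v : L}, ‖v - 1‖ < 1 → ‖v‖ = 1 := fun {v} hv => by
    simpa using norm_eq_of_norm_sub_lt_norm_right (y := (1 : L)) (by simpa using hv)
  have hlt1 : ∀ k, 1 ≤ k → ‖π‖ ^ k < 1 := fun k hk => pow_lt_one₀ h0.le h1 (by omega)
  have key : ∀ k, k ≤ 2 * l + 1 → 1 ≤ k → ∀ u : L, ‖u - 1‖ ≤ ‖π‖ ^ k → P u := by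
    intro k hk
    induction hk using Nat.decreasingInduction with
    | self =>
      intro _ u hu
      obtain ⟨y, rfl⟩ := exists_sq_eq_of_norm_sub_one_lt (u := u) (by
        have h4 : (4 : L) = π ^ (2 * l) := by rw [mul_comm, pow_mul, h2]; norm_num
        rw [h4, norm_pow]
        exact hu.trans_lt (hanti (by omega)))
      refine hsq y fun h => ?_
      have := hunit (hu.trans_lt (hlt1 _ (by omega)))
      simp [h] at this
    | of_succ k hk ih =>
      intro hk1 u hu
      rcases hu.lt_or_eq with hlt | heq
      · exact ih (by omega) u (norm_le_pow_succ_of_lt h0 h1 hres hlt)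
      obtain ⟨c, hPc, hc⟩ : ∃ c, P c ∧ ‖c - 1 - π ^ k‖ ≤ ‖π‖ ^ (k + 1) := by
        rcases Nat.even_or_odd k with he | ho
        · rcases (show k ≤ 2 * l by omega).lt_or_eq with hk2 | rfl
          · obtain ⟨m, rfl⟩ := he
            refine ⟨(1 + π ^ m) ^ 2, hsq _ fun h => ?_, ?_⟩
            · have : π ^ m = -1 := by linear_combination h
              have := congrArg norm this
              rw [norm_pow, norm_neg, norm_one] at this
              exact (hlt1 m (by omega)).ne this
            · have hid : (1 + π ^ m) ^ 2 - 1 - π ^ (m + m) = 2 * π ^ m := by ring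
              rw [hid, norm_mul, hn2, norm_pow, ← pow_add]
              exact hanti.antitone (by omega)
          · exact ⟨_, htop, by simp [pow_nonneg h0.le]⟩
        · refine ⟨_, hodd k ho ?_, by simp [pow_nonneg h0.le]⟩
          obtain ⟨m, rfl⟩ := ho
          omega
      have hc1 : ‖c‖ = 1 := hunit <| by
        have hid : c - 1 = (c - 1 - π ^ k) + π ^ k := by ring
        rw [hid]
        refine (IsUltrametricDist.norm_add_le_max _ _).trans_lt (max_lt ?_ ?_)
        · exact hc.trans_lt (hlt1 _ (by omega))
        · rw [norm_pow]
          exact hlt1 k hk1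
      have hc0 : c ≠ 0 := by
        rintro rfl
        simp at hc1
      have hPuc : P (u / c) := by
        refine ih (by omega) _ ?_
        have hid : u / c - 1 = ((u - 1 - π ^ k) - (c - 1 - π ^ k)) / c := by
          field_simp
          ring
        rw [hid, norm_div, hc1, div_one]
        exact (norm_sub_le_max_norm _ _).trans
          (max_le (norm_sub_pow_le h0 h1 hres heq) hc)
      simpa [div_mul_cancel₀ u hc0] using hmul _ _ hPuc hPc
  exact key 1 (by omega) le_rfl u (by simpa using hu)

end Ultrametric

theorem padic_two_exists_norm_sub_zpow_lt {a : ℚ_[2]} (ha : a ≠ 0) :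
    ∃ v : ℤ, ‖a - 2 ^ v‖ < ‖(2 : ℚ_[2]) ^ v‖ := by
  have h2 : (2 : ℚ_[2]) ≠ 0 := two_ne_zero
  refine ⟨a.valuation, ?_⟩
  set v := a.valuation
  have h2v : (2 : ℚ_[2]) ^ v ≠ 0 := zpow_ne_zero v h2
  have hna : ‖a‖ = ‖(2 : ℚ_[2]) ^ v‖ := by
    rw [Padic.norm_eq_zpow_neg_valuation ha, norm_zpow]
    have : ‖(2 : ℚ_[2])‖ = 2⁻¹ := by simpa using Padic.norm_p (p := 2)
    rw [this]
    simp [v]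
  have hu : ‖a / 2 ^ v‖ = 1 := by rw [norm_div, hna, div_self (norm_ne_zero_iff.2 h2v)]
  set u : ℤ_[2] := ⟨a / 2 ^ v, hu.le⟩ with hudef
  have hu1 : ‖u - 1‖ < 1 := by
    rw [PadicInt.norm_lt_one_iff_dvd, ← Ideal.mem_span_singleton, ← PadicInt.maximalIdeal_eq_span_p,
      ← PadicInt.ker_toZMod, RingHom.mem_ker, map_sub, map_one]
    have hne : PadicInt.toZMod u ≠ 0 := by
      rw [Ne, ← RingHom.mem_ker, PadicInt.ker_toZMod, PadicInt.maximalIdeal_eq_span_p,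
        Ideal.mem_span_singleton, ← PadicInt.norm_lt_one_iff_dvd]
      exact hu.not_lt
    generalize PadicInt.toZMod u = t at hne
    revert t
    decide
  have hid : a - 2 ^ v = (a / 2 ^ v - 1) * 2 ^ v := by field_simp
  rw [hid, norm_mul]
  exact mul_lt_of_lt_one_left (norm_pos_iff.2 h2v) hu1

/-- If `π ^ l = 2` in an extension of `ℚ₂` of degree `l`, every nonzero element is congruent to a
power of `π` up to terms of smaller norm. -/
theorem exists_norm_sub_zpow_lt_of_pow_eq_two {L : Type*} [NormedField L] [IsUltrametricDist L]
    [NormedAlgebra ℚ_[2] L] {l : ℕ} (hl : 1 ≤ l) {π : L} (h0 : 0 < ‖π‖) (h1 : ‖π‖ < 1)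
    (h2 : π ^ l = 2) (hdeg : Module.finrank ℚ_[2] L = l) {x : L} (hx : x ≠ 0) :
    ∃ n : ℤ, ‖x - π ^ n‖ < ‖π ^ n‖ := by
  have hπ0 : π ≠ 0 := norm_pos_iff.1 h0
  have hterm : ∀ (a : ℚ_[2]) (i : ℕ), a ≠ 0 →
      ∃ v : ℤ, ‖a • π ^ i - π ^ (l * v + i)‖ < ‖π ^ (l * v + i)‖ := by
    intro a i ha
    obtain ⟨v, hv⟩ := padic_two_exists_norm_sub_zpow_lt ha
    refine ⟨v, ?_⟩
    have hmap : π ^ (l * v + i : ℤ) = ((2 : ℚ_[2]) ^ v) • π ^ i := by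
      rw [zpow_add₀ hπ0, zpow_mul, zpow_natCast, zpow_natCast, h2, Algebra.smul_def, map_zpow₀,
        map_ofNat]
    rw [hmap, ← sub_smul, norm_smul, norm_smul]
    exact mul_lt_mul_of_pos_right hv (norm_pos_iff.2 (pow_ne_zero i hπ0))
  have hdist : ∀ (a : Fin l → ℚ_[2]) (i j : Fin l), a i • π ^ (i : ℕ) ≠ 0 →
      ‖a i • π ^ (i : ℕ)‖ = ‖a j • π ^ (j : ℕ)‖ → i = j := by
    intro a i j hi hij
    have hj : a j • π ^ (j : ℕ) ≠ 0 := by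
      rw [← norm_ne_zero_iff, ← hij]
      exact norm_ne_zero_iff.2 hi
    obtain ⟨v, hv⟩ := hterm (a i) i (left_ne_zero_of_smul hi)
    obtain ⟨w, hw⟩ := hterm (a j) j (left_ne_zero_of_smul hj)
    rw [norm_eq_of_norm_sub_lt_norm_right hv, norm_eq_of_norm_sub_lt_norm_right hw, norm_zpow,
      norm_zpow] at hij
    have hexp : (l * v + i : ℤ) = l * w + j := zpow_right_injective₀ h0 h1.ne hij
    have hmod := congrArg (· % (l : ℤ)) hexp
    simp only [Int.mul_add_emod_self_left] at hmod
    rw [Int.emod_eq_of_lt (by omega) (by omega), Int.emod_eq_of_lt (by omega) (by omega)] at hmod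
    exact Fin.ext (by exact_mod_cast hmod)
  have hli : LinearIndependent ℚ_[2] (fun i : Fin l => π ^ (i : ℕ)) := by
    rw [Fintype.linearIndependent_iff]
    intro a ha i
    by_contra hai
    obtain ⟨k, -, hk⟩ := exists_norm_sum_sub_lt _ (hdist a)
      ⟨i, smul_ne_zero hai (pow_ne_zero _ hπ0)⟩
    rw [ha, zero_sub, norm_neg] at hk
    exact hk.false
  have : Nonempty (Fin l) := ⟨⟨0, hl⟩⟩
  obtain ⟨a, rfl⟩ : ∃ a : Fin l → ℚ_[2], ∑ i, a i • π ^ (i : ℕ) = x := by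
    let b := basisOfLinearIndependentOfCardEqFinrank hli (by simp [hdeg])
    exact ⟨b.repr x, by simpa [b] using b.sum_repr x⟩
  have hne : ∃ i, a i • π ^ (i : ℕ) ≠ 0 := by
    by_contra! h
    exact hx (Finset.sum_eq_zero fun i _ => h i)
  obtain ⟨k, hk0, hk⟩ := exists_norm_sum_sub_lt _ (hdist a) hne
  obtain ⟨v, hv⟩ := hterm (a k) k (left_ne_zero_of_smul hk0)
  refine ⟨l * v + k, ?_⟩
  rw [norm_eq_of_norm_sub_lt_norm_right hv] at hk
  rw [← sub_add_sub_cancel _ (a k • π ^ (k : ℕ))]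
  exact (IsUltrametricDist.norm_add_le_max _ _).trans_lt (max_lt hk hv)

/-- The classes of `π`, `1 + π ^ j` for odd `j < 2 * l`, and `1 + π ^ (2 * l)` form a basis of
`Lˣ` modulo squares, for `L` a normed extension of `ℚ₂` of degree `l` with `π ^ l = 2`. -/
theorem existsUnique_prod_mul_sq {L : Type*} [NormedField L] [IsUltrametricDist L]
    [NormedAlgebra ℚ_[2] L] [CompleteSpace L] {l : ℕ} (hl : 1 ≤ l) {π : L} (h2 : π ^ l = 2)
    (hdeg : Module.finrank ℚ_[2] L = l) {e : Fin (l + 2) → L}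
    (he : ∀ i : Fin (l + 2), e i =
      if (i : ℕ) = 0 then π
      else if (i : ℕ) ≤ l then 1 + π ^ (2 * (i : ℕ) - 1)
      else 1 + π ^ (2 * l)) {x : L} (hx : x ≠ 0) :
    ∃! s : Finset (Fin (l + 2)), ∃ y : L, y ≠ 0 ∧ x = (∏ i ∈ s, e i) * y ^ 2 := by
  classical
  have hn2 : ‖π‖ ^ l = 2⁻¹ := by
    rw [← norm_pow, h2, ← map_ofNat (algebraMap ℚ_[2] L) 2, norm_algebraMap']
    simpa using Padic.norm_p (p := 2)
  have h0 : 0 < ‖π‖ := by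
    refine (norm_nonneg π).lt_of_ne fun h => ?_
    rw [← h, zero_pow (by omega)] at hn2
    norm_num at hn2
  have h1 : ‖π‖ < 1 := by
    by_contra! h
    have := one_le_pow₀ (n := l) h
    rw [hn2] at this
    norm_num at this
  have hπ0 : π ≠ 0 := norm_pos_iff.1 h0
  have hres : ∀ x : L, x ≠ 0 → ∃ n : ℤ, ‖x - π ^ n‖ < ‖π ^ n‖ := fun x hx =>
    exists_norm_sub_zpow_lt_of_pow_eq_two hl h0 h1 h2 hdeg hx
  have hanti := pow_right_strictAnti₀ h0 h1
  -- the level of the unit `e i` for `i ≠ 0`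
  let J : ℕ → ℕ := fun i => if i ≤ l then 2 * i - 1 else 2 * l
  have hJpos : ∀ i, 1 ≤ i → 1 ≤ J i := fun i hi => by simp only [J]; split_ifs <;> omega
  have hJmono : ∀ i k, 1 ≤ i → i < k → k < l + 2 → J i + 1 ≤ J k := fun i k hi hik hk => by
    simp only [J]; split_ifs <;> omega
  have heJ : ∀ i : Fin (l + 2), (i : ℕ) ≠ 0 → e i = 1 + π ^ J i := fun i hi => by
    rw [he, if_neg hi]; simp only [J]; split_ifs <;> rfl
  have hlevel : ∀ i : Fin (l + 2), (i : ℕ) ≠ 0 → ‖e i - 1‖ = ‖π‖ ^ J i := fun i hi => by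
    rw [heJ i hi, add_sub_cancel_left, norm_pow]
  have hunit : ∀ {v : L}, ‖v - 1‖ < 1 → ‖v‖ = 1 := fun {v} hv => by
    simpa using norm_eq_of_norm_sub_lt_norm_right (y := (1 : L)) (by simpa using hv)
  have he1 : ∀ i : Fin (l + 2), (i : ℕ) ≠ 0 → ‖e i‖ = 1 := fun i hi => hunit <| by
    rw [hlevel i hi]
    exact pow_lt_one₀ h0.le h1 (by have := hJpos i (by omega); omega)
  have hez : e 0 = π := by simp [he]
  have he0 : ∀ i, e i ≠ 0 := fun i => by
    by_cases hi : (i : ℕ) = 0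
    · rw [show i = 0 from Fin.ext hi, hez]; exact hπ0
    · exact norm_ne_zero_iff.1 (by rw [he1 i hi]; exact one_ne_zero)
  have hprod0 : ∀ s : Finset (Fin (l + 2)), ∏ i ∈ s, e i ≠ 0 := fun s =>
    Finset.prod_ne_zero_iff.2 fun i _ => he0 i
  have hsymm : ∀ s t : Finset (Fin (l + 2)), (∏ i ∈ s, e i) * ∏ i ∈ t, e i
      = (∏ i ∈ symmDiff s t, e i) * (∏ i ∈ s ∩ t, e i) ^ 2 := fun s t => by
    rw [← Finset.prod_union_inter, sq, ← mul_assoc]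
    congr 1
    rw [← Finset.prod_union]
    · congr 1
      ext i
      simp only [Finset.mem_union, Finset.mem_symmDiff, Finset.mem_inter]
      tauto
    · rw [Finset.disjoint_left]
      intro i
      simp only [Finset.mem_symmDiff, Finset.mem_inter]
      tauto
  -- independence
  have hindep : ∀ (s : Finset (Fin (l + 2))) (y : L), ∏ i ∈ s, e i = y ^ 2 → s = ∅ := by
    intro s y hy
    by_contra hs
    obtain ⟨i, his, himin⟩ := s.exists_min_image id (Finset.nonempty_iff_ne_empty.2 hs)
    have hgt : ∀ k ∈ s.erase i, (i : ℕ) < k := fun k hk =>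
      lt_of_le_of_ne (himin k (Finset.mem_of_mem_erase hk)) fun h =>
        Finset.ne_of_mem_erase hk (Fin.ext h.symm)
    rw [← Finset.mul_prod_erase _ _ his] at hy
    by_cases hi : (i : ℕ) = 0
    · have hnorm := congrArg norm hy
      rw [norm_mul, norm_prod, Finset.prod_eq_one fun k hk => he1 k (by have := hgt k hk; omega),
        show i = 0 from Fin.ext hi, hez, mul_one, norm_pow] at hnorm
      have hy0 : y ≠ 0 := by
        rintro rfl
        simp [hπ0] at hnorm
      obtain ⟨n, hn⟩ := hres y hy0
      rw [norm_eq_of_norm_sub_lt_norm_right hn, norm_zpow, ← zpow_natCast, ← zpow_mul] at hnorm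
      have := zpow_right_injective₀ h0 h1.ne ((zpow_one _).trans hnorm)
      push_cast at this
      omega
    · have hQ : ‖∏ k ∈ s.erase i, e k - 1‖ ≤ ‖π‖ ^ (J i + 1) := by
        refine norm_prod_sub_one_le _ _ (pow_nonneg h0.le _) (pow_le_one₀ h0.le h1.le) ?_
        intro k hk
        have hik := hgt k hk
        rw [hlevel k (by omega)]
        exact hanti.antitone (hJmono i k (by omega) hik k.2)
      have hQ1 : ‖∏ k ∈ s.erase i, e k‖ = 1 :=
        hunit (hQ.trans_lt (pow_lt_one₀ h0.le h1 (by omega)))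
      have hlead : ‖(e i - 1) * ∏ k ∈ s.erase i, e k‖ = ‖π‖ ^ J i := by
        rw [norm_mul, hQ1, mul_one, hlevel i hi]
      have hyn : ‖y ^ 2 - 1‖ = ‖π‖ ^ J i := by
        have hid : y ^ 2 - 1 = (e i - 1) * ∏ k ∈ s.erase i, e k + (∏ k ∈ s.erase i, e k - 1) := by
          rw [← hy]; ring
        rw [hid, norm_add_eq_of_norm_lt, hlead]
        rw [hlead]
        exact hQ.trans_lt (hanti (by omega))
      have hlev := even_and_lt_or_lt_of_norm_sq_sub_one h0 h1 hres hl h2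
        (hJpos i (by omega)) hyn
      simp only [J] at hlev
      split_ifs at hlev with hil
      · rcases hlev with ⟨⟨m, hm⟩, -⟩ | h <;> omega
      · omega
  -- generation
  let P : L → Prop := fun x => ∃ s : Finset (Fin (l + 2)), ∃ y : L, y ≠ 0 ∧
    x = (∏ i ∈ s, e i) * y ^ 2
  have hPmul : ∀ x y, P x → P y → P (x * y) := by
    rintro _ _ ⟨s, y, hy, rfl⟩ ⟨t, z, hz, rfl⟩
    refine ⟨symmDiff s t, (∏ i ∈ s ∩ t, e i) * (y * z),
      mul_ne_zero (hprod0 _) (mul_ne_zero hy hz), ?_⟩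
    linear_combination (y ^ 2 * z ^ 2) * hsymm s t
  have hPsq : ∀ x, x ≠ 0 → P (x ^ 2) := fun x hx => ⟨∅, x, hx, by simp⟩
  have hPe : ∀ i, P (e i) := fun i => ⟨{i}, 1, one_ne_zero, by simp⟩
  have hPunit : ∀ u : L, ‖u - 1‖ ≤ ‖π‖ → P u := by
    intro u hu
    refine principal_units_induction h0 h1 hres h2 P hPmul hPsq ?_ ?_ hu
    · rintro j ⟨m, rfl⟩ hj
      have := hPe ⟨m + 1, by omega⟩
      rwa [heJ _ (by simp), show J (m + 1) = 2 * m + 1 by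
        simp only [J]; split_ifs <;> omega] at this
    · have := hPe ⟨l + 1, by omega⟩
      rwa [heJ _ (by simp), show J (l + 1) = 2 * l by simp [J]] at this
  have hPx : P x := by
    obtain ⟨n, hn⟩ := hres x hx
    have hπn : π ^ n ≠ 0 := zpow_ne_zero n hπ0
    have hu : P (x / π ^ n) := by
      refine hPunit _ ?_
      have hid : x / π ^ n - 1 = (x - π ^ n) / π ^ n := by field_simp
      have hlt : ‖x / π ^ n - 1‖ < ‖π‖ ^ 0 := by
        rw [hid, norm_div, pow_zero, div_lt_one (norm_pos_iff.2 hπn)]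
        exact hn
      simpa using norm_le_pow_succ_of_lt h0 h1 hres hlt
    have hPπ : P (π ^ n) := by
      rcases Int.even_or_odd' n with ⟨m, rfl | rfl⟩
      · rw [mul_comm, zpow_mul]
        exact_mod_cast hPsq _ (zpow_ne_zero m hπ0)
      · rw [zpow_add_one₀ hπ0, mul_comm 2 m, zpow_mul]
        refine hPmul _ _ (by exact_mod_cast hPsq _ (zpow_ne_zero m hπ0)) ?_
        rw [← hez]
        exact hPe 0
    simpa [div_mul_cancel₀ x hπn] using hPmul _ _ hu hPπ
  obtain ⟨s, y, hy, hxs⟩ := hPx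
  refine ⟨s, ⟨y, hy, hxs⟩, ?_⟩
  rintro t ⟨z, hz, hxt⟩
  have hst : symmDiff s t = ∅ := by
    refine hindep _ ((∏ i ∈ t, e i) * z / (y * ∏ i ∈ s ∩ t, e i)) ?_
    have hI := hprod0 (s ∩ t)
    rw [div_pow, eq_div_iff (pow_ne_zero 2 (mul_ne_zero hy hI))]
    linear_combination (-y ^ 2) * hsymm s t + (∏ i ∈ t, e i) * (hxt - hxs)
  exact (symmDiff_eq_bot.1 hst).symm

/-- In `L₂ = ℚ₂(2^{1/l})` (`l ≥ 3` odd, `λ = 2^{1/l}`), the classes of the `l + 2` elements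
`λ, 1+λ, 1+λ³, …, 1+λ^{2l-1}, 1+λ^{2l}` form an `𝔽₂`-basis of `L₂^×/(L₂^×)²`: every
nonzero `x ∈ L₂` is, for a unique subset `s` of the index set, of the form
`(∏_{i ∈ s} e_i)·y²` with `y ≠ 0`. -/
theorem stmt9 (l : ℕ) (hl : 3 ≤ l) (hodd : Odd l)
    (L₂ : Type*) [Field L₂] [Algebra ℚ_[2] L₂]
    (lam : L₂) (hlam : lam ^ l = 2) (hdeg : Module.finrank ℚ_[2] L₂ = l)
    (e : Fin (l + 2) → L₂)
    (he : ∀ i : Fin (l + 2), e i =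
      if (i : ℕ) = 0 then lam
      else if (i : ℕ) ≤ l then 1 + lam ^ (2 * (i : ℕ) - 1)
      else 1 + lam ^ (2 * l)) :
    ∀ x : L₂, x ≠ 0 → ∃! s : Finset (Fin (l + 2)),
      ∃ y : L₂, y ≠ 0 ∧ x = (∏ i ∈ s, e i) * y ^ 2 := by
  intro x hx
  have : FiniteDimensional ℚ_[2] L₂ := FiniteDimensional.of_finrank_pos (by omega)
  let := spectralNorm.normedField ℚ_[2] L₂
  let := spectralNorm.normedAlgebra ℚ_[2] L₂
  have : IsUltrametricDist L₂ :=
    IsUltrametricDist.isUltrametricDist_of_isNonarchimedean_norm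
      (isNonarchimedean_spectralNorm (K := ℚ_[2]))
  have : CompleteSpace L₂ := spectralNorm.completeSpace ℚ_[2] L₂
  exact existsUnique_prod_mul_sq (by omega) hlam hdeg he hx
end

section
/- Let l ≥ 3 be odd and let L₂ = ℚ₂[x]/(x^l − 2) with λ the image of x, so λ^l = 2 and L₂ is a totally ramified field extension of ℚ₂ of degree l. Then for every u ∈ ℤ₂^× (viewed in L₂), there exists s ∈ L₂^× such that (2u)^{−2} + λ^{−2} = s²·(1 + λ^{2l−1}). (This is the square-class computation for the residue disk at infinity in Lemma 6.2.) -/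
open Metric in
/-- A quadratic case of the Hensel lemma: over a complete nonarchimedean field, `y + y ^ 2 = z` is
solvable when `‖z‖ < 1`. -/
theorem exists_add_sq_eq_of_norm_lt_one {K : Type*} [NormedField K] [CompleteSpace K]
    [IsUltrametricDist K] {z : K} (hz : ‖z‖ < 1) : ∃ y : K, y + y ^ 2 = z := by
  have hmaps : Set.MapsTo (fun y : K ↦ z - y ^ 2) (closedBall 0 ‖z‖) (closedBall 0 ‖z‖) := by
    intro y hy
    rw [mem_closedBall_zero_iff] at hy ⊢
    beta_reduce
    rw [sub_eq_add_neg]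
    refine (IsUltrametricDist.norm_add_le_max _ _).trans (max_le le_rfl ?_)
    rw [norm_neg, norm_pow]
    nlinarith [norm_nonneg y]
  have hcontr : ContractingWith ‖z‖₊ (hmaps.restrict _ _ _) := by
    refine ⟨by exact_mod_cast hz, LipschitzWith.of_dist_le_mul ?_⟩
    rintro ⟨a, ha⟩ ⟨b, hb⟩
    rw [mem_closedBall_zero_iff] at ha hb
    change dist (z - a ^ 2) (z - b ^ 2) ≤ ‖z‖ * dist a b
    have hab : ‖b + a‖ ≤ ‖z‖ := (IsUltrametricDist.norm_add_le_max _ _).trans (max_le hb ha)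
    rw [dist_eq_norm, dist_comm, dist_eq_norm,
      show z - a ^ 2 - (z - b ^ 2) = (b + a) * (b - a) by ring, norm_mul]
    gcongr
  obtain ⟨y, -, hy, -⟩ := hcontr.exists_fixedPoint' isClosed_closedBall.isComplete hmaps
    (mem_closedBall_self (norm_nonneg z)) (edist_ne_top _ _)
  have hy : z - y ^ 2 = y := hy
  exact ⟨y, by linear_combination -hy⟩

/-- Over a complete nonarchimedean field, every element closer to `1` than `‖4‖` is a square. -/
theorem isSquare_of_norm_sub_one_lt_norm_four {K : Type*} [NormedField K] [CompleteSpace K]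
    [IsUltrametricDist K] {w : K} (hw : ‖w - 1‖ < ‖(4 : K)‖) : IsSquare w := by
  have h4 : (4 : K) ≠ 0 := norm_pos_iff.mp ((norm_nonneg _).trans_lt hw)
  have hz : ‖(w - 1) / 4‖ < 1 := by
    rw [norm_div]
    exact (div_lt_one (norm_pos_iff.mpr h4)).mpr hw
  obtain ⟨y, hy⟩ := exists_add_sq_eq_of_norm_lt_one hz
  rw [eq_div_iff h4] at hy
  exact ⟨1 + 2 * y, by linear_combination -hy⟩

theorem norm_one_add_eq_one_of_norm_lt_one {K : Type*} [NormedField K] [IsUltrametricDist K]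
    {x : K} (hx : ‖x‖ < 1) : ‖1 + x‖ = 1 := by
  rw [IsUltrametricDist.norm_add_eq_max_of_norm_ne_norm (by simpa using hx.ne'), norm_one]
  exact max_eq_left hx.le

/-- The square class of `1 + u ^ 2 * m ^ 2`, where `m` divides `2` with quotient `lam`, which in
turn divides `m`, and `u ≡ -1` modulo `2`. -/
theorem exists_one_add_sq_mul_sq_eq {K : Type*} [NormedField K] [CompleteSpace K]
    [IsUltrametricDist K] {lam m u : K} (h2 : lam * m = 2) (h20 : (2 : K) ≠ 0)
    (hlam1 : ‖lam‖ < 1) (hm : ‖m‖ ≤ ‖lam‖) (hu : ‖u‖ = 1) (hu1 : ‖u + 1‖ ≤ ‖(2 : K)‖) :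
    ∃ t : K, t ≠ 0 ∧ 1 + u ^ 2 * m ^ 2 = t ^ 2 * (1 + 2 * m) := by
  have hlam0 : 0 < ‖lam‖ := norm_pos_iff.mpr (left_ne_zero_of_mul (h2 ▸ h20))
  have hm0 : 0 < ‖m‖ := norm_pos_iff.mpr (right_ne_zero_of_mul (h2 ▸ h20))
  have hn2 : ‖(2 : K)‖ = ‖lam‖ * ‖m‖ := by rw [← h2, norm_mul]
  have hm1 : ‖m‖ < 1 := hm.trans_lt hlam1
  have hlt : ‖(2 : K)‖ < ‖lam‖ := by
    rw [hn2]
    exact mul_lt_of_lt_one_right hlam0 hm1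
  have hB : ‖1 + 2 * m‖ = 1 := norm_one_add_eq_one_of_norm_lt_one (by
    rw [norm_mul]; nlinarith [norm_nonneg (2 : K)])
  have hum : ‖u * m‖ < 1 := by rwa [norm_mul, hu, one_mul]
  have hC : ‖1 + u * m‖ = 1 := norm_one_add_eq_one_of_norm_lt_one hum
  have hA : ‖1 + u ^ 2 * m ^ 2‖ = 1 := norm_one_add_eq_one_of_norm_lt_one (by
    rw [← mul_pow, norm_pow]; exact pow_lt_one₀ (norm_nonneg _) hum two_ne_zero)
  have hA0 : 1 + u ^ 2 * m ^ 2 ≠ 0 := norm_ne_zero_iff.mp (hA ▸ one_ne_zero)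
  have hB0 : 1 + 2 * m ≠ 0 := norm_ne_zero_iff.mp (hB ▸ one_ne_zero)
  have hC0 : 1 + u * m ≠ 0 := norm_ne_zero_iff.mp (hC ▸ one_ne_zero)
  have hE : ‖u + (1 + u * m) ^ 2‖ < ‖lam‖ := by
    rw [show u + (1 + u * m) ^ 2 = (u + 1) + u * m * (2 + u * m) by ring]
    refine (IsUltrametricDist.norm_add_le_max _ _).trans_lt
      (max_lt (hu1.trans_lt hlt) ?_)
    have : ‖2 + u * m‖ < 1 :=
      (IsUltrametricDist.norm_add_le_max _ _).trans_lt (max_lt (hlt.trans hlam1) hum)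
    rw [norm_mul, norm_mul, hu, one_mul]
    exact (mul_lt_of_lt_one_right hm0 this).trans_le hm
  have hw : ‖(1 + u ^ 2 * m ^ 2) / ((1 + u * m) ^ 2 * (1 + 2 * m)) - 1‖ < ‖(4 : K)‖ := by
    rw [div_sub_one (mul_ne_zero (pow_ne_zero 2 hC0) hB0), norm_div, norm_mul, norm_pow, hC, hB,
      show 1 + u ^ 2 * m ^ 2 - (1 + u * m) ^ 2 * (1 + 2 * m)
        = -(2 * m * (u + (1 + u * m) ^ 2)) by ring,
      show (4 : K) = 2 * m * lam by linear_combination -2 * h2]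
    simp only [norm_neg, norm_mul, one_pow, mul_one, div_one]
    have := norm_pos_iff.mpr h20
    gcongr
  obtain ⟨r, hr⟩ := isSquare_of_norm_sub_one_lt_norm_four hw
  rw [div_eq_iff (mul_ne_zero (pow_ne_zero 2 hC0) hB0)] at hr
  refine ⟨r * (1 + u * m), fun h ↦ hA0 ?_, by rw [hr]; ring⟩
  rw [hr]
  linear_combination (r * (1 + u * m) * (1 + 2 * m)) * h

theorem PadicInt.two_dvd_unit_add_one (u : ℤ_[2]ˣ) : (2 : ℤ_[2]) ∣ u + 1 := by
  have h : ∀ x : ZMod 2, IsUnit x → x + 1 = 0 := by decide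
  have hmem : (u + 1 : ℤ_[2]) ∈ RingHom.ker (PadicInt.toZMod (p := 2)) := by
    rw [RingHom.mem_ker, map_add, map_one]
    exact h _ (u.isUnit.map PadicInt.toZMod)
  rw [PadicInt.ker_toZMod, PadicInt.maximalIdeal_eq_span_p, Ideal.mem_span_singleton] at hmem
  exact_mod_cast hmem

/-- Square-class computation for the residue disk at infinity (Lemma 6.2): in
`L₂ = ℚ₂(2^{1/l})` with `λ^l = 2`, for every 2-adic unit `u` one has
`(2u)⁻² + λ⁻² = s²·(1 + λ^{2l-1})` for some `s ∈ L₂^×`. -/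
theorem stmt10 (l : ℕ) (hl : 3 ≤ l) (hodd : Odd l)
    (L₂ : Type*) [Field L₂] [Algebra ℚ_[2] L₂]
    (lam : L₂) (hlam : lam ^ l = 2) (hdeg : Module.finrank ℚ_[2] L₂ = l)
    (u : ℤ_[2]ˣ) :
    ∃ s : L₂, s ≠ 0 ∧
      ((2 * algebraMap ℚ_[2] L₂ (((u : ℤ_[2]) : ℚ_[2])))⁻¹) ^ 2 + (lam⁻¹) ^ 2 =
        s ^ 2 * (1 + lam ^ (2 * l - 1)) := by
  have hfin : FiniteDimensional ℚ_[2] L₂ := Module.finite_of_finrank_pos (by lia)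
  let : NormedField L₂ := spectralNorm.normedField ℚ_[2] L₂
  have : CompleteSpace L₂ := spectralNorm.completeSpace ℚ_[2] L₂
  have : IsUltrametricDist L₂ :=
    IsUltrametricDist.isUltrametricDist_of_isNonarchimedean_norm
      (isNonarchimedean_spectralNorm (K := ℚ_[2]) (L := L₂))
  have hext (x : ℚ_[2]) : ‖algebraMap ℚ_[2] L₂ x‖ = ‖x‖ := spectralNorm_extends x
  have hn2 : ‖(2 : L₂)‖ = 2⁻¹ := by
    rw [← map_ofNat (algebraMap ℚ_[2] L₂) 2, hext]
    exact Padic.norm_p (p := 2)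
  have h20 : (2 : L₂) ≠ 0 := norm_ne_zero_iff.mp (by rw [hn2]; norm_num)
  have hlam1 : ‖lam‖ < 1 := by
    rw [← pow_lt_one_iff_of_nonneg (norm_nonneg lam) (by lia : l ≠ 0), ← norm_pow, hlam, hn2]
    norm_num
  have hlam0 : lam ≠ 0 := by
    rintro rfl
    exact h20 (by rw [← hlam, zero_pow (by lia)])
  have h2 : lam * lam ^ (l - 1) = 2 := by rw [mul_pow_sub_one (by lia), hlam]
  have hpow : lam ^ (2 * l - 1) = 2 * lam ^ (l - 1) := by
    rw [← hlam, ← pow_add]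
    congr 1
    lia
  have hm : ‖lam ^ (l - 1)‖ ≤ ‖lam‖ := by
    rw [norm_pow]
    exact pow_le_of_le_one (norm_nonneg lam) hlam1.le (by lia)
  set v : L₂ := algebraMap ℚ_[2] L₂ ((u : ℤ_[2]) : ℚ_[2]) with hv
  have hu : ‖v‖ = 1 := by
    rw [hv, hext]
    exact PadicInt.norm_units u
  have hu1 : ‖v + 1‖ ≤ ‖(2 : L₂)‖ := by
    obtain ⟨k, hk⟩ := PadicInt.two_dvd_unit_add_one u
    have hk' : v + 1 = 2 * algebraMap ℚ_[2] L₂ (k : ℚ_[2]) := by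
      rw [hv, ← map_one (algebraMap ℚ_[2] L₂), ← map_ofNat (algebraMap ℚ_[2] L₂) 2, ← map_add,
        ← map_mul]
      congr 1
      exact_mod_cast congrArg ((↑) : ℤ_[2] → ℚ_[2]) hk
    rw [hk', norm_mul, hext]
    exact mul_le_of_le_one_right (norm_nonneg _) k.norm_le_one
  have hv0 : v ≠ 0 := norm_ne_zero_iff.mp (hu ▸ one_ne_zero)
  obtain ⟨t, ht0, ht⟩ := exists_one_add_sq_mul_sq_eq h2 h20 hlam1 hm hu hu1
  refine ⟨t / (2 * v), div_ne_zero ht0 (mul_ne_zero h20 hv0), ?_⟩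
  rw [hpow, div_pow, div_mul_eq_mul_div, ← ht]
  generalize lam ^ (l - 1) = m at h2
  field_simp
  linear_combination (-v ^ 2 * (lam * m + 2)) * h2
end
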